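/- There exists a constant C, depending only on V_F, V_E, g_L, g_in, a and σ_E (but not on q), with the following property: for every classical stationary solution p of the voltage–conductance equation with p > 0 on (0,V_F)×[0,∞), and every q ≥ 4/3 such that d_q := ∫_Ω (g + g_L)²·p(v,g)^q dv dg < ∞ and such that p^q, g²·p^q and ∂_g(p^q) decay to 0 as g → ∞ uniformly in v, one has ∫_Ω (g + g_L)·|∂_g (p(v,g)^{q/2})|² dv dg ≤ C·q·d_q. -/

import Mathlib

open Real MeasureTheory Set Filter

noncomputable section

/-- The voltage flux `J(v,g) = -g_L v + g (V_E - v)`. -/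
def Jflux (VE gL v g : ℝ) : ℝ := -gL * v + g * (VE - v)

/-- The Maxwellian `M(g) = exp(-(g - g_in)^2 / (2a))`. -/
def Mw (gin a g : ℝ) : ℝ := Real.exp (-(g - gin) ^ 2 / (2 * a))

/-- A classical stationary solution of the voltage-conductance equation:
`p : (0,V_F) × [0,∞) → [0,∞)`, C¹ in `v` (with continuous boundary extension) and
C² in `g` up to `g = 0`, satisfying the stationary equation, the no-flux boundary
condition at `g = 0`, the `v`-boundary conditions changing type at `g_F = g_L V_F/(V_E - V_F)`,
the normalization, and decay (uniform in `v`) of `p`, `g² p`, `∂_g p` as `g → ∞`. -/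
structure StatSol (VF VE gL gin a σE : ℝ) (p : ℝ → ℝ → ℝ) : Prop where
  nonneg : ∀ v ∈ Ioo 0 VF, ∀ g ∈ Ici (0:ℝ), 0 ≤ p v g
  cont_v : ∀ g ∈ Ici (0:ℝ), ContinuousOn (fun v => p v g) (Icc 0 VF)
  diff_v : ∀ v ∈ Ioo 0 VF, ∀ g ∈ Ioi (0:ℝ), DifferentiableAt ℝ (fun v' => p v' g) v
  smooth_g : ∀ v ∈ Ioo 0 VF, ContDiffOn ℝ 2 (fun g => p v g) (Ici 0)
  pde : ∀ v ∈ Ioo 0 VF, ∀ g ∈ Ioi (0:ℝ),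
    deriv (fun v' => Jflux VE gL v' g * p v' g) v
      + deriv (fun g' => ((gin - g') / σE) * p v g') g
      - (a / σE) * deriv (deriv (fun g' => p v g')) g = 0
  bc_g : ∀ v ∈ Ioo 0 VF, (0 - gin) * p v 0 + a * deriv (fun g' => p v g') 0 = 0
  bc_v_low : ∀ g ∈ Ioo 0 (gL * VF / (VE - VF)),
    Jflux VE gL 0 g * p 0 g = 0 ∧ Jflux VE gL VF g * p VF g = 0
  bc_v_high : ∀ g ∈ Ici (gL * VF / (VE - VF)),
    Jflux VE gL 0 g * p 0 g = Jflux VE gL VF g * p VF g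
  normalized : ∫ v in Ioo 0 VF, ∫ g in Ioi (0:ℝ), p v g = 1
  decay : ∀ ε > 0, ∃ G : ℝ, ∀ g ∈ Ici G, ∀ v ∈ Ioo 0 VF,
    p v g < ε ∧ g ^ 2 * p v g < ε ∧ |deriv (fun g' => p v g') g| < ε

section
open scoped Topology ENNReal

section

/-- one-dimensional integration by parts -/
lemma ibp1 {x1 x2 : ℝ} (hx : x1 ≤ x2) {K φ φ1 φ2 z Fz Sz B b b1 : ℝ → ℝ}
    (hK : ∀ g ∈ Icc x1 x2, K g ≠ 0)
    (hKc : ContinuousOn K (Icc x1 x2))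
    (hφ : ∀ g ∈ Ioo x1 x2, HasDerivAt φ (φ1 g) g) (hφc : ContinuousOn φ (Icc x1 x2))
    (hφ1 : ∀ g ∈ Ioo x1 x2, HasDerivAt (fun g => K g * φ1 g) (φ2 g) g)
    (hφ1c : ContinuousOn φ1 (Icc x1 x2)) (hφ2c : ContinuousOn φ2 (Icc x1 x2))
    (hz : ∀ g ∈ Ioo x1 x2, HasDerivAt z (Fz g / K g) g) (hzc : ContinuousOn z (Icc x1 x2))
    (hF : ∀ g ∈ Ioo x1 x2, HasDerivAt Fz (Sz g) g) (hFc : ContinuousOn Fz (Icc x1 x2))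
    (hSc : ContinuousOn Sz (Icc x1 x2))
    (hB : ∀ y, HasDerivAt B (b y) y) (hb : ∀ y, HasDerivAt b (b1 y) y) (hb1 : Continuous b1) :
    ∫ g in x1..x2, φ g * b (z g) * Sz g =
      (φ x2 * b (z x2) * Fz x2 - K x2 * φ1 x2 * B (z x2))
      - (φ x1 * b (z x1) * Fz x1 - K x1 * φ1 x1 * B (z x1))
      - (∫ g in x1..x2, φ g * b1 (z g) * (Fz g ^ 2 / K g))
      + ∫ g in x1..x2, φ2 g * B (z g) := by
  have hBc : Continuous B := continuous_iff_continuousAt.2 fun y => (hB y).continuousAt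
  have hbc : Continuous b := continuous_iff_continuousAt.2 fun y => (hb y).continuousAt
  have c1 : ContinuousOn (fun g => φ g * b (z g) * Sz g) (Icc x1 x2) :=
    (hφc.mul (hbc.comp_continuousOn hzc)).mul hSc
  have c2 : ContinuousOn (fun g => φ g * b1 (z g) * (Fz g ^ 2 / K g)) (Icc x1 x2) :=
    (hφc.mul (hb1.comp_continuousOn hzc)).mul ((hFc.pow 2).div hKc hK)
  have c3 : ContinuousOn (fun g => φ2 g * B (z g)) (Icc x1 x2) :=
    hφ2c.mul (hBc.comp_continuousOn hzc)
  have i1 := c1.intervalIntegrable_of_Icc (μ := volume) hx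
  have i2 := c2.intervalIntegrable_of_Icc (μ := volume) hx
  have i3 := c3.intervalIntegrable_of_Icc (μ := volume) hx
  have key := intervalIntegral.integral_eq_sub_of_hasDerivAt_of_le hx
    (f := fun g => φ g * b (z g) * Fz g - (K g * φ1 g) * B (z g))
    (f' := fun g => φ g * b (z g) * Sz g + φ g * b1 (z g) * (Fz g ^ 2 / K g) - φ2 g * B (z g))
    (((hφc.mul (hbc.comp_continuousOn hzc)).mul hFc).sub
      ((hKc.mul hφ1c).mul (hBc.comp_continuousOn hzc)))
    (by
      intro g hg
      have hk := hK g (Ioo_subset_Icc_self hg)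
      have h1 := (((hφ g hg).mul ((hb (z g)).comp g (hz g hg))).mul (hF g hg)).sub
        ((hφ1 g hg).mul ((hB (z g)).comp g (hz g hg)))
      refine h1.congr_deriv ?_
      simp only [Function.comp, Pi.mul_apply]
      field_simp
      ring) ((i1.add i2).sub i3)
  rw [intervalIntegral.integral_sub (i1.add i2) i3, intervalIntegral.integral_add i1 i2] at key
  linarith

/-! ### cutoffs -/
def chi (x : ℝ) : ℝ := smoothTransition (2 - x)

lemma chi_cd : ContDiff ℝ 2 chi := by
  unfold chi
  exact (smoothTransition.contDiff (n := 2)).comp (by fun_prop)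
lemma chi_nonneg (x : ℝ) : 0 ≤ chi x := smoothTransition.nonneg _
lemma chi_le_one (x : ℝ) : chi x ≤ 1 := smoothTransition.le_one _
lemma chi_one {x : ℝ} (h : x ≤ 1) : chi x = 1 := smoothTransition.one_of_one_le (by linarith)
lemma chi_zero {x : ℝ} (h : 2 ≤ x) : chi x = 0 := smoothTransition.zero_of_nonpos (by linarith)
lemma chi_anti : Antitone chi := fun x y h => smoothTransition.monotone (by linarith)
lemma chi_cont : Continuous chi := chi_cd.continuous
def chi1 (x : ℝ) : ℝ := deriv chi x
lemma chi_deriv (x : ℝ) : HasDerivAt chi (chi1 x) x :=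
  (chi_cd.differentiable (by norm_num) x).hasDerivAt
lemma chi1_cont : Continuous chi1 := chi_cd.continuous_deriv (by norm_num)
lemma chi1_nonpos (x : ℝ) : chi1 x ≤ 0 := chi_anti.deriv_nonpos
lemma chi1_low {x : ℝ} (h : x ≤ 1) : chi1 x = 0 := by
  have h1 : HasDerivWithinAt chi (chi1 x) (Iic x) x := (chi_deriv x).hasDerivWithinAt
  have h2 : HasDerivWithinAt chi 0 (Iic x) x := by
    refine (hasDerivWithinAt_const x (Iic x) (1:ℝ)).congr (fun y hy => chi_one (le_trans hy h)) (chi_one h)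
  exact (uniqueDiffWithinAt_Iic x).eq_deriv _ h1 h2
lemma chi1_high {x : ℝ} (h : 2 ≤ x) : chi1 x = 0 := by
  have h1 : HasDerivWithinAt chi (chi1 x) (Ici x) x := (chi_deriv x).hasDerivWithinAt
  have h2 : HasDerivWithinAt chi 0 (Ici x) x := by
    refine (hasDerivWithinAt_const x (Ici x) (0:ℝ)).congr (fun y hy => chi_zero (le_trans h hy)) (chi_zero h)
  exact (uniqueDiffWithinAt_Ici x).eq_deriv _ h1 h2
lemma chi1_bdd : ∃ c : ℝ, 0 ≤ c ∧ ∀ x, |chi1 x| ≤ c := by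
  obtain ⟨c, hc⟩ := (isCompact_Icc (a := (1:ℝ)) (b := 2)).exists_bound_of_continuousOn chi1_cont.continuousOn
  refine ⟨max c 0, le_max_right _ _, fun x => ?_⟩
  rcases le_total x 1 with h | h
  · simp [chi1_low h]
  rcases le_total x 2 with h' | h'
  · exact (hc x ⟨h, h'⟩).trans (le_max_left _ _)
  · simp [chi1_high h']

def bt (j x : ℝ) : ℝ := chi (x / j)
def bt1 (j x : ℝ) : ℝ := chi1 (x / j) / j
def th (j x : ℝ) : ℝ := ∫ y in (0:ℝ)..x, bt j y

lemma bt_cont (j : ℝ) : Continuous (bt j) := chi_cont.comp (continuous_id.div_const j)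
lemma bt1_cont (j : ℝ) : Continuous (bt1 j) := (chi1_cont.comp (continuous_id.div_const j)).div_const j
lemma bt_nonneg (j x : ℝ) : 0 ≤ bt j x := chi_nonneg _
lemma bt_le_one (j x : ℝ) : bt j x ≤ 1 := chi_le_one _
lemma bt_deriv (j x : ℝ) : HasDerivAt (bt j) (bt1 j x) x := by
  have := (chi_deriv (x / j)).comp x ((hasDerivAt_id x).div_const j)
  refine this.congr_deriv ?_
  unfold bt1; ring
lemma th_deriv (j x : ℝ) : HasDerivAt (th j) (bt j x) x :=
  intervalIntegral.integral_hasDerivAt_right ((bt_cont j).intervalIntegrable _ _)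
    ((bt_cont j).stronglyMeasurableAtFilter _ _) (bt_cont j).continuousAt
lemma th_cont (j : ℝ) : Continuous (th j) :=
  continuous_iff_continuousAt.2 fun y => (th_deriv j y).continuousAt
lemma bt_one {j x : ℝ} (hj : 0 < j) (h : x ≤ j) : bt j x = 1 := chi_one ((div_le_one hj).2 h)
lemma bt_zero {j x : ℝ} (hj : 0 < j) (h : 2 * j ≤ x) : bt j x = 0 := chi_zero ((le_div_iff₀ hj).2 h)
lemma bt_anti {j : ℝ} (hj : 0 < j) : Antitone (bt j) := fun x y h => chi_anti (by gcongr)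
lemma bt1_nonpos {j : ℝ} (hj : 0 < j) (x : ℝ) : bt1 j x ≤ 0 :=
  div_nonpos_of_nonpos_of_nonneg (chi1_nonpos _) hj.le
lemma bt1_low {j x : ℝ} (hj : 0 < j) (h : x ≤ j) : bt1 j x = 0 := by
  unfold bt1; rw [chi1_low ((div_le_one hj).2 h)]; simp
lemma bt1_high {j x : ℝ} (hj : 0 < j) (h : 2 * j ≤ x) : bt1 j x = 0 := by
  unfold bt1; rw [chi1_high ((le_div_iff₀ hj).2 h)]; simp
lemma th_zero (j : ℝ) : th j 0 = 0 := by simp [th]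
lemma th_eq {j x : ℝ} (hj : 0 < j) (h0 : 0 ≤ x) (h : x ≤ j) : th j x = x := by
  unfold th
  rw [intervalIntegral.integral_congr (g := fun _ => (1:ℝ))]
  · simp
  · intro y hy
    rw [uIcc_of_le h0] at hy
    exact bt_one hj (hy.2.trans h)
lemma th_mono (j : ℝ) : Monotone (th j) :=
  monotone_of_hasDerivAt_nonneg (fun x => th_deriv j x) (fun x => bt_nonneg j x)
lemma th_nonneg {j x : ℝ} (h0 : 0 ≤ x) : 0 ≤ th j x := th_zero j ▸ th_mono j h0
lemma th_lip (j : ℝ) : LipschitzWith 1 (th j) := by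
  refine lipschitzWith_of_nnnorm_deriv_le (fun x => (th_deriv j x).differentiableAt) fun x => ?_
  rw [(th_deriv j x).deriv, ← NNReal.coe_le_coe, coe_nnnorm, Real.norm_eq_abs,
    abs_of_nonneg (bt_nonneg _ _)]
  exact bt_le_one _ _
lemma th_abs (j x y : ℝ) : |th j x - th j y| ≤ |x - y| := by
  have := (th_lip j).dist_le_mul x y
  simpa [Real.dist_eq] using this
lemma th_le {j x : ℝ} (h0 : 0 ≤ x) : th j x ≤ x := by
  have := th_abs j x 0
  rw [th_zero, sub_zero, sub_zero, abs_of_nonneg h0, abs_of_nonneg (th_nonneg h0)] at this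
  exact this
lemma th_le_two {j x : ℝ} (hj : 0 < j) (h0 : 0 ≤ x) : th j x ≤ 2 * j := by
  rcases le_total x (2*j) with h | h
  · exact (th_le h0).trans h
  · have : th j x = th j (2*j) := by
      unfold th
      rw [← intervalIntegral.integral_add_adjacent_intervals
        ((bt_cont j).intervalIntegrable 0 (2*j)) ((bt_cont j).intervalIntegrable (2*j) x)]
      rw [intervalIntegral.integral_congr (a := 2*j) (g := fun _ => (0:ℝ))]
      · simp
      · intro y hy
        rw [uIcc_of_le h] at hy
        exact bt_zero hj hy.1
    rw [this]; exact th_le (by positivity)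
/-- `κ = θ - β p ≥ 0` -/
lemma bt_mul_le {j x : ℝ} (hj : 0 < j) (h0 : 0 ≤ x) : bt j x * x ≤ th j x := by
  unfold th
  have : ∫ y in (0:ℝ)..x, bt j x = bt j x * x := by simp; ring
  rw [← this]
  exact intervalIntegral.integral_mono_on h0 (by simp) ((bt_cont j).intervalIntegrable _ _)
    (fun y hy => bt_anti hj hy.2)
lemma th_mono_j {j k x : ℝ} (hk : 0 < k) (hkj : k ≤ j) (h0 : 0 ≤ x) : th k x ≤ th j x := by
  unfold th
  refine intervalIntegral.integral_mono_on h0 ((bt_cont k).intervalIntegrable _ _)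
    ((bt_cont j).intervalIntegrable _ _) (fun y hy => chi_anti ?_)
  exact div_le_div_of_nonneg_left hy.1 hk hkj
/-- bounds on `bt1` by the exponential weight -/
lemma bt1_exp {j : ℝ} (hj : 0 < j) : ∃ c : ℝ, 0 ≤ c ∧ ∀ x, |bt1 j x| ≤ c * exp (-x) := by
  obtain ⟨c, hc, h⟩ := chi1_bdd
  refine ⟨c / j * exp (2*j), by positivity, fun x => ?_⟩
  rcases le_total (2*j) x with hx | hx
  · rw [bt1_high hj hx]; simp; positivity
  · rw [mul_assoc, ← exp_add]
    calc |bt1 j x| = |chi1 (x/j)| / j := by unfold bt1; rw [abs_div, abs_of_pos hj]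
      _ ≤ c / j * 1 := by rw [mul_one]; gcongr; exact h _
      _ ≤ _ := by gcongr; exact one_le_exp (by linarith)
lemma bt_exp {j : ℝ} (hj : 0 < j) : ∃ c : ℝ, 0 ≤ c ∧ ∀ x, (bt j x)^2 ≤ c * exp (-x) := by
  refine ⟨exp (2*j), by positivity, fun x => ?_⟩
  rcases le_total (2*j) x with hx | hx
  · rw [bt_zero hj hx]; simp; positivity
  · rw [← exp_add]
    have h1 : (bt j x)^2 ≤ 1 := pow_le_one₀ (bt_nonneg _ _) (bt_le_one _ _)
    exact h1.trans (one_le_exp (by linarith))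

/-- convex cutoff -/
lemma exists_cvx (c ε : ℝ) (hc : 0 ≤ c) (hε : 0 < ε) : ∃ B b b1 : ℝ → ℝ,
    (∀ y, HasDerivAt B (b y) y) ∧ (∀ y, HasDerivAt b (b1 y) y) ∧ Continuous b1 ∧
    (∀ y, 0 ≤ b y) ∧ (∀ y, b y ≤ 1) ∧ (∀ y, 0 ≤ b1 y) ∧ (∀ y ≤ c, b y = 0) ∧ (∀ y ≤ c, B y = 0) ∧
    (∀ y, 0 ≤ B y) ∧ (∀ y, y - c - ε ≤ B y) ∧ (∀ y, B y ≤ |y|) := by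
  set b : ℝ → ℝ := fun y => smoothTransition ((y - c)/ε) with hb
  have bcd : ContDiff ℝ 2 b := (smoothTransition.contDiff (n := 2)).comp (by fun_prop)
  have bd : ∀ y, HasDerivAt b (deriv b y) y := fun y => (bcd.differentiable (by norm_num) y).hasDerivAt
  have bm : Monotone b := fun x y h => smoothTransition.monotone (by gcongr)
  have b0 : ∀ y, 0 ≤ b y := fun y => smoothTransition.nonneg _
  have b1 : ∀ y, b y ≤ 1 := fun y => smoothTransition.le_one _
  have bz : ∀ y ≤ c, b y = 0 := fun y hy => smoothTransition.zero_of_nonpos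
    (div_nonpos_of_nonpos_of_nonneg (by linarith) hε.le)
  set B : ℝ → ℝ := fun y => ∫ s in c..y, b s with hBdef
  have Bd : ∀ y, HasDerivAt B (b y) y := fun y =>
    intervalIntegral.integral_hasDerivAt_right (bcd.continuous.intervalIntegrable _ _)
      (bcd.continuous.stronglyMeasurableAtFilter _ _) bcd.continuous.continuousAt
  have Bm : Monotone B := monotone_of_hasDerivAt_nonneg Bd b0
  have Bz : ∀ y ≤ c, B y = 0 := by
    intro y hy
    simp only [hBdef]
    rw [intervalIntegral.integral_congr (g := fun _ => (0:ℝ))]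
    · simp
    · intro s hs; rw [uIcc_of_ge hy] at hs; exact bz s hs.2
  have Bn : ∀ y, 0 ≤ B y := by
    intro y
    rcases le_total y c with h | h
    · rw [Bz y h]
    · have := Bm h; rwa [Bz c le_rfl] at this
  refine ⟨B, b, deriv b, Bd, bd, bcd.continuous_deriv (by norm_num), b0, b1, fun y => bm.deriv_nonneg,
    bz, Bz, Bn, ?_, ?_⟩
  · intro y
    rcases le_total y (c+ε) with h | h
    · linarith [Bn y]
    · have e : B y = B (c+ε) + ∫ s in (c+ε)..y, b s := by
        simp only [hBdef]
        rw [intervalIntegral.integral_add_adjacent_intervals] <;>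
          exact bcd.continuous.intervalIntegrable _ _
      have : ∫ s in (c+ε)..y, b s = ∫ s in (c+ε)..y, (1:ℝ) := by
        apply intervalIntegral.integral_congr
        intro s hs; rw [uIcc_of_le h] at hs
        refine smoothTransition.one_of_one_le ?_
        rw [le_div_iff₀ hε]; linarith [hs.1]
      rw [e, this]; simp; linarith [Bn (c+ε)]
  · intro y
    rcases le_total y c with h | h
    · rw [Bz y h]; positivity
    · have : B y ≤ ∫ s in c..y, (1:ℝ) :=
        intervalIntegral.integral_mono_on h (bcd.continuous.intervalIntegrable _ _) (by simp) (fun s _ => b1 s)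
      simp at this
      have := le_abs_self y; linarith

end

section

def gapLo (Q : Set ℝ) (a v : ℝ) : ℝ := sSup (Q ∩ Iic (max v a))
def gapUp (Q : Set ℝ) (b v : ℝ) : ℝ := sInf (Q ∩ Ici (min v b))

section gap
variable {Q : Set ℝ} {a b : ℝ}

lemma gapLo_mono (ha : a ∈ Q) : Monotone (gapLo Q a) := by
  intro v w h
  refine csSup_le_csSup ⟨max w a, fun x hx => hx.2⟩ ⟨a, ha, mem_Iic.2 (le_max_right _ _)⟩ ?_
  exact inter_subset_inter_right _ (Iic_subset_Iic.2 (max_le_max_right _ h))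
lemma gapUp_mono (hb : b ∈ Q) : Monotone (gapUp Q b) := by
  intro v w h
  refine csInf_le_csInf ⟨min v b, fun x hx => hx.2⟩ ⟨b, hb, mem_Ici.2 (min_le_right _ _)⟩ ?_
  exact inter_subset_inter_right _ (Ici_subset_Ici.2 (min_le_min_right _ h))
lemma gapLo_mem (hQ : IsClosed Q) (ha : a ∈ Q) (v : ℝ) : gapLo Q a v ∈ Q ∩ Iic (max v a) :=
  (hQ.inter isClosed_Iic).csSup_mem ⟨a, ha, mem_Iic.2 (le_max_right _ _)⟩ ⟨max v a, fun x hx => hx.2⟩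
lemma gapUp_mem (hQ : IsClosed Q) (hb : b ∈ Q) (v : ℝ) : gapUp Q b v ∈ Q ∩ Ici (min v b) :=
  (hQ.inter isClosed_Ici).csInf_mem ⟨b, hb, mem_Ici.2 (min_le_right _ _)⟩ ⟨min v b, fun x hx => hx.2⟩
lemma gapLo_le (hQ : IsClosed Q) (ha : a ∈ Q) {v : ℝ} (h : a ≤ v) : gapLo Q a v ≤ v := by
  have := (gapLo_mem hQ ha v).2; rwa [max_eq_left h] at this
lemma le_gapUp (hQ : IsClosed Q) (hb : b ∈ Q) {v : ℝ} (h : v ≤ b) : v ≤ gapUp Q b v := by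
  have := (gapUp_mem hQ hb v).2; rwa [min_eq_left h] at this
lemma le_gapLo {v w : ℝ} (hw : w ∈ Q) (h : w ≤ v) : w ≤ gapLo Q a v :=
  le_csSup ⟨max v a, fun _ hx => hx.2⟩ ⟨hw, h.trans (le_max_left _ _)⟩
lemma gapUp_le {v w : ℝ} (hw : w ∈ Q) (h : v ≤ w) : gapUp Q b v ≤ w :=
  csInf_le ⟨min v b, fun _ hx => hx.2⟩ ⟨hw, (min_le_left _ _).trans h⟩
lemma gapLo_self (hQ : IsClosed Q) (ha : a ∈ Q) {v : ℝ} (h : a ≤ v) (hv : v ∈ Q) : gapLo Q a v = v :=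
  le_antisymm (gapLo_le hQ ha h) (le_gapLo hv le_rfl)
lemma gapUp_self (hQ : IsClosed Q) (hb : b ∈ Q) {v : ℝ} (h : v ≤ b) (hv : v ∈ Q) : gapUp Q b v = v :=
  le_antisymm (gapUp_le hv le_rfl) (le_gapUp hQ hb h)
lemma gapLo_lt (hQ : IsClosed Q) (ha : a ∈ Q) {v : ℝ} (h : a ≤ v) (hv : v ∉ Q) : gapLo Q a v < v :=
  lt_of_le_of_ne (gapLo_le hQ ha h) (fun e => hv (e ▸ (gapLo_mem hQ ha v).1))
lemma lt_gapUp (hQ : IsClosed Q) (hb : b ∈ Q) {v : ℝ} (h : v ≤ b) (hv : v ∉ Q) : v < gapUp Q b v :=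
  lt_of_le_of_ne (le_gapUp hQ hb h) (fun e => hv (e ▸ (gapUp_mem hQ hb v).1))
lemma gap_not_mem {v w : ℝ} (h1 : gapLo Q a v < w) (h2 : w < gapUp Q b v) :
    w ∉ Q := by
  intro hw
  rcases le_total w v with h | h
  · exact absurd (le_gapLo (a := a) hw h) (not_le.2 h1)
  · exact absurd (gapUp_le (b := b) hw h) (not_le.2 h2)
lemma gap_Lo_eq (hQ : IsClosed Q) (ha : a ∈ Q) {v w : ℝ} (hv : v ∈ Icc a b)
    (h1 : gapLo Q a v < w) (h2 : w < gapUp Q b v) : gapLo Q a w = gapLo Q a v := by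
  have hl : a ≤ gapLo Q a v := le_gapLo ha hv.1
  have hw : a ≤ w := hl.trans h1.le
  refine le_antisymm ?_ (le_gapLo (gapLo_mem hQ ha v).1 h1.le)
  by_contra hh
  push Not at hh
  exact gap_not_mem (b := b) hh ((gapLo_le hQ ha hw).trans_lt h2) (gapLo_mem hQ ha w).1
lemma gap_Up_eq (hQ : IsClosed Q) (hb : b ∈ Q) {v w : ℝ} (hv : v ∈ Icc a b)
    (h1 : gapLo Q a v < w) (h2 : w < gapUp Q b v) : gapUp Q b w = gapUp Q b v := by
  have hl : gapUp Q b v ≤ b := gapUp_le hb hv.2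
  have hw : w ≤ b := h2.le.trans hl
  refine le_antisymm (gapUp_le (gapUp_mem hQ hb v).1 h2.le) ?_
  by_contra hh
  push Not at hh
  exact gap_not_mem (a := a) (h1.trans_le (le_gapUp hQ hb hw)) hh (gapUp_mem hQ hb w).1

/-- slope over the gap containing `v` -/
def gapSlope (Q : Set ℝ) (a b : ℝ) (f : ℝ → ℝ) (v : ℝ) : ℝ :=
  (f (gapUp Q b v) - f (gapLo Q a v)) / (gapUp Q b v - gapLo Q a v)

def gapInterp (Q : Set ℝ) (a b : ℝ) (f : ℝ → ℝ) (v : ℝ) : ℝ :=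
  f (gapLo Q a v) + (v - gapLo Q a v) * gapSlope Q a b f v

lemma gapInterp_self (hQ : IsClosed Q) (ha : a ∈ Q) {v : ℝ} (h : a ≤ v) (hv : v ∈ Q) (f : ℝ → ℝ) :
    gapInterp Q a b f v = f v := by
  unfold gapInterp; rw [gapLo_self hQ ha h hv]; ring

lemma gapInterp_eq (hQ : IsClosed Q) (ha : a ∈ Q) (hb : b ∈ Q) {v w : ℝ} (hv : v ∈ Icc a b)
    (h1 : gapLo Q a v < w) (h2 : w < gapUp Q b v) (f : ℝ → ℝ) :
    gapInterp Q a b f w = f (gapLo Q a v) + (w - gapLo Q a v) * gapSlope Q a b f v := by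
  unfold gapInterp gapSlope
  rw [gap_Lo_eq hQ ha hv h1 h2, gap_Up_eq hQ hb hv h1 h2]

/-- the convexity estimate -/
lemma gapInterp_est (hQ : IsClosed Q) (ha : a ∈ Q) (hb : b ∈ Q) {v x : ℝ} (f : ℝ → ℝ) (hx : x ∈ Icc a b)
    (hv : v ∈ Q) {f' ε : ℝ}
    (h1 : |f (gapLo Q a x) - f v - f' * (gapLo Q a x - v)| ≤ ε * |gapLo Q a x - v|)
    (h2 : |f (gapUp Q b x) - f v - f' * (gapUp Q b x - v)| ≤ ε * |gapUp Q b x - v|) :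
    |gapInterp Q a b f x - f v - f' * (x - v)| ≤ ε * |x - v| := by
  by_cases hxQ : x ∈ Q
  · rw [gapInterp_self hQ ha hx.1 hxQ]
    rwa [gapLo_self hQ ha hx.1 hxQ] at h1
  have l1 := gapLo_lt hQ ha hx.1 hxQ
  have l2 := lt_gapUp hQ hb hx.2 hxQ
  unfold gapInterp gapSlope
  have hLv : (v ≤ gapLo Q a x) ∨ (gapUp Q b x ≤ v) := by
    rcases le_total v x with h | h
    · exact Or.inl (le_gapLo hv h)
    · exact Or.inr (gapUp_le hv h)
  set l := gapLo Q a x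
  set u := gapUp Q b x
  have hlu : 0 < u - l := by linarith
  set t := (x - l)/(u - l) with ht
  have t0 : 0 ≤ t := div_nonneg (by linarith) hlu.le
  have t1 : t ≤ 1 := (div_le_one hlu).2 (by linarith)
  have hxe : x = (1 - t) * l + t * u := by rw [ht]; field_simp; ring
  have e : f l + (x - l) * ((f u - f l)/(u - l)) - f v - f' * (x - v) =
      (1 - t) * (f l - f v - f' * (l - v)) + t * (f u - f v - f' * (u - v)) := by
    have : (x - l) * ((f u - f l)/(u - l)) = t * (f u - f l) := by rw [ht]; ring
    rw [this]
    have : f' * (x - v) = (1-t) * (f' * (l - v)) + t * (f' * (u - v)) := by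
      conv_lhs => rw [hxe]
      ring
    rw [this]; ring
  rw [e]
  have key : |x - v| = (1 - t) * |l - v| + t * |u - v| := by
    rcases hLv with h | h
    · rw [abs_of_nonneg (by linarith : 0 ≤ x - v), abs_of_nonneg (by linarith : 0 ≤ l - v),
        abs_of_nonneg (by linarith : 0 ≤ u - v)]
      conv_lhs => rw [hxe]
      ring
    · rw [abs_of_nonpos (by linarith : x - v ≤ 0), abs_of_nonpos (by linarith : l - v ≤ 0),
        abs_of_nonpos (by linarith : u - v ≤ 0)]
      conv_lhs => rw [hxe]
      ring
  rw [key]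
  calc _ ≤ |(1 - t) * (f l - f v - f' * (l - v))| + |t * (f u - f v - f' * (u - v))| := abs_add_le _ _
    _ = (1-t) * |f l - f v - f' * (l - v)| + t * |f u - f v - f' * (u - v)| := by
        rw [abs_mul, abs_mul, abs_of_nonneg t0, abs_of_nonneg (by linarith : 0 ≤ 1 - t)]
    _ ≤ (1-t) * (ε * |l - v|) + t * (ε * |u - v|) := by
        have : 0 ≤ 1 - t := by linarith
        gcongr
    _ = _ := by ring

lemma gapInterp_right (hQ : IsClosed Q) (hQs : Q ⊆ Icc a b) (ha : a ∈ Q) (hb : b ∈ Q) {v f' : ℝ} (f : ℝ → ℝ)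
    (hv : v ∈ Q) (hd : HasDerivAt f f' v) (hn : 𝓝[Q ∩ Ioi v] v ≠ ⊥) :
    HasDerivWithinAt (gapInterp Q a b f) f' (Ici v) v := by
  have hvab := hQs hv
  rw [hasDerivWithinAt_iff_isLittleO, Asymptotics.isLittleO_iff]
  intro ε hε
  have hd' := hasDerivAt_iff_isLittleO.1 hd
  rw [Asymptotics.isLittleO_iff] at hd'
  obtain ⟨δ, hδ, H⟩ := Metric.eventually_nhds_iff.1 (hd' hε)
  have : (𝓝[Q ∩ Ioi v] v).NeBot := ⟨hn⟩
  have : ∃ q, q ∈ Q ∩ Ioi v ∧ dist q v < δ :=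
    ((self_mem_nhdsWithin (a := v) (s := Q ∩ Ioi v)) |> fun h1 =>
      (Filter.Eventually.and h1 (mem_nhdsWithin_of_mem_nhds (Metric.ball_mem_nhds v hδ)))).exists
  obtain ⟨q, ⟨hq, hqv⟩, hqd⟩ := this
  have hqv' : v < q := hqv
  rw [Real.dist_eq, abs_of_pos (sub_pos.2 hqv')] at hqd
  have hmem : Ico v q ∈ 𝓝[≥] v := Ico_mem_nhdsGE hqv
  filter_upwards [hmem] with x hx
  have hxab : x ∈ Icc a b := ⟨hvab.1.trans hx.1, hx.2.le.trans (hQs hq).2⟩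
  rw [gapInterp_self hQ ha hvab.1 hv]
  have l1 := gapLo_le hQ ha hxab.1
  have l2 : v ≤ gapLo Q a x := le_gapLo hv hx.1
  have u1 := le_gapUp hQ hb hxab.2
  have u2 : gapUp Q b x ≤ q := gapUp_le hq hx.2.le
  have := gapInterp_est hQ ha hb f hxab hv (f' := f') (ε := ε)
    (by
      have := @H (gapLo Q a x) (by rw [Real.dist_eq, abs_of_nonneg (by linarith)]; linarith [hx.2])
      simpa [mul_comm] using this)
    (by
      have := @H (gapUp Q b x) (by rw [Real.dist_eq, abs_of_nonneg (by linarith [hx.1])]; linarith [hx.2])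
      simpa [mul_comm] using this)
  simpa [mul_comm] using this

lemma gapInterp_left (hQ : IsClosed Q) (hQs : Q ⊆ Icc a b) (ha : a ∈ Q) (hb : b ∈ Q) {v f' : ℝ} (f : ℝ → ℝ)
    (hv : v ∈ Q) (hd : HasDerivAt f f' v) (hn : 𝓝[Q ∩ Iio v] v ≠ ⊥) :
    HasDerivWithinAt (gapInterp Q a b f) f' (Iic v) v := by
  have hvab := hQs hv
  rw [hasDerivWithinAt_iff_isLittleO, Asymptotics.isLittleO_iff]
  intro ε hε
  have hd' := hasDerivAt_iff_isLittleO.1 hd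
  rw [Asymptotics.isLittleO_iff] at hd'
  obtain ⟨δ, hδ, H⟩ := Metric.eventually_nhds_iff.1 (hd' hε)
  have : (𝓝[Q ∩ Iio v] v).NeBot := ⟨hn⟩
  have : ∃ q, q ∈ Q ∩ Iio v ∧ dist q v < δ :=
    ((self_mem_nhdsWithin (a := v) (s := Q ∩ Iio v)) |> fun h1 =>
      (Filter.Eventually.and h1 (mem_nhdsWithin_of_mem_nhds (Metric.ball_mem_nhds v hδ)))).exists
  obtain ⟨q, ⟨hq, hqv⟩, hqd⟩ := this
  have hqv' : q < v := hqv
  rw [Real.dist_eq, abs_of_neg (sub_neg.2 hqv')] at hqd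
  have hmem : Ioc q v ∈ 𝓝[≤] v := Ioc_mem_nhdsLE hqv
  filter_upwards [hmem] with x hx
  have hxab : x ∈ Icc a b := ⟨(hQs hq).1.trans hx.1.le, hx.2.trans hvab.2⟩
  rw [gapInterp_self hQ ha hvab.1 hv]
  have l1 := gapLo_le hQ ha hxab.1
  have l2 : q ≤ gapLo Q a x := le_gapLo hq hx.1.le
  have u1 := le_gapUp hQ hb hxab.2
  have u2 : gapUp Q b x ≤ v := gapUp_le hv hx.2
  have := gapInterp_est hQ ha hb f hxab hv (f' := f') (ε := ε)
    (by
      have := @H (gapLo Q a x) (by rw [Real.dist_eq, abs_of_nonpos (by linarith [hx.2])]; linarith [hx.2])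
      simpa [mul_comm] using this)
    (by
      have := @H (gapUp Q b x) (by rw [Real.dist_eq, abs_of_nonpos (by linarith [hx.1])]; linarith [hx.1])
      simpa [mul_comm] using this)
  simpa [mul_comm] using this

lemma gapInterp_right_cont (hQ : IsClosed Q) (hQs : Q ⊆ Icc a b) (ha : a ∈ Q) (hb : b ∈ Q) {v : ℝ} (f : ℝ → ℝ)
    (hv : v ∈ Q) (hvb : v < b) (hn : 𝓝[Q ∩ Ioi v] v = ⊥) :
    ContinuousWithinAt (gapInterp Q a b f) (Ici v) v := by
  have hvab := hQs hv
  rw [← empty_mem_iff_bot, mem_nhdsWithin_iff_exists_mem_nhds_inter] at hn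
  obtain ⟨s, hs, hse⟩ := hn
  obtain ⟨y, hxy, hy⟩ := exists_Ico_subset_of_mem_nhds hs ⟨b, hvb⟩
  obtain ⟨w, hw1, hw2⟩ := exists_between (lt_min hxy hvb)
  have hwab : w ∈ Icc a b := ⟨hvab.1.trans hw1.le, hw2.le.trans (min_le_right _ _)⟩
  have hno : ∀ x, v < x → x < y → x ∉ Q := fun x h1 h2 h3 => hse ⟨hy ⟨h1.le, h2⟩, h3, h1⟩
  have hwy : w < y := hw2.trans_le (min_le_left _ _)
  have hl : gapLo Q a w = v := by
    refine le_antisymm ?_ (le_gapLo hv hw1.le)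
    by_contra hh; push Not at hh
    exact hno _ hh ((gapLo_le hQ ha hwab.1).trans_lt hwy) (gapLo_mem hQ ha w).1
  have hu : w < gapUp Q b w := lt_gapUp hQ hb hwab.2 (hno w hw1 hwy)
  have haff : ContinuousWithinAt (fun x => f v + (x - v) * gapSlope Q a b f w) (Ici v) v := by
    fun_prop
  refine haff.congr_of_eventuallyEq ?_ ?_
  · filter_upwards [Ico_mem_nhdsGE hw1] with x hx
    rcases eq_or_lt_of_le hx.1 with h | h
    · rw [← h, gapInterp_self hQ ha hvab.1 hv]; simp
    · rw [gapInterp_eq hQ ha hb hwab (by rw [hl]; exact h) (hx.2.trans hu), hl]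
  · rw [gapInterp_self hQ ha hvab.1 hv]; simp

lemma gapInterp_left_cont (hQ : IsClosed Q) (hQs : Q ⊆ Icc a b) (ha : a ∈ Q) (hb : b ∈ Q) {v : ℝ} (f : ℝ → ℝ)
    (hv : v ∈ Q) (hva : a < v) (hn : 𝓝[Q ∩ Iio v] v = ⊥) :
    ContinuousWithinAt (gapInterp Q a b f) (Iic v) v := by
  have hvab := hQs hv
  rw [← empty_mem_iff_bot, mem_nhdsWithin_iff_exists_mem_nhds_inter] at hn
  obtain ⟨s, hs, hse⟩ := hn
  obtain ⟨y, hxy, hy⟩ := exists_Ioc_subset_of_mem_nhds hs ⟨a, hva⟩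
  obtain ⟨w, hw2, hw1⟩ := exists_between (max_lt hxy hva)
  have hwab : w ∈ Icc a b := ⟨(le_max_right _ _).trans hw2.le, hw1.le.trans hvab.2⟩
  have hno : ∀ x, x < v → y < x → x ∉ Q := fun x h1 h2 h3 => hse ⟨hy ⟨h2, h1.le⟩, h3, h1⟩
  have hwy : y < w := (le_max_left _ _).trans_lt hw2
  have hu : gapUp Q b w = v := by
    refine le_antisymm (gapUp_le hv hw1.le) ?_
    by_contra hh; push Not at hh
    exact hno _ hh (hwy.trans_le (le_gapUp hQ hb hwab.2)) (gapUp_mem hQ hb w).1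
  have hl : gapLo Q a w < w := gapLo_lt hQ ha hwab.1 (hno w hw1 hwy)
  have haff : ContinuousWithinAt (fun x => f (gapLo Q a w) + (x - gapLo Q a w) * gapSlope Q a b f w) (Iic v) v := by
    fun_prop
  have hval : f v = f (gapLo Q a w) + (v - gapLo Q a w) * gapSlope Q a b f w := by
    unfold gapSlope; rw [hu]
    have : v - gapLo Q a w ≠ 0 := by linarith
    field_simp; ring
  refine haff.congr_of_eventuallyEq ?_ ?_
  · filter_upwards [Ioc_mem_nhdsLE hw1] with x hx
    rcases eq_or_lt_of_le hx.2 with h | h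
    · rw [h, gapInterp_self hQ ha hvab.1 hv, ← hval]
    · rw [gapInterp_eq hQ ha hb hwab (hl.trans hx.1) (by rw [hu]; exact h)]
  · rw [gapInterp_self hQ ha hvab.1 hv, ← hval]

theorem gap_ftc (hQ : IsClosed Q) (hQs : Q ⊆ Icc a b) (ha : a ∈ Q) (hb : b ∈ Q) (f f' d : ℝ → ℝ)
    (hd : ∀ v ∈ Q, HasDerivAt f (f' v) v)
    (hdQ : ∀ v ∈ Q, d v = f' v) (hdU : ∀ v ∈ Ioo a b \ Q, d v = gapSlope Q a b f v)
    (hi : IntervalIntegrable d volume a b) : ∫ v in a..b, d v = f b - f a := by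
  have hab : a ≤ b := (hQs ha).2
  have key := MeasureTheory.integral_eq_of_hasDerivAt_off_countable_of_le (gapInterp Q a b f) d hab
    (s := {x ∈ Q | 𝓝[Q ∩ Ioi x] x = ⊥} ∪ {x ∈ Q | 𝓝[Q ∩ Iio x] x = ⊥})
    (countable_setOfPred_isolated_right_within.union countable_setOfPred_isolated_left_within)
    ?_ ?_ hi
  · rw [key, gapInterp_self hQ ha hab hb, gapInterp_self hQ ha le_rfl ha]
  · intro v hv
    by_cases hvQ : v ∈ Q
    · have hR : ContinuousWithinAt (gapInterp Q a b f) (Icc a b ∩ Ici v) v := by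
        rcases eq_or_lt_of_le hv.2 with h | h
        · refine (continuousWithinAt_singleton (x := v)).mono ?_
          rintro x ⟨hx1, hx2⟩
          have : v ≤ x := hx2
          exact le_antisymm (by linarith [hx1.2]) this
        · by_cases hn : 𝓝[Q ∩ Ioi v] v = ⊥
          · exact (gapInterp_right_cont hQ hQs ha hb f hvQ h hn).mono inter_subset_right
          · exact (gapInterp_right hQ hQs ha hb f hvQ (hd v hvQ) hn).continuousWithinAt.mono inter_subset_right
      have hL : ContinuousWithinAt (gapInterp Q a b f) (Icc a b ∩ Iic v) v := by
        rcases eq_or_lt_of_le hv.1 with h | h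
        · refine (continuousWithinAt_singleton (x := v)).mono ?_
          rintro x ⟨hx1, hx2⟩
          have : x ≤ v := hx2
          exact le_antisymm this (by linarith [hx1.1])
        · by_cases hn : 𝓝[Q ∩ Iio v] v = ⊥
          · exact (gapInterp_left_cont hQ hQs ha hb f hvQ h hn).mono inter_subset_right
          · exact (gapInterp_left hQ hQs ha hb f hvQ (hd v hvQ) hn).continuousWithinAt.mono inter_subset_right
      refine (hL.union hR).mono ?_
      intro x hx
      rcases le_total x v with h | h
      · exact Or.inl ⟨hx, h⟩
      · exact Or.inr ⟨hx, h⟩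
    · have haff : ContinuousAt (fun x => f (gapLo Q a v) + (x - gapLo Q a v) * gapSlope Q a b f v) v := by
        fun_prop
      refine (haff.congr ?_).continuousWithinAt
      filter_upwards [Ioo_mem_nhds (gapLo_lt hQ ha hv.1 hvQ) (lt_gapUp hQ hb hv.2 hvQ)] with x hx
      rw [gapInterp_eq hQ ha hb hv hx.1 hx.2]
  · rintro v ⟨hv, hvs⟩
    have hv' := Ioo_subset_Icc_self hv
    by_cases hvQ : v ∈ Q
    · have h1 : 𝓝[Q ∩ Ioi v] v ≠ ⊥ := fun h => hvs (Or.inl ⟨hvQ, h⟩)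
      have h2 : 𝓝[Q ∩ Iio v] v ≠ ⊥ := fun h => hvs (Or.inr ⟨hvQ, h⟩)
      rw [hdQ v hvQ]
      have := (gapInterp_left hQ hQs ha hb f hvQ (hd v hvQ) h2).union
        (gapInterp_right hQ hQs ha hb f hvQ (hd v hvQ) h1)
      rw [Iic_union_Ici] at this
      exact this.hasDerivAt univ_mem
    · rw [hdU v ⟨hv, hvQ⟩]
      have haff : HasDerivAt (fun x => f (gapLo Q a v) + (x - gapLo Q a v) * gapSlope Q a b f v)
          (gapSlope Q a b f v) v := by
        have := (((hasDerivAt_id v).sub_const (gapLo Q a v)).mul_const (gapSlope Q a b f v)).const_add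
          (f (gapLo Q a v))
        simpa using this
      refine haff.congr_of_eventuallyEq ?_
      filter_upwards [Ioo_mem_nhds (gapLo_lt hQ ha hv'.1 hvQ) (lt_gapUp hQ hb hv'.2 hvQ)] with x hx
      rw [gapInterp_eq hQ ha hb hv' hx.1 hx.2]

theorem gap_avg (hQ : IsClosed Q) (ha : a ∈ Q) (hb : b ∈ Q) (f : ℝ → ℝ≥0∞) (hf : Measurable f) :
    ∫⁻ v in Ioo a b \ Q, ENNReal.ofReal (1 / (gapUp Q b v - gapLo Q a v)) *
      ∫⁻ w in Ioo (gapLo Q a v) (gapUp Q b v), f w = ∫⁻ v in Ioo a b \ Q, f v := by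
  set U := Ioo a b \ Q with hU
  have hUm : MeasurableSet U := measurableSet_Ioo.diff hQ.measurableSet
  have mlo : Measurable (gapLo Q a) := (gapLo_mono ha).measurable
  have mup : Measurable (gapUp Q b) := (gapUp_mono hb).measurable
  set T : Set (ℝ × ℝ) := {x | gapLo Q a x.1 < x.2 ∧ x.2 < gapUp Q b x.1} with hT
  have hTm : MeasurableSet T :=
    (measurableSet_lt (mlo.comp measurable_fst) measurable_snd).inter
      (measurableSet_lt measurable_snd (mup.comp measurable_fst))
  have hsub : ∀ v ∈ U, ∀ w, (v, w) ∈ T → w ∈ U ∧ gapLo Q a w = gapLo Q a v ∧ gapUp Q b w = gapUp Q b v := by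
    intro v hv w hw
    have hv' := Ioo_subset_Icc_self hv.1
    refine ⟨⟨⟨?_, ?_⟩, gap_not_mem hw.1 hw.2⟩, gap_Lo_eq hQ ha hv' hw.1 hw.2, gap_Up_eq hQ hb hv' hw.1 hw.2⟩
    · exact (le_gapLo ha hv'.1).trans_lt hw.1
    · exact hw.2.trans_le (gapUp_le hb hv'.2)
  have hsym : ∀ v ∈ U, ∀ w ∈ U, (v, w) ∈ T → (w, v) ∈ T := by
    intro v hv w hw h
    obtain ⟨_, e1, e2⟩ := hsub v hv w h
    have hv' := Ioo_subset_Icc_self hv.1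
    refine ⟨?_, ?_⟩
    · show gapLo Q a w < v
      rw [e1]; exact gapLo_lt hQ ha hv'.1 hv.2
    · show v < gapUp Q b w
      rw [e2]; exact lt_gapUp hQ hb hv'.2 hv.2
  let k : ℝ → ℝ → ℝ≥0∞ := fun v w =>
    T.indicator (fun x => ENNReal.ofReal (1 / (gapUp Q b x.1 - gapLo Q a x.1))) (v, w)
  have hkm : Measurable (Function.uncurry k) := by
    have : Function.uncurry k = T.indicator (fun x => ENNReal.ofReal (1 / (gapUp Q b x.1 - gapLo Q a x.1))) := by
      ext ⟨v, w⟩; rfl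
    rw [this]
    refine Measurable.indicator ?_ hTm
    have h1 : Measurable fun x : ℝ × ℝ => gapUp Q b x.1 := mup.comp measurable_fst
    have h2 : Measurable fun x : ℝ × ℝ => gapLo Q a x.1 := mlo.comp measurable_fst
    exact ((h1.sub h2).const_div 1).ennreal_ofReal
  have step1 : ∀ v ∈ U, ENNReal.ofReal (1 / (gapUp Q b v - gapLo Q a v)) *
      ∫⁻ w in Ioo (gapLo Q a v) (gapUp Q b v), f w = ∫⁻ w in U, k v w * f w := by
    intro v hv
    rw [← lintegral_const_mul _ hf, ← lintegral_indicator measurableSet_Ioo, ← lintegral_indicator hUm]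
    refine lintegral_congr fun w => ?_
    by_cases hw : (v, w) ∈ T
    · rw [indicator_of_mem (show w ∈ Ioo _ _ from hw), indicator_of_mem (hsub v hv w hw).1]
      simp only [k, indicator_of_mem hw]
    · rw [indicator_of_notMem (show w ∉ Ioo _ _ from hw)]
      have : k v w = 0 := indicator_of_notMem hw _
      simp [this, indicator]
  rw [setLIntegral_congr_fun hUm step1]
  rw [lintegral_lintegral_swap]
  · refine setLIntegral_congr_fun hUm ?_
    intro w hw
    have hw' := Ioo_subset_Icc_self hw.1
    have hkw : Measurable fun v => k v w := hkm.comp (measurable_id.prodMk measurable_const)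
    show ∫⁻ v in U, k v w * f w = f w
    rw [lintegral_mul_const _ hkw]
    have : ∫⁻ v in U, k v w = 1 := by
      have hlt : gapLo Q a w < gapUp Q b w :=
        (gapLo_lt hQ ha hw'.1 hw.2).trans (lt_gapUp hQ hb hw'.2 hw.2)
      have e : ∫⁻ v in U, k v w = ∫⁻ v in Ioo (gapLo Q a w) (gapUp Q b w),
          ENNReal.ofReal (1 / (gapUp Q b w - gapLo Q a w)) := by
        rw [← lintegral_indicator hUm, ← lintegral_indicator measurableSet_Ioo]
        refine lintegral_congr fun v => ?_
        by_cases hv : (w, v) ∈ T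
        · obtain ⟨hvU, e1, e2⟩ := hsub w hw v hv
          rw [indicator_of_mem (show v ∈ Ioo _ _ from hv), indicator_of_mem hvU]
          simp only [k, indicator_of_mem (hsym w hw v hvU hv), e1, e2]
        · rw [indicator_of_notMem (show v ∉ Ioo _ _ from hv)]
          by_cases hvU : v ∈ U
          · rw [indicator_of_mem hvU]
            simp only [k]
            rw [indicator_of_notMem (fun h => hv (hsym v hvU w hw h))]
          · rw [indicator_of_notMem hvU]
      rw [e, setLIntegral_const, Real.volume_Ioo, ← ENNReal.ofReal_mul (by
        rw [one_div]; exact inv_nonneg.2 (by linarith))]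
      rw [one_div, inv_mul_cancel₀ (by linarith), ENNReal.ofReal_one]
    rw [this, one_mul]
  · exact ((hkm.mul (hf.comp measurable_snd)).aemeasurable)
end gap

end

section

theorem image_null {F : Set ℝ} (hF : MeasurableSet F) (hFv : volume F ≠ ⊤) {h τ : ℝ → ℝ}
    (hh : Integrable h) (h0 : ∀ x ∈ F, h x = 0)
    (hτ : ∀ x ∈ F, ∀ y ∈ F, x ≤ y → |τ y - τ x| ≤ ∫ s in x..y, |h s|) :
    volume (τ '' F) = 0 := by
  have main : ∀ ε : ℝ, 0 < ε → volume (τ '' F) ≤ ENNReal.ofReal ε * volume F := by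
    intro ε hε
    set k : ℝ → ℝ := fun s => |h s| + ε with hk
    have ki : ∀ x y, IntervalIntegrable k volume x y := fun x y =>
      (hh.abs.intervalIntegrable).add (by simp)
    set H : ℝ → ℝ := fun x => ∫ s in (0:ℝ)..x, k s with hH
    have Hc : Continuous H := intervalIntegral.continuous_primitive ki 0
    have Hsub : ∀ x y, H y - H x = ∫ s in x..y, k s := fun x y =>
      intervalIntegral.integral_interval_sub_left (ki 0 y) (ki 0 x)
    have Hge : ∀ x y, x ≤ y → ε * (y - x) + (∫ s in x..y, |h s|) ≤ H y - H x := by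
      intro x y hxy
      rw [Hsub, hk, intervalIntegral.integral_add (hh.abs.intervalIntegrable) (by simp)]
      simp; linarith
    have habs : ∀ x y, x ≤ y → 0 ≤ ∫ s in x..y, |h s| := fun x y hxy =>
      intervalIntegral.integral_nonneg hxy (fun _ _ => abs_nonneg _)
    have Hm : StrictMono H := by
      intro x y hxy
      have := Hge x y hxy.le
      have := habs x y hxy.le
      have : 0 < ε * (y - x) := mul_pos hε (sub_pos.2 hxy)
      linarith
    have He : MeasurableEmbedding H := Hc.measurableEmbedding Hm.injective
    have hmeas : volume.comap H = volume.withDensity (fun s => ENNReal.ofReal (k s)) := by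
      have hIoc : ∀ ⦃a b : ℝ⦄, a < b → volume.comap H (Ioc a b) = ENNReal.ofReal (H b - H a) := by
        intro a b hab
        rw [He.comap_apply]
        have : H '' Ioc a b = Ioc (H a) (H b) := by
          apply Subset.antisymm
          · rintro _ ⟨x, hx, rfl⟩
            exact ⟨Hm hx.1, Hm.monotone hx.2⟩
          · intro y hy
            obtain ⟨x, hx, rfl⟩ := intermediate_value_Ioc hab.le Hc.continuousOn hy
            exact ⟨x, hx, rfl⟩
        rw [this, Real.volume_Ioc]
      refine Measure.ext_of_Ioc' _ _ (fun a b hab => ?_) (fun a b hab => ?_)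
      · rw [hIoc hab]; exact ENNReal.ofReal_ne_top
      · rw [hIoc hab, withDensity_apply _ measurableSet_Ioc, Hsub,
          intervalIntegral.integral_of_le hab.le, ofReal_integral_eq_lintegral_ofReal]
        · exact (ki a b).1
        · exact Eventually.of_forall fun s => by positivity
    have hvol : volume (H '' F) = ENNReal.ofReal ε * volume F := by
      rw [← He.comap_apply, hmeas, withDensity_apply _ hF]
      rw [setLIntegral_congr_fun hF (g := fun _ => ENNReal.ofReal ε)]
      · simp
      · intro x hx; simp [hk, h0 x hx]
    -- Lipschitz map
    set inv := Function.invFun H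
    have hinv : ∀ x, inv (H x) = x := Function.leftInverse_invFun Hm.injective
    have hlip : LipschitzOnWith 1 (fun y => τ (inv y)) (H '' F) := by
      have aux : ∀ x ∈ F, ∀ y ∈ F, x ≤ y → |τ y - τ x| ≤ |H y - H x| := by
        intro x hx y hy hxy
        have h1 := hτ x hx y hy hxy
        have h2 := Hge x y hxy
        have : 0 ≤ ε * (y - x) := mul_nonneg hε.le (sub_nonneg.2 hxy)
        exact h1.trans ((by linarith : _ ≤ H y - H x).trans (le_abs_self _))
      refine LipschitzOnWith.of_dist_le_mul ?_
      rintro _ ⟨x, hx, rfl⟩ _ ⟨y, hy, rfl⟩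
      simp only [hinv, Real.dist_eq, NNReal.coe_one, one_mul]
      rcases le_total x y with hxy | hxy
      · rw [abs_sub_comm (τ x), abs_sub_comm (H x)]; exact aux x hx y hy hxy
      · exact aux y hy x hx hxy
    have himg : (fun y => τ (inv y)) '' (H '' F) = τ '' F := by
      rw [image_image]; simp only [hinv]
    have := hlip.hausdorffMeasure_image_le (d := 1) zero_le_one
    rw [himg, hausdorffMeasure_real, hvol] at this
    simpa using this
  refine le_antisymm ?_ bot_le
  have hlim : Tendsto (fun ε : ℝ => ENNReal.ofReal ε * volume F) (𝓝[>] 0) (𝓝 0) := by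
    have h1 : Tendsto (fun ε : ℝ => ENNReal.ofReal ε) (𝓝[>] 0) (𝓝 (ENNReal.ofReal 0)) :=
      (ENNReal.continuous_ofReal.tendsto 0).mono_left nhdsWithin_le_nhds
    have := ENNReal.Tendsto.mul_const h1 (Or.inr hFv)
    simpa using this
  refine ge_of_tendsto hlim ?_
  filter_upwards [self_mem_nhdsWithin] with ε hε using main ε hε

theorem tau_zero {τ : ℝ → ℝ} {G : ℝ} (hG : 0 ≤ G) (hc : ContinuousOn τ (Icc 0 G)) (F : ℕ → Set ℝ)
    (hU : Icc 0 G ⊆ ⋃ k, F k) (hn : ∀ k, volume (τ '' F k) = 0) : τ G ≤ τ 0 := by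
  by_contra hlt
  push Not at hlt
  have h1 : Icc (τ 0) (τ G) ⊆ ⋃ k, τ '' F k := by
    rw [← image_iUnion]
    exact (intermediate_value_Icc hG hc).trans (image_mono hU)
  have h2 : volume (⋃ k, τ '' F k) = 0 := measure_iUnion_null hn
  have h3 := measure_mono_null h1 h2
  rw [Real.volume_Icc, ENNReal.ofReal_eq_zero] at h3
  linarith
end

section

/-- abstract degenerate two-sided parabolic system -/
structure Sys where
  V : ℝ
  G : ℝ
  X : ℝ
  k0 : ℝ
  K : ℝ → ℝ
  K1 : ℝ → ℝ
  ρ : ℝ → ℝ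
  r : ℝ → ℝ
  ψ : ℝ → ℝ
  ψ1 : ℝ → ℝ
  ψ2 : ℝ → ℝ
  γ : ℝ → ℝ
  p : ℝ → ℝ → ℝ
  F : ℝ → ℝ → ℝ
  S : ℝ → ℝ → ℝ
  pv : ℝ → ℝ → ℝ
  hV : 0 < V
  hG : 0 < G
  hGX : G < X
  hk0 : 0 < k0
  Kpos : ∀ g, 0 < K g
  Kder : ∀ g, HasDerivAt K (K1 g) g
  K1c : Continuous K1
  ρc : Continuous ρ
  rc : Continuous r
  rnn : ∀ g ∈ Icc 0 X, 0 ≤ r g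
  ψder : ∀ g, HasDerivAt ψ (ψ1 g) g
  ψ1c : Continuous ψ1
  ψ1der : ∀ g, HasDerivAt (fun g => K g * ψ1 g) (ψ2 g) g
  ψ2c : Continuous ψ2
  ψnn : ∀ g, 0 ≤ ψ g
  ψle : ∀ g, ψ g ≤ 1
  ψlow : ∀ g ≤ G, ψ g = 1
  ψ1low : ∀ g ≤ G, ψ1 g = 0
  ψ2low : ∀ g ≤ G, ψ2 g = 0
  ψX : ψ X = 0
  ψ1X : ψ1 X = 0
  γc : ContinuousOn γ (Ioo 0 V)
  γmem : ∀ v ∈ Ioo 0 V, γ v ∈ Ioo 0 G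
  γpos : ∀ v ∈ Ioo 0 V, ∀ g ∈ Icc 0 X, γ v ≤ g → 0 ≤ ρ g - r g * v
  γneg : ∀ v ∈ Ioo 0 V, ∀ g ∈ Icc 0 X, g ≤ γ v → ρ g - r g * v ≤ 0
  pnn : ∀ v g, 0 ≤ p v g
  ppos : ∀ v ∈ Ioo 0 V, ∀ g ∈ Icc 0 X, 0 < p v g
  pcv : ∀ g, Continuous (fun v => p v g)
  pcg : ∀ v ∈ Ioo 0 V, ContinuousOn (p v) (Icc 0 X)
  pder : ∀ v ∈ Ioo 0 V, ∀ g ∈ Ioo 0 X, HasDerivAt (p v) (F v g / K g) g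
  Fc : ∀ v ∈ Ioo 0 V, ContinuousOn (F v) (Icc 0 X)
  F0 : ∀ v ∈ Ioo 0 V, F v 0 = 0
  Fder : ∀ v ∈ Ioo 0 V, ∀ g ∈ Ioo 0 X, HasDerivAt (F v) (S v g) g
  Sc : ∀ v ∈ Ioo 0 V, ContinuousOn (S v) (Icc 0 X)
  pvder : ∀ v ∈ Ioo 0 V, ∀ g ∈ Ioo 0 X, HasDerivAt (fun v => p v g) (pv v g) v
  eqn : ∀ v ∈ Ioo 0 V, ∀ g ∈ Ioo 0 X, (ρ g - r g * v) * pv v g = S v g + r g * p v g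
  pk0 : ∀ v, ∀ g ∈ Icc G X, p v g ≤ k0
  pk00 : ∀ v, p v 0 ≤ k0
  pm : Measurable (Function.uncurry p)
  Fm : Measurable (Function.uncurry F)
  Sm : Measurable (Function.uncurry S)
  pint : IntegrableOn (Function.uncurry p) (Ioo 0 V ×ˢ Ioo 0 X)

namespace Sys
variable (s : Sys)

def R (v g : ℝ) : ℝ := s.ρ g - s.r g * v

lemma hX : 0 < s.X := s.hG.trans s.hGX

lemma Kc : Continuous s.K := continuous_iff_continuousAt.2 fun g => (s.Kder g).continuousAt
lemma ψc : Continuous s.ψ := continuous_iff_continuousAt.2 fun g => (s.ψder g).continuousAt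

lemma exists_M : ∃ M : ℝ, 1 ≤ M ∧ ∀ g ∈ Icc 0 s.X, s.r g ≤ M ∧ |s.ψ1 g| ≤ M ∧ |s.ψ2 g| ≤ M ∧
    s.K g ≤ M ∧ |s.K1 g| ≤ M ∧ 1 / s.K g ≤ M ∧ (∀ v ∈ Icc 0 s.V, |s.R v g| ≤ M) := by
  have B : ∀ f : ℝ → ℝ, Continuous f → ∃ c, 0 ≤ c ∧ ∀ g ∈ Icc 0 s.X, |f g| ≤ c := by
    intro f hf
    obtain ⟨c, hc⟩ := (isCompact_Icc (a := (0:ℝ)) (b := s.X)).exists_bound_of_continuousOn hf.continuousOn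
    exact ⟨max c 0, le_max_right _ _, fun g hg => (hc g hg).trans (le_max_left _ _)⟩
  obtain ⟨c1, n1, h1⟩ := B _ s.rc
  obtain ⟨c2, n2, h2⟩ := B _ s.ψ1c
  obtain ⟨c3, n3, h3⟩ := B _ s.ψ2c
  obtain ⟨c4, n4, h4⟩ := B _ s.Kc
  obtain ⟨c5, n5, h5⟩ := B _ s.K1c
  obtain ⟨c6, n6, h6⟩ := B (fun g => 1 / s.K g) (continuous_const.div s.Kc (fun g => (s.Kpos g).ne'))
  obtain ⟨c7, n7, h7⟩ := B _ s.ρc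
  have hV := s.hV
  have n8 : 0 ≤ c1 * s.V := by positivity
  refine ⟨1 + c1 + c2 + c3 + c4 + c5 + c6 + c7 + c1 * s.V, by linarith, fun g hg => ?_⟩
  have a1 := h1 g hg
  have a2 := h2 g hg
  have a3 := h3 g hg
  have a4 := h4 g hg
  have a5 := h5 g hg
  have a6 := h6 g hg
  have a7 := h7 g hg
  refine ⟨by linarith [le_abs_self (s.r g)], by linarith, by linarith, by linarith [le_abs_self (s.K g)],
    by linarith, by linarith [le_abs_self (1 / s.K g)], fun v hv => ?_⟩
  have : |s.R v g| ≤ |s.ρ g| + |s.r g * v| := abs_sub _ _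
  have e : |s.r g * v| ≤ c1 * s.V := by
    rw [abs_mul, abs_of_nonneg hv.1]
    exact mul_le_mul a1 hv.2 hv.1 n1
  linarith

def M : ℝ := s.exists_M.choose
lemma M1 : 1 ≤ s.M := s.exists_M.choose_spec.1
lemma M0 : 0 ≤ s.M := zero_le_one.trans s.M1
lemma rM {g : ℝ} (hg : g ∈ Icc 0 s.X) : s.r g ≤ s.M := (s.exists_M.choose_spec.2 g hg).1
lemma ψ1M {g : ℝ} (hg : g ∈ Icc 0 s.X) : |s.ψ1 g| ≤ s.M := (s.exists_M.choose_spec.2 g hg).2.1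
lemma ψ2M {g : ℝ} (hg : g ∈ Icc 0 s.X) : |s.ψ2 g| ≤ s.M := (s.exists_M.choose_spec.2 g hg).2.2.1
lemma KM {g : ℝ} (hg : g ∈ Icc 0 s.X) : s.K g ≤ s.M := (s.exists_M.choose_spec.2 g hg).2.2.2.1
lemma K1M {g : ℝ} (hg : g ∈ Icc 0 s.X) : |s.K1 g| ≤ s.M := (s.exists_M.choose_spec.2 g hg).2.2.2.2.1
lemma KiM {g : ℝ} (hg : g ∈ Icc 0 s.X) : 1 / s.K g ≤ s.M := (s.exists_M.choose_spec.2 g hg).2.2.2.2.2.1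
lemma RM {g : ℝ} (hg : g ∈ Icc 0 s.X) {v : ℝ} (hv : v ∈ Icc 0 s.V) : |s.R v g| ≤ s.M :=
  (s.exists_M.choose_spec.2 g hg).2.2.2.2.2.2 v hv

structure TF (C : ℝ) (Ψ Ψ' : ℝ → ℝ → ℝ) : Prop where
  C0 : 0 ≤ C
  m : Measurable (Function.uncurry Ψ)
  m' : Measurable (Function.uncurry Ψ')
  bd : ∀ g ∈ Icc 0 s.X, ∀ y, 0 ≤ y → |Ψ g y| ≤ C * s.ψ g
  bd' : ∀ g ∈ Icc 0 s.X, ∀ y, 0 ≤ y → |Ψ' g y| ≤ C * s.ψ g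
  cont : ∀ g ∈ Icc 0 s.X, ContinuousOn (Ψ g) (Ici 0)
  der : ∀ g ∈ Icc 0 s.X, ∀ y, 0 < y → HasDerivAt (Ψ g) (Ψ' g y) y

def Hh (Ψ Ψ' : ℝ → ℝ → ℝ) (v g : ℝ) : ℝ :=
  Ψ' g (s.p v g) * (s.S v g + s.r g * s.p v g) - s.r g * Ψ g (s.p v g)
def Φ (Ψ : ℝ → ℝ → ℝ) (v : ℝ) : ℝ := ∫ g in (0:ℝ)..s.X, s.R v g * Ψ g (s.p v g)
def E (Ψ Ψ' : ℝ → ℝ → ℝ) (v : ℝ) : ℝ := ∫ g in (0:ℝ)..s.X, s.Hh Ψ Ψ' v g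

variable {s}
lemma TF.neg {C : ℝ} {Ψ Ψ' : ℝ → ℝ → ℝ} (h : s.TF C Ψ Ψ') :
    s.TF C (fun g y => - Ψ g y) (fun g y => - Ψ' g y) where
  C0 := h.C0
  m := h.m.neg
  m' := h.m'.neg
  bd g hg y hy := by rw [abs_neg]; exact h.bd g hg y hy
  bd' g hg y hy := by rw [abs_neg]; exact h.bd' g hg y hy
  cont g hg := (h.cont g hg).neg
  der g hg y hy := (h.der g hg y hy).neg

lemma Φ_neg (Ψ : ℝ → ℝ → ℝ) (v : ℝ) : s.Φ (fun g y => - Ψ g y) v = - s.Φ Ψ v := by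
  unfold Φ; rw [← intervalIntegral.integral_neg]; congr 1; ext g; ring
lemma E_neg (Ψ Ψ' : ℝ → ℝ → ℝ) (v : ℝ) :
    s.E (fun g y => - Ψ g y) (fun g y => - Ψ' g y) v = - s.E Ψ Ψ' v := by
  unfold E Hh; rw [← intervalIntegral.integral_neg]; congr 1; ext g; ring

lemma pmg (v : ℝ) : Measurable (s.p v) := s.pm.comp (measurable_const.prodMk measurable_id)
lemma Rm : Measurable (Function.uncurry s.R) := by
  have h1 : Measurable fun x : ℝ × ℝ => s.ρ x.2 := s.ρc.measurable.comp measurable_snd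
  have h2 : Measurable fun x : ℝ × ℝ => s.r x.2 := s.rc.measurable.comp measurable_snd
  exact h1.sub (h2.mul measurable_fst)

lemma TF.lip {C : ℝ} {Ψ Ψ' : ℝ → ℝ → ℝ} (h : s.TF C Ψ Ψ') {g x y : ℝ} (hg : g ∈ Icc 0 s.X)
    (hx : 0 ≤ x) (hy : 0 ≤ y) : |Ψ g x - Ψ g y| ≤ C * s.ψ g * |x - y| := by
  have aux : ∀ x y : ℝ, 0 ≤ x → x < y → |Ψ g y - Ψ g x| ≤ C * s.ψ g * |y - x| := by
    intro x y hx hxy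
    obtain ⟨c, hc, e⟩ := exists_hasDerivAt_eq_slope (Ψ g) (Ψ' g) hxy
      ((h.cont g hg).mono (fun z hz => hx.trans hz.1)) (fun z hz => h.der g hg z (hx.trans_lt hz.1))
    have hyx : y - x ≠ 0 := by linarith
    have : Ψ g y - Ψ g x = Ψ' g c * (y - x) := by rw [e]; field_simp
    rw [this, abs_mul]
    gcongr
    exact h.bd' g hg c (hx.trans hc.1.le)
  rcases lt_trichotomy x y with hxy | hxy | hxy
  · rw [abs_sub_comm, abs_sub_comm x]; exact aux x y hx hxy
  · simp [hxy]
  · exact aux y x hy hxy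

lemma Rcont (g : ℝ) : Continuous (fun v => s.R v g) := by unfold R; fun_prop
lemma Rcontg (v : ℝ) : Continuous (fun g => s.R v g) := by
  unfold R; exact s.ρc.sub (s.rc.mul continuous_const)

lemma TF.meas {C : ℝ} {Ψ Ψ' : ℝ → ℝ → ℝ} (h : s.TF C Ψ Ψ') :
    Measurable (fun x : ℝ × ℝ => Ψ x.2 (s.p x.1 x.2)) :=
  h.m.comp (measurable_snd.prodMk s.pm)
lemma TF.meas' {C : ℝ} {Ψ Ψ' : ℝ → ℝ → ℝ} (h : s.TF C Ψ Ψ') :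
    Measurable (fun x : ℝ × ℝ => Ψ' x.2 (s.p x.1 x.2)) :=
  h.m'.comp (measurable_snd.prodMk s.pm)
lemma TF.Hm {C : ℝ} {Ψ Ψ' : ℝ → ℝ → ℝ} (h : s.TF C Ψ Ψ') :
    Measurable (Function.uncurry (s.Hh Ψ Ψ')) := by
  have hr : Measurable fun x : ℝ × ℝ => s.r x.2 := s.rc.measurable.comp measurable_snd
  exact (h.meas'.mul (s.Sm.add (hr.mul s.pm))).sub (hr.mul h.meas)

lemma TF.Φcont {C : ℝ} {Ψ Ψ' : ℝ → ℝ → ℝ} (h : s.TF C Ψ Ψ') :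
    ContinuousOn (s.Φ Ψ) (Icc 0 s.V) := by
  intro v hv
  refine intervalIntegral.continuousWithinAt_of_dominated_interval (bound := fun _ => s.M * C) ?_ ?_ ?_ ?_
  · filter_upwards [] with v
    exact (((Rcontg v).measurable.mul (h.meas.comp (measurable_const.prodMk measurable_id)))).aestronglyMeasurable
  · filter_upwards [self_mem_nhdsWithin] with v hv
    filter_upwards [] with g hg
    rw [uIoc_of_le s.hX.le] at hg
    have hg' := Ioc_subset_Icc_self hg
    rw [Real.norm_eq_abs, abs_mul]
    refine mul_le_mul (s.RM hg' hv) ?_ (abs_nonneg _) s.M0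
    have := h.bd g hg' _ (s.pnn v g)
    have h2 : C * s.ψ g ≤ C * 1 := mul_le_mul_of_nonneg_left (s.ψle g) h.C0
    linarith
  · simp
  · filter_upwards [] with g hg
    rw [uIoc_of_le s.hX.le] at hg
    have hg' := Ioc_subset_Icc_self hg
    have : Continuous (fun v => Ψ g (s.p v g)) :=
      (h.cont g hg').comp_continuous (s.pcv g) (fun v => s.pnn v g)
    exact ((Rcont g).mul this).continuousWithinAt

lemma TF.Em {C : ℝ} {Ψ Ψ' : ℝ → ℝ → ℝ} (h : s.TF C Ψ Ψ') : Measurable (s.E Ψ Ψ') := by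
  have : s.E Ψ Ψ' = fun v => ∫ g in Ioc 0 s.X, s.Hh Ψ Ψ' v g := by
    ext v; unfold E; rw [intervalIntegral.integral_of_le s.hX.le]
  rw [this]
  exact (h.Hm.stronglyMeasurable.integral_prod_right).measurable

lemma TF.hder {C : ℝ} {Ψ Ψ' : ℝ → ℝ → ℝ} (h : s.TF C Ψ Ψ') {v g : ℝ} (hv : v ∈ Ioo 0 s.V)
    (hg : g ∈ Ioo 0 s.X) :
    HasDerivAt (fun v => s.R v g * Ψ g (s.p v g)) (s.Hh Ψ Ψ' v g) v := by
  have hg' := Ioo_subset_Icc_self hg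
  have h1 : HasDerivAt (fun v => s.R v g) (- s.r g) v := by
    unfold R
    have := ((hasDerivAt_id v).const_mul (s.r g)).const_sub (s.ρ g)
    simpa using this
  have h2 := (h.der g hg' _ (s.ppos v hv g hg')).comp v (s.pvder v hv g hg)
  refine (h1.mul h2).congr_deriv ?_
  have := s.eqn v hv g hg
  unfold Hh
  rw [← this]
  simp only [R, Function.comp]
  ring

variable (s)
def base (a b : ℝ) : Prop := ∀ (C : ℝ) (Ψ Ψ' : ℝ → ℝ → ℝ), s.TF C Ψ Ψ' → ∀ e : ℝ → ℝ,
  IntervalIntegrable e volume a b → (∀ v ∈ Ioo a b, - e v ≤ s.E Ψ Ψ' v) →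
  IntervalIntegrable (s.E Ψ Ψ') volume a b ∧ s.Φ Ψ b - s.Φ Ψ a = ∫ v in a..b, s.E Ψ Ψ' v

def Good (a b : ℝ) : Prop := ∀ x y, a ≤ x → x ≤ y → y ≤ b → s.base x y
variable {s}

lemma Good.mono {a b a' b' : ℝ} (h : s.Good a b) (ha : a ≤ a') (hb : b' ≤ b) : s.Good a' b' :=
  fun x y h1 h2 h3 => h x y (ha.trans h1) h2 (h3.trans hb)

lemma base_refl (a : ℝ) : s.base a a := by
  intro C Ψ Ψ' _ e _ _; simp

lemma base.trans {a b c : ℝ} (hab : a ≤ b) (hbc : b ≤ c) (h1 : s.base a b) (h2 : s.base b c) :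
    s.base a c := by
  intro C Ψ Ψ' hT e he hE
  have u : uIcc a b ⊆ uIcc a c := by
    rw [uIcc_of_le hab, uIcc_of_le (hab.trans hbc)]; exact Icc_subset_Icc_right hbc
  have u' : uIcc b c ⊆ uIcc a c := by
    rw [uIcc_of_le hbc, uIcc_of_le (hab.trans hbc)]; exact Icc_subset_Icc_left hab
  obtain ⟨i1, e1⟩ := h1 C Ψ Ψ' hT e (he.mono_set u) (fun v hv => hE v ⟨hv.1, hv.2.trans_le hbc⟩)
  obtain ⟨i2, e2⟩ := h2 C Ψ Ψ' hT e (he.mono_set u') (fun v hv => hE v ⟨hab.trans_lt hv.1, hv.2⟩)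
  refine ⟨i1.trans i2, ?_⟩
  rw [← intervalIntegral.integral_add_adjacent_intervals i1 i2]; linarith

/-- upper bound version -/
lemma base.upper {a b : ℝ} (h : s.base a b) {C : ℝ} {Ψ Ψ' : ℝ → ℝ → ℝ} (hT : s.TF C Ψ Ψ') (e : ℝ → ℝ)
    (he : IntervalIntegrable e volume a b) (hE : ∀ v ∈ Ioo a b, s.E Ψ Ψ' v ≤ e v) :
    IntervalIntegrable (s.E Ψ Ψ') volume a b ∧ s.Φ Ψ b - s.Φ Ψ a = ∫ v in a..b, s.E Ψ Ψ' v := by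
  obtain ⟨i1, e1⟩ := h C _ _ hT.neg e he (fun v hv => by rw [E_neg]; linarith [hE v hv])
  have : s.E (fun g y => - Ψ g y) (fun g y => - Ψ' g y) = fun v => - s.E Ψ Ψ' v := by
    ext v; exact E_neg _ _ v
  rw [this] at i1 e1
  refine ⟨by have h3 := i1.neg; convert h3 using 1; ext v; simp, ?_⟩
  rw [Φ_neg, Φ_neg, intervalIntegral.integral_neg] at e1
  linarith

/-- base on all compact subintervals implies base -/
lemma base_of_inner {a b : ℝ} (ha : 0 ≤ a) (hb : b ≤ s.V) (hab : a < b)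
    (h : ∀ x y, a < x → x ≤ y → y < b → s.base x y) : s.base a b := by
  intro C Ψ Ψ' hT e he hE
  have hΦ := hT.Φcont.mono (Icc_subset_Icc ha hb)
  set u : ℕ → ℝ := fun n => a + (b - a) / (n + 3) with hu
  set w : ℕ → ℝ := fun n => b - (b - a) / (n + 3) with hw
  have hd : ∀ n : ℕ, 0 < (b - a) / ((n:ℝ) + 3) ∧ (b - a) / ((n:ℝ) + 3) ≤ (b - a) / 3 := by
    intro n
    have : 0 < b - a := by linarith
    refine ⟨by positivity, ?_⟩
    gcongr; linarith [(Nat.cast_nonneg n : (0:ℝ) ≤ n)]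
  have u1 : ∀ n, a < u n := fun n => by simp only [hu]; linarith [(hd n).1]
  have w1 : ∀ n, w n < b := fun n => by simp only [hw]; linarith [(hd n).1]
  have uw : ∀ n, u n ≤ w n := fun n => by simp only [hu, hw]; linarith [(hd n).2]
  have lim0 : Tendsto (fun n : ℕ => (b - a) / ((n:ℝ) + 3)) atTop (𝓝 0) :=
    tendsto_const_nhds.div_atTop (tendsto_atTop_add_const_right _ _ tendsto_natCast_atTop_atTop)
  have ulim : Tendsto u atTop (𝓝 a) := by simpa using lim0.const_add a
  have wlim : Tendsto w atTop (𝓝 b) := by simpa using lim0.const_sub b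
  have sub : ∀ n, uIcc (u n) (w n) ⊆ uIcc a b := fun n => by
    rw [uIcc_of_le (uw n), uIcc_of_le hab.le]; exact Icc_subset_Icc (u1 n).le (w1 n).le
  have hn : ∀ n, IntervalIntegrable (s.E Ψ Ψ') volume (u n) (w n) ∧
      s.Φ Ψ (w n) - s.Φ Ψ (u n) = ∫ v in (u n)..(w n), s.E Ψ Ψ' v := fun n =>
    h _ _ (u1 n) (uw n) (w1 n) C Ψ Ψ' hT e (he.mono_set (sub n))
      (fun v hv => hE v ⟨(u1 n).trans hv.1, hv.2.trans (w1 n)⟩)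
  have Φu : Tendsto (fun n => s.Φ Ψ (u n)) atTop (𝓝 (s.Φ Ψ a)) :=
    (hΦ a (left_mem_Icc.2 hab.le)).tendsto.comp (tendsto_nhdsWithin_iff.2 ⟨ulim,
      Eventually.of_forall fun n => ⟨(u1 n).le, (uw n).trans (w1 n).le⟩⟩)
  have Φw : Tendsto (fun n => s.Φ Ψ (w n)) atTop (𝓝 (s.Φ Ψ b)) :=
    (hΦ b (right_mem_Icc.2 hab.le)).tendsto.comp (tendsto_nhdsWithin_iff.2 ⟨wlim,
      Eventually.of_forall fun n => ⟨(u1 n).le.trans (uw n), (w1 n).le⟩⟩)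
  have Φd := Φw.sub Φu
  -- boundedness
  obtain ⟨c, hc⟩ := Φd.bddAbove_range
  have hEe : IntegrableOn (fun v => s.E Ψ Ψ' v + e v) (Ioc a b) := by
    refine integrableOn_Ioc_of_intervalIntegral_norm_bounded (I := c + ∫ v in a..b, |e v|)
      (a := u) (b := w) (l := atTop) (fun n => ?_) ulim wlim (Eventually.of_forall fun n => ?_)
    · exact (((hn n).1.add (he.mono_set (sub n)))).1
    · have e1 : ∫ x in Ioc (u n) (w n), ‖s.E Ψ Ψ' x + e x‖ = ∫ x in Ioc (u n) (w n), (s.E Ψ Ψ' x + e x) := by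
        refine setIntegral_congr_fun measurableSet_Ioc fun x hx => ?_
        have := hE x ⟨(u1 n).trans hx.1, hx.2.trans_lt (w1 n)⟩
        rw [Real.norm_eq_abs, abs_of_nonneg (by linarith)]
      rw [e1, ← intervalIntegral.integral_of_le (uw n),
        intervalIntegral.integral_add (hn n).1 (he.mono_set (sub n)), ← (hn n).2]
      have h1 := hc ⟨n, rfl⟩
      have h2 : ∫ v in (u n)..(w n), e v ≤ ∫ v in a..b, |e v| := by
        calc _ ≤ ∫ v in (u n)..(w n), |e v| :=
              intervalIntegral.integral_mono_on (uw n) (he.mono_set (sub n)) (he.mono_set (sub n)).abs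
                (fun x _ => le_abs_self _)
          _ ≤ _ := intervalIntegral.integral_mono_interval (u1 n).le (uw n) (w1 n).le
                (Eventually.of_forall fun x => abs_nonneg _) he.abs
      simp only at h1
      linarith
  have hEi : IntervalIntegrable (s.E Ψ Ψ') volume a b := by
    have h1 : IntervalIntegrable (fun v => s.E Ψ Ψ' v + e v) volume a b :=
      (intervalIntegrable_iff_integrableOn_Ioc_of_le hab.le).2 hEe
    simpa using h1.sub he
  refine ⟨hEi, ?_⟩
  have hcont := intervalIntegral.continuousOn_primitive_interval' hEi left_mem_uIcc
  rw [uIcc_of_le hab.le] at hcont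
  have Iu := (hcont a (left_mem_Icc.2 hab.le)).tendsto.comp (tendsto_nhdsWithin_iff.2 ⟨ulim,
      Eventually.of_forall fun n => ⟨(u1 n).le, (uw n).trans (w1 n).le⟩⟩)
  have Iw := (hcont b (right_mem_Icc.2 hab.le)).tendsto.comp (tendsto_nhdsWithin_iff.2 ⟨wlim,
      Eventually.of_forall fun n => ⟨(u1 n).le.trans (uw n), (w1 n).le⟩⟩)
  have Id := Iw.sub Iu
  have e2 : ∀ n, s.Φ Ψ (w n) - s.Φ Ψ (u n) =
      (∫ v in a..(w n), s.E Ψ Ψ' v) - ∫ v in a..(u n), s.E Ψ Ψ' v := by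
    intro n
    rw [(hn n).2, intervalIntegral.integral_interval_sub_left]
    · exact hEi.mono_set (by rw [uIcc_of_le ((u1 n).le.trans (uw n)), uIcc_of_le hab.le]; exact Icc_subset_Icc_right (w1 n).le)
    · exact hEi.mono_set (by rw [uIcc_of_le (u1 n).le, uIcc_of_le hab.le]; exact Icc_subset_Icc_right ((uw n).trans (w1 n).le))
  have := tendsto_nhds_unique (Φd.congr e2) Id
  simpa using this

lemma good_of_local {a b : ℝ} (ha : 0 ≤ a) (hb : b ≤ s.V)
    (h : ∀ v ∈ Ioo a b, ∃ δ > 0, s.Good (v - δ) (v + δ)) : s.Good a b := by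
  intro x y hx hxy hy
  rcases eq_or_lt_of_le hxy with rfl | hlt
  · exact base_refl x
  refine base_of_inner (ha.trans hx) (hy.trans hb) hlt ?_
  intro x' y' hx' hxy' hy'
  have H : ∀ v : Icc x' y', ∃ δ > 0, s.Good (v - δ) (v + δ) := fun v =>
    h v ⟨hx.trans_lt (hx'.trans_le v.2.1), (v.2.2.trans_lt hy').trans_le hy⟩
  choose δ hδ hG using H
  obtain ⟨t, t0, tm, ⟨m, hm⟩, ht⟩ := exists_monotone_Icc_subset_open_cover_Icc hxy'
    (c := fun v : Icc x' y' => {w : Icc x' y' | (w:ℝ) ∈ Ioo ((v:ℝ) - δ v) (v + δ v)})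
    (fun v => isOpen_Ioo.preimage continuous_subtype_val)
    (fun v _ => mem_iUnion.2 ⟨v, by
      constructor <;> linarith [hδ v]⟩)
  have key : ∀ n, s.base x' (t n) := by
    intro n
    induction n with
    | zero => rw [t0]; exact base_refl _
    | succ n ih =>
      have hle : (t n : ℝ) ≤ t (n+1) := tm (Nat.le_succ n)
      obtain ⟨i, hi⟩ := ht n
      refine ih.trans (t n).2.1 hle ?_
      have h1 : ((t n) : ℝ) ∈ Ioo ((i:ℝ) - δ i) (i + δ i) := hi (left_mem_Icc.2 hle)
      have h2 : ((t (n+1)) : ℝ) ∈ Ioo ((i:ℝ) - δ i) (i + δ i) := hi (right_mem_Icc.2 hle)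
      exact hG i _ _ h1.1.le hle h2.2.le
  have := key m
  rwa [hm m le_rfl] at this

end Sys
end

section
namespace Sys
variable {s : Sys}

/-- integration by parts for `z = p v` -/
lemma ibpP {v : ℝ} (hv : v ∈ Ioo 0 s.V) {x1 x2 : ℝ} (hx : x1 ≤ x2) (h0 : 0 ≤ x1) (hX : x2 ≤ s.X)
    {φ φ1 φ2 B b b1 : ℝ → ℝ}
    (hφ : ∀ g ∈ Ioo x1 x2, HasDerivAt φ (φ1 g) g) (hφc : ContinuousOn φ (Icc x1 x2))
    (hφ1 : ∀ g ∈ Ioo x1 x2, HasDerivAt (fun g => s.K g * φ1 g) (φ2 g) g)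
    (hφ1c : ContinuousOn φ1 (Icc x1 x2)) (hφ2c : ContinuousOn φ2 (Icc x1 x2))
    (hB : ∀ y, HasDerivAt B (b y) y) (hb : ∀ y, HasDerivAt b (b1 y) y) (hb1 : Continuous b1) :
    ∫ g in x1..x2, φ g * b (s.p v g) * s.S v g =
      (φ x2 * b (s.p v x2) * s.F v x2 - s.K x2 * φ1 x2 * B (s.p v x2))
      - (φ x1 * b (s.p v x1) * s.F v x1 - s.K x1 * φ1 x1 * B (s.p v x1))
      - (∫ g in x1..x2, φ g * b1 (s.p v g) * (s.F v g ^ 2 / s.K g))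
      + ∫ g in x1..x2, φ2 g * B (s.p v g) := by
  have i1 : Ioo x1 x2 ⊆ Ioo 0 s.X := Ioo_subset_Ioo h0 hX
  have i2 : Icc x1 x2 ⊆ Icc 0 s.X := Icc_subset_Icc h0 hX
  exact ibp1 hx (fun g _ => (s.Kpos g).ne') s.Kc.continuousOn hφ hφc hφ1 hφ1c hφ2c
    (fun g hg => s.pder v hv g (i1 hg)) ((s.pcg v hv).mono i2)
    (fun g hg => s.Fder v hv g (i1 hg)) ((s.Fc v hv).mono i2) ((s.Sc v hv).mono i2) hB hb hb1

/-- interval integrability of continuous functions -/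
lemma ii_of_cont {f : ℝ → ℝ} (hf : ContinuousOn f (Icc 0 s.X)) {x1 x2 : ℝ} (hx : x1 ≤ x2)
    (h0 : 0 ≤ x1) (hX : x2 ≤ s.X) : IntervalIntegrable f volume x1 x2 :=
  (hf.mono (Icc_subset_Icc h0 hX)).intervalIntegrable_of_Icc hx

variable (s)
/-- local energy -/
def En (v : ℝ) : ℝ := ∫ g in (0:ℝ)..s.X, s.ψ g * exp (-(s.p v g)) * (s.F v g ^ 2 / s.K g)
/-- total mass -/
def ms (v : ℝ) : ℝ := ∫ g in (0:ℝ)..s.X, s.p v g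

def al (j v g : ℝ) : ℝ := - bt1 j (s.p v g) * (s.F v g ^ 2 / s.K g)
def alT (j v : ℝ) : ℝ := ∫ g in (0:ℝ)..s.X, s.al j v g
variable {s}

lemma ms_int : IntervalIntegrable s.ms volume 0 s.V := by
  rw [intervalIntegrable_iff_integrableOn_Ioo_of_le s.hV.le]
  have h := s.pint
  rw [IntegrableOn, Measure.volume_eq_prod, ← Measure.prod_restrict] at h
  have := h.integral_prod_left
  refine this.congr (Eventually.of_forall fun v => ?_)
  simp only [ms, Function.uncurry]
  rw [intervalIntegral.integral_of_le s.hX.le, integral_Ioc_eq_integral_Ioo]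

lemma ms_nonneg (v : ℝ) : 0 ≤ s.ms v :=
  intervalIntegral.integral_nonneg s.hX.le (fun g _ => s.pnn v g)

lemma En_int {a b : ℝ} (ha : 0 ≤ a) (hab : a ≤ b) (hb : b ≤ s.V) (h : s.base a b) :
    IntervalIntegrable s.En volume a b := by
  have hX := s.hX
  set Ψ : ℝ → ℝ → ℝ := fun g y => s.ψ g * (1 - exp (-y)) with hΨ
  set Ψ' : ℝ → ℝ → ℝ := fun g y => s.ψ g * exp (-y) with hΨ'
  have hT : s.TF 1 Ψ Ψ' := by
    have hψ : Measurable fun x : ℝ × ℝ => s.ψ x.1 := s.ψc.measurable.comp measurable_fst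
    refine ⟨zero_le_one, hψ.mul (by fun_prop), hψ.mul (by fun_prop), ?_, ?_, ?_, ?_⟩
    · intro g _ y hy
      have h1 : exp (-y) ≤ 1 := exp_le_one_iff.2 (by linarith)
      have h2 := exp_pos (-y)
      simp only [hΨ]
      rw [abs_mul, abs_of_nonneg (s.ψnn g), one_mul, abs_of_nonneg (by linarith)]
      exact mul_le_of_le_one_right (s.ψnn g) (by linarith)
    · intro g _ y hy
      have h1 : exp (-y) ≤ 1 := exp_le_one_iff.2 (by linarith)
      have h2 := exp_pos (-y)
      simp only [hΨ']
      rw [abs_mul, abs_of_nonneg (s.ψnn g), one_mul, abs_of_nonneg h2.le]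
      exact mul_le_of_le_one_right (s.ψnn g) h1
    · intro g _; simp only [hΨ]; fun_prop
    · intro g _ y _
      have := (((hasDerivAt_neg y).exp).const_sub 1).const_mul (s.ψ g)
      simpa [hΨ, hΨ'] using this
  -- the identity
  set T : ℝ → ℝ := fun v => ∫ g in (0:ℝ)..s.X, (s.ψ2 g * (-exp (-(s.p v g))) +
    s.r g * s.ψ g * (exp (-(s.p v g)) * s.p v g - (1 - exp (-(s.p v g))))) with hTdef
  have hid : ∀ v ∈ Ioo 0 s.V, s.E Ψ Ψ' v = s.En v + T v := by
    intro v hv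
    have ib := ibpP hv hX.le le_rfl le_rfl (φ := s.ψ) (φ1 := s.ψ1) (φ2 := s.ψ2)
      (B := fun y => - exp (-y)) (b := fun y => exp (-y)) (b1 := fun y => - exp (-y))
      (fun g _ => s.ψder g) s.ψc.continuousOn (fun g _ => s.ψ1der g) s.ψ1c.continuousOn s.ψ2c.continuousOn
      (fun y => by
        have h := (hasDerivAt_neg y).exp.neg
        exact h.congr_deriv (by simp))
      (fun y => by simpa using (hasDerivAt_neg y).exp) (by fun_prop)
    rw [s.ψX, s.ψ1X, s.ψ1low 0 s.hG.le, s.F0 v hv] at ib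
    simp only [zero_mul, mul_zero, sub_zero, zero_sub] at ib
    have pc := s.pcg v hv
    have ec : ContinuousOn (fun g => exp (-(s.p v g))) (Icc 0 s.X) := pc.neg.rexp
    have c1 : ContinuousOn (fun g => s.ψ g * exp (-(s.p v g)) * s.S v g) (Icc 0 s.X) :=
      (s.ψc.continuousOn.mul ec).mul (s.Sc v hv)
    have c2 : ContinuousOn (fun g => s.ψ2 g * (-exp (-(s.p v g)))) (Icc 0 s.X) :=
      s.ψ2c.continuousOn.mul ec.neg
    have c3 : ContinuousOn (fun g => s.r g * s.ψ g * (exp (-(s.p v g)) * s.p v g - (1 - exp (-(s.p v g))))) (Icc 0 s.X) :=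
      (s.rc.mul s.ψc).continuousOn.mul ((ec.mul pc).sub (continuousOn_const.sub ec))
    have e1 : s.E Ψ Ψ' v = (∫ g in (0:ℝ)..s.X, s.ψ g * exp (-(s.p v g)) * s.S v g) +
        ∫ g in (0:ℝ)..s.X, s.r g * s.ψ g * (exp (-(s.p v g)) * s.p v g - (1 - exp (-(s.p v g)))) := by
      rw [← intervalIntegral.integral_add (ii_of_cont c1 hX.le le_rfl le_rfl) (ii_of_cont c3 hX.le le_rfl le_rfl)]
      unfold E Hh
      congr 1; ext g; simp only [hΨ, hΨ']; ring
    rw [e1, ib, hTdef]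
    simp only
    rw [intervalIntegral.integral_add (ii_of_cont c2 hX.le le_rfl le_rfl) (ii_of_cont c3 hX.le le_rfl le_rfl)]
    have e2 : ∫ g in (0:ℝ)..s.X, s.ψ g * -exp (-(s.p v g)) * (s.F v g ^ 2 / s.K g) = - s.En v := by
      unfold En; rw [← intervalIntegral.integral_neg]; congr 1; ext g; ring
    rw [e2]; ring
  have Tb : ∀ v, |T v| ≤ (3 * s.M) * |s.X - 0| := by
    intro v
    rw [← Real.norm_eq_abs]
    refine intervalIntegral.norm_integral_le_of_norm_le_const ?_
    intro g hg
    rw [uIoc_of_le hX.le] at hg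
    have hg' := Ioc_subset_Icc_self hg
    have hp := s.pnn v g
    have h1 : exp (-(s.p v g)) ≤ 1 := exp_le_one_iff.2 (by linarith)
    have h2 := exp_pos (-(s.p v g))
    have h3 : exp (-(s.p v g)) * s.p v g ≤ 1 - exp (-(s.p v g)) := by
      have : 1 + s.p v g ≤ exp (s.p v g) := by linarith [add_one_le_exp (s.p v g)]
      have : exp (-(s.p v g)) * (1 + s.p v g) ≤ exp (-(s.p v g)) * exp (s.p v g) := by gcongr
      rw [← exp_add] at this; simp at this; linarith
    have h4 : 0 ≤ exp (-(s.p v g)) * s.p v g := by positivity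
    rw [Real.norm_eq_abs]
    refine (abs_add_le _ _).trans ?_
    rw [abs_mul, abs_neg, abs_of_pos h2, abs_mul, abs_mul, abs_of_nonneg (s.rnn g hg'), abs_of_nonneg (s.ψnn g)]
    have a1 : |s.ψ2 g| * exp (-(s.p v g)) ≤ s.M * 1 := mul_le_mul (s.ψ2M hg') h1 h2.le s.M0
    have a2 : s.r g * s.ψ g * |exp (-(s.p v g)) * s.p v g - (1 - exp (-(s.p v g)))| ≤ s.M * 1 * 1 := by
      refine mul_le_mul (mul_le_mul (s.rM hg') (s.ψle g) (s.ψnn g) s.M0) ?_ (abs_nonneg _) (by linarith [s.M0])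
      rw [abs_le]; constructor <;> linarith
    linarith [s.M0]
  have Tm : Measurable T := by
    have : T = fun v => ∫ g in Ioc 0 s.X, (s.ψ2 g * (-exp (-(s.p v g))) +
        s.r g * s.ψ g * (exp (-(s.p v g)) * s.p v g - (1 - exp (-(s.p v g))))) := by
      ext v; simp only [hTdef]; rw [intervalIntegral.integral_of_le s.hX.le]
    rw [this]
    have e1 : Measurable fun x : ℝ × ℝ => exp (-(s.p x.1 x.2)) := (s.pm.neg).exp
    have e2 : Measurable fun x : ℝ × ℝ => s.ψ2 x.2 := s.ψ2c.measurable.comp measurable_snd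
    have e3 : Measurable fun x : ℝ × ℝ => s.r x.2 := s.rc.measurable.comp measurable_snd
    have e4 : Measurable fun x : ℝ × ℝ => s.ψ x.2 := s.ψc.measurable.comp measurable_snd
    have e5 : Measurable fun x : ℝ × ℝ => s.p x.1 x.2 := s.pm
    have : Measurable (Function.uncurry fun v g => (s.ψ2 g * (-exp (-(s.p v g))) +
        s.r g * s.ψ g * (exp (-(s.p v g)) * s.p v g - (1 - exp (-(s.p v g)))))) :=
      (e2.mul e1.neg).add ((e3.mul e4).mul ((e1.mul e5).sub (measurable_const.sub e1)))
    exact (this.stronglyMeasurable.integral_prod_right).measurable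
  have Ti : IntervalIntegrable T volume a b := by
    rw [intervalIntegrable_iff]
    refine Measure.integrableOn_of_bounded (M := (3 * s.M) * |s.X - 0|) (by simp) Tm.aestronglyMeasurable ?_
    exact Eventually.of_forall fun v => by rw [Real.norm_eq_abs]; exact Tb v
  have hEn0 : ∀ v, 0 ≤ s.En v := fun v => intervalIntegral.integral_nonneg hX.le (fun g _ =>
    mul_nonneg (mul_nonneg (s.ψnn g) (exp_pos _).le) (div_nonneg (sq_nonneg _) (s.Kpos g).le))
  have hsub : Ioo a b ⊆ Ioo 0 s.V := Ioo_subset_Ioo ha hb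
  obtain ⟨i, -⟩ := h 1 Ψ Ψ' hT (fun v => - T v) Ti.neg (fun v hv => by
    rw [hid v (hsub hv)]; linarith [hEn0 v])
  have := i.sub Ti
  rw [intervalIntegrable_iff_integrableOn_Ioo_of_le hab] at this ⊢
  refine this.congr_fun (fun v hv => ?_) measurableSet_Ioo
  simp [hid v (hsub hv)]

lemma al_nonneg {j : ℝ} (hj : 0 < j) (v g : ℝ) : 0 ≤ s.al j v g :=
  mul_nonneg (by linarith [bt1_nonpos hj (s.p v g)]) (div_nonneg (sq_nonneg _) (s.Kpos g).le)

lemma al_zero {j v g : ℝ} (hj : 0 < j) (h : s.p v g ≤ j) : s.al j v g = 0 := by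
  unfold al; rw [bt1_low hj h]; simp

lemma al_G {j v g : ℝ} (hj : s.k0 ≤ j) (hg : g ∈ Icc s.G s.X) : s.al j v g = 0 :=
  al_zero (s.hk0.trans_le hj) ((s.pk0 v g hg).trans hj)

lemma al_m (j : ℝ) : Measurable (Function.uncurry (s.al j)) := by
  have hK : Measurable fun x : ℝ × ℝ => s.K x.2 := s.Kc.measurable.comp measurable_snd
  exact (((bt1_cont j).measurable.comp s.pm).neg).mul ((s.Fm.pow_const 2).div hK)

lemma al_le {j : ℝ} (hj : s.k0 ≤ j) : ∃ c, 0 ≤ c ∧ ∀ v, ∀ g ∈ Icc 0 s.X,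
    s.al j v g ≤ c * (s.ψ g * exp (-(s.p v g)) * (s.F v g ^ 2 / s.K g)) := by
  have hj0 := s.hk0.trans_le hj
  obtain ⟨c, hc, h⟩ := bt1_exp hj0
  refine ⟨c, hc, fun v g hg => ?_⟩
  have hq : 0 ≤ s.F v g ^ 2 / s.K g := div_nonneg (sq_nonneg _) (s.Kpos g).le
  rcases le_total g s.G with hgG | hgG
  · rw [s.ψlow g hgG]
    unfold al
    calc _ ≤ (c * exp (-(s.p v g))) * (s.F v g ^ 2 / s.K g) := by
          gcongr; exact (neg_le_abs _).trans (h _)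
      _ = _ := by ring
  · rw [al_G hj ⟨hgG, hg.2⟩]
    have := s.ψnn g
    positivity

lemma al_cont {j v : ℝ} (hv : v ∈ Ioo 0 s.V) : ContinuousOn (s.al j v) (Icc 0 s.X) := by
  unfold al
  exact (((bt1_cont j).comp_continuousOn (s.pcg v hv)).neg).mul
    (((s.Fc v hv).pow 2).div s.Kc.continuousOn (fun g _ => (s.Kpos g).ne'))

lemma En_cont {v : ℝ} (hv : v ∈ Ioo 0 s.V) :
    ContinuousOn (fun g => s.ψ g * exp (-(s.p v g)) * (s.F v g ^ 2 / s.K g)) (Icc 0 s.X) :=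
  (s.ψc.continuousOn.mul (s.pcg v hv).neg.rexp).mul
    (((s.Fc v hv).pow 2).div s.Kc.continuousOn (fun g _ => (s.Kpos g).ne'))

lemma alT_nonneg {j : ℝ} (hj : 0 < j) (v : ℝ) : 0 ≤ s.alT j v :=
  intervalIntegral.integral_nonneg s.hX.le (fun g _ => al_nonneg hj v g)

lemma alT_m (j : ℝ) : Measurable (s.alT j) := by
  have : s.alT j = fun v => ∫ g in Ioc 0 s.X, s.al j v g := by
    ext v; unfold alT; rw [intervalIntegral.integral_of_le s.hX.le]
  rw [this]
  exact ((al_m j).stronglyMeasurable.integral_prod_right).measurable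

lemma alT_int {a b j : ℝ} (ha : 0 ≤ a) (hab : a ≤ b) (hb : b ≤ s.V) (h : s.base a b) (hj : s.k0 ≤ j) :
    IntervalIntegrable (s.alT j) volume a b := by
  obtain ⟨c, hc, hle⟩ := s.al_le hj
  have hj0 := s.hk0.trans_le hj
  have hE := (En_int ha hab hb h).const_mul c
  rw [intervalIntegrable_iff_integrableOn_Ioo_of_le hab] at hE ⊢
  refine hE.mono' (alT_m j).aestronglyMeasurable ?_
  refine (ae_restrict_mem measurableSet_Ioo).mono fun v hv => ?_
  have hv' : v ∈ Ioo 0 s.V := Ioo_subset_Ioo ha hb hv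
  rw [Real.norm_eq_abs, abs_of_nonneg (alT_nonneg hj0 v)]
  unfold alT En
  rw [← intervalIntegral.integral_const_mul]
  exact intervalIntegral.integral_mono_on s.hX.le (ii_of_cont (al_cont hv') s.hX.le le_rfl le_rfl)
    (ii_of_cont (continuousOn_const.mul (En_cont hv')) s.hX.le le_rfl le_rfl) (fun g hg => hle v g hg)

/-- joint integrability of `α_j` -/
lemma al_int {a b j : ℝ} (ha : 0 ≤ a) (hab : a ≤ b) (hb : b ≤ s.V) (h : s.base a b) (hj : s.k0 ≤ j) :
    Integrable (Function.uncurry (s.al j)) ((volume.restrict (Ioo a b)).prod (volume.restrict (Ioc 0 s.X))) := by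
  have hj0 := s.hk0.trans_le hj
  rw [integrable_prod_iff (al_m j).aestronglyMeasurable]
  constructor
  · refine (ae_restrict_mem measurableSet_Ioo).mono fun v hv => ?_
    have hv' : v ∈ Ioo 0 s.V := Ioo_subset_Ioo ha hb hv
    exact (ii_of_cont (al_cont hv') s.hX.le le_rfl le_rfl).1
  · have := alT_int ha hab hb h hj
    rw [intervalIntegrable_iff_integrableOn_Ioo_of_le hab] at this
    refine this.congr (Eventually.of_forall fun v => ?_)
    simp only [alT, Function.uncurry]
    rw [intervalIntegral.integral_of_le s.hX.le]
    refine integral_congr_ae (Eventually.of_forall fun g => ?_)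
    simp only
    rw [Real.norm_eq_abs, abs_of_nonneg (al_nonneg hj0 v g)]

end Sys
end

section
namespace Sys
variable {s : Sys}

lemma int_ind {x1 x2 : ℝ} (h0 : 0 ≤ x1) (hx : x1 ≤ x2) (hX : x2 ≤ s.X) (f : ℝ → ℝ) :
    ∫ g in (0:ℝ)..s.X, (Ioc x1 x2).indicator f g = ∫ g in Ioc x1 x2, f g := by
  rw [intervalIntegral.integral_of_le s.hX.le, integral_indicator measurableSet_Ioc,
    Measure.restrict_restrict measurableSet_Ioc]
  congr 2
  exact inter_eq_left.2 (Ioc_subset_Ioc h0 hX)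

variable (s)
def kap (j v g : ℝ) : ℝ := th j (s.p v g) - bt j (s.p v g) * s.p v g
def aa (a b j g : ℝ) : ℝ := ∫ v in Ioo a b, s.al j v g
def cc (a b j g : ℝ) : ℝ := ∫ v in Ioo a b, s.r g * s.kap j v g
def dd (a b j g : ℝ) : ℝ := s.R b g * th j (s.p b g) - s.R a g * th j (s.p a g)
def di (a b g : ℝ) : ℝ := s.R b g * s.p b g - s.R a g * s.p a g
def Hj (a b j g : ℝ) : ℝ := s.aa a b j g - s.cc a b j g - s.dd a b j g
variable {s}

lemma kap_nonneg {j : ℝ} (hj : 0 < j) (v g : ℝ) : 0 ≤ s.kap j v g := by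
  have := bt_mul_le (j := j) hj (s.pnn v g); unfold kap; linarith
lemma kap_le (j v g : ℝ) : s.kap j v g ≤ s.p v g := by
  have h1 := th_le (j := j) (s.pnn v g)
  have h2 := mul_nonneg (bt_nonneg j (s.p v g)) (s.pnn v g)
  unfold kap; linarith
lemma kap_le2 {j : ℝ} (hj : 0 < j) (v g : ℝ) : s.kap j v g ≤ 2 * j := by
  have h1 := th_le_two hj (s.pnn v g)
  have h2 := mul_nonneg (bt_nonneg j (s.p v g)) (s.pnn v g)
  unfold kap; linarith
lemma kap_zero {j v g : ℝ} (hj : 0 < j) (h : s.p v g ≤ j) : s.kap j v g = 0 := by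
  unfold kap; rw [th_eq hj (s.pnn v g) h, bt_one hj h]; ring
lemma kap_m (j : ℝ) : Measurable (Function.uncurry (s.kap j)) := by
  have h : Measurable fun x : ℝ × ℝ => s.p x.1 x.2 := s.pm
  exact ((th_cont j).measurable.comp h).sub (((bt_cont j).measurable.comp h).mul h)

lemma rkap_int {a b j : ℝ} (hj : 0 < j) :
    Integrable (fun x : ℝ × ℝ => s.r x.2 * s.kap j x.1 x.2)
      ((volume.restrict (Ioo a b)).prod (volume.restrict (Ioc 0 s.X))) := by
  have hr : Measurable fun x : ℝ × ℝ => s.r x.2 := s.rc.measurable.comp measurable_snd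
  refine Integrable.of_bound (hr.mul (kap_m j)).aestronglyMeasurable (s.M * (2 * j)) ?_
  rw [Measure.prod_restrict]
  refine (ae_restrict_mem (measurableSet_Ioo.prod measurableSet_Ioc)).mono fun x hx => ?_
  have hg := Ioc_subset_Icc_self hx.2
  rw [Real.norm_eq_abs, abs_mul, abs_of_nonneg (s.rnn _ hg), abs_of_nonneg (kap_nonneg hj _ _)]
  exact mul_le_mul (s.rM hg) (kap_le2 hj _ _) (kap_nonneg hj _ _) s.M0

lemma aa_int {a b j : ℝ} (ha : 0 ≤ a) (hab : a ≤ b) (hb : b ≤ s.V) (h : s.base a b) (hj : s.k0 ≤ j) :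
    IntegrableOn (s.aa a b j) (Ioc 0 s.X) := (al_int ha hab hb h hj).integral_prod_right
lemma cc_int {a b j : ℝ} (hj : 0 < j) :
    IntegrableOn (s.cc a b j) (Ioc 0 s.X) := (rkap_int (a := a) (b := b) hj).integral_prod_right

lemma dd_m (a b j : ℝ) : Measurable (s.dd a b j) :=
  ((Rcontg b).measurable.mul ((th_cont j).measurable.comp (pmg b))).sub
    ((Rcontg a).measurable.mul ((th_cont j).measurable.comp (pmg a)))

lemma dd_int {a b j : ℝ} (ha : 0 ≤ a) (hab : a ≤ b) (hb : b ≤ s.V) (hj : 0 < j) :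
    IntegrableOn (s.dd a b j) (Ioc 0 s.X) := by
  refine Integrable.of_bound (dd_m a b j).aestronglyMeasurable (s.M * (2 * j) + s.M * (2 * j)) ?_
  refine (ae_restrict_mem measurableSet_Ioc).mono fun g hg => ?_
  have hg := Ioc_subset_Icc_self hg
  have aux : ∀ v ∈ Icc 0 s.V, |s.R v g * th j (s.p v g)| ≤ s.M * (2 * j) := by
    intro v hv
    rw [abs_mul, abs_of_nonneg (th_nonneg (s.pnn v g))]
    exact mul_le_mul (s.RM hg hv) (th_le_two hj (s.pnn v g)) (th_nonneg (s.pnn v g)) s.M0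
  rw [Real.norm_eq_abs]
  refine (abs_sub _ _).trans (add_le_add (aux b ⟨ha.trans hab, hb⟩) (aux a ⟨ha, hab.trans hb⟩))

lemma Hj_int {a b j : ℝ} (ha : 0 ≤ a) (hab : a ≤ b) (hb : b ≤ s.V) (h : s.base a b) (hj : s.k0 ≤ j) :
    IntegrableOn (s.Hj a b j) (Ioc 0 s.X) :=
  ((aa_int ha hab hb h hj).sub (cc_int (s.hk0.trans_le hj))).sub (dd_int ha hab hb (s.hk0.trans_le hj))

/-- identity D0 -/
lemma D0 {a b : ℝ} (ha : 0 ≤ a) (hab : a ≤ b) (hb : b ≤ s.V) (hbase : s.base a b) {j k : ℝ}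
    (hk : s.k0 ≤ k) (hkj : k ≤ j) {x1 x2 : ℝ} (h0 : 0 ≤ x1) (hx : x1 ≤ x2) (hG : x2 ≤ s.G) (u w : ℝ)
    (hx1 : (∀ v ∈ Ioo a b, s.p v x1 ≤ k) ∨ u + w * x1 = 0)
    (hx2 : (∀ v ∈ Ioo a b, s.p v x2 ≤ k) ∨ u + w * x2 = 0) :
    ∫ g in Ioc x1 x2, (u + w * g)^2 * (s.Hj a b j g - s.Hj a b k g) =
    - ∫ v in Ioo a b, ∫ g in Ioc x1 x2, (s.K1 g * (2 * w * (u + w * g)) + s.K g * (2 * w^2)) *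
        (th j (s.p v g) - th k (s.p v g)) := by
  have hk0 := s.hk0.trans_le hk
  have hj := hk.trans hkj
  have hj0 := s.hk0.trans_le hj
  have hX : x2 ≤ s.X := hG.trans s.hGX.le
  have hsub : Ioo a b ⊆ Ioo 0 s.V := Ioo_subset_Ioo ha hb
  have hIs : Ioc x1 x2 ⊆ Ioc 0 s.X := Ioc_subset_Ioc h0 hX
  set φ : ℝ → ℝ := fun g => (u + w * g)^2 with hφ
  set φ1 : ℝ → ℝ := fun g => 2 * w * (u + w * g) with hφ1
  set φ2 : ℝ → ℝ := fun g => s.K1 g * (2 * w * (u + w * g)) + s.K g * (2 * w^2) with hφ2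
  have φc : Continuous φ := by simp only [hφ]; fun_prop
  have φ1c : Continuous φ1 := by simp only [hφ1]; fun_prop
  have φ2c : Continuous φ2 := by
    have := s.K1c; have := s.Kc; simp only [hφ2]; fun_prop
  have lin : ∀ g : ℝ, HasDerivAt (fun g : ℝ => u + w * g) w g := fun g => by
    simpa using ((hasDerivAt_id g).const_mul w).const_add u
  have φd : ∀ g, HasDerivAt φ (φ1 g) g := fun g => by
    have := (lin g).pow 2
    refine this.congr_deriv ?_
    simp only [hφ1]; ring
  have φ1d : ∀ g, HasDerivAt (fun g => s.K g * φ1 g) (φ2 g) g := fun g => by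
    have := (s.Kder g).mul ((lin g).const_mul (2 * w))
    refine this.congr_deriv ?_
    simp only [hφ2]; ring
  obtain ⟨Cφ, hCφ⟩ := (isCompact_Icc (a := (0:ℝ)) (b := s.X)).exists_bound_of_continuousOn φc.continuousOn
  obtain ⟨C2, hC2⟩ := (isCompact_Icc (a := (0:ℝ)) (b := s.X)).exists_bound_of_continuousOn φ2c.continuousOn
  have hCφ0 : 0 ≤ Cφ := (norm_nonneg _).trans (hCφ 0 ⟨le_rfl, s.hX.le⟩)
  have hC20 : 0 ≤ C2 := (norm_nonneg _).trans (hC2 0 ⟨le_rfl, s.hX.le⟩)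
  have thd : ∀ y, 0 ≤ y → |th j y - th k y| ≤ 2 * j := by
    intro y hy
    have h1 := th_mono_j hk0 hkj hy
    have h2 := th_le_two hj0 hy
    have h3 := th_nonneg (j := k) hy
    rw [abs_of_nonneg (by linarith)]; linarith
  have btd : ∀ y, |bt j y - bt k y| ≤ 1 := by
    intro y
    rw [abs_le]; constructor <;> linarith [bt_nonneg j y, bt_nonneg k y, bt_le_one j y, bt_le_one k y]
  set Ψ : ℝ → ℝ → ℝ := fun g y => (Ioc x1 x2).indicator φ g * (th j y - th k y) with hΨ
  set Ψ' : ℝ → ℝ → ℝ := fun g y => (Ioc x1 x2).indicator φ g * (bt j y - bt k y) with hΨ'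
  have indb : ∀ g ∈ Icc 0 s.X, |(Ioc x1 x2).indicator φ g| ≤ Cφ * s.ψ g := by
    intro g hg
    by_cases hm : g ∈ Ioc x1 x2
    · rw [indicator_of_mem hm, s.ψlow g (hm.2.trans hG), mul_one]; exact hCφ g hg
    · rw [indicator_of_notMem hm, abs_zero]; exact mul_nonneg hCφ0 (s.ψnn g)
  have indm : Measurable fun x : ℝ × ℝ => (Ioc x1 x2).indicator φ x.1 :=
    (φc.measurable.indicator measurableSet_Ioc).comp measurable_fst
  have thc := th_cont j
  have thc' := th_cont k
  have btc := bt_cont j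
  have btc' := bt_cont k
  have hT : s.TF (Cφ * (2 * j + 1)) Ψ Ψ' := by
    refine ⟨by positivity, indm.mul ?_, indm.mul ?_, ?_, ?_, ?_, ?_⟩
    · exact Continuous.measurable (by fun_prop)
    · exact Continuous.measurable (by fun_prop)
    · intro g hg y hy
      simp only [hΨ]; rw [abs_mul]
      calc _ ≤ (Cφ * s.ψ g) * (2 * j + 1) := by
            refine mul_le_mul (indb g hg) (by linarith [thd y hy]) (abs_nonneg _) (mul_nonneg hCφ0 (s.ψnn g))
        _ = _ := by ring
    · intro g hg y hy
      simp only [hΨ']; rw [abs_mul]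
      calc _ ≤ (Cφ * s.ψ g) * (2 * j + 1) := by
            refine mul_le_mul (indb g hg) (by linarith [btd y]) (abs_nonneg _) (mul_nonneg hCφ0 (s.ψnn g))
        _ = _ := by ring
    · intro g _; simp only [hΨ]; fun_prop
    · intro g _ y _
      exact ((th_deriv j y).sub (th_deriv k y)).const_mul _
  -- f
  set f : ℝ → ℝ → ℝ := fun v g => φ g * ((s.al j v g - s.r g * s.kap j v g) - (s.al k v g - s.r g * s.kap k v g)) with hf
  set f2 : ℝ → ℝ → ℝ := fun v g => φ2 g * (th j (s.p v g) - th k (s.p v g)) with hf2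
  have hEid : ∀ v ∈ Ioo a b, s.E Ψ Ψ' v = (∫ g in Ioc x1 x2, f v g) + ∫ g in Ioc x1 x2, f2 v g := by
    intro v hv
    have hv' := hsub hv
    have e1 : s.E Ψ Ψ' v = ∫ g in Ioc x1 x2, φ g * ((bt j (s.p v g) - bt k (s.p v g)) * (s.S v g + s.r g * s.p v g)
        - s.r g * (th j (s.p v g) - th k (s.p v g))) := by
      rw [← int_ind h0 hx hX]
      unfold E Hh
      congr 1; ext g
      simp only [hΨ, hΨ']
      by_cases hm : g ∈ Ioc x1 x2
      · simp only [indicator_of_mem hm]; ring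
      · simp only [indicator_of_notMem hm]; ring
    have ib := ibpP hv' hx h0 hX (φ := φ) (φ1 := φ1) (φ2 := φ2)
      (B := fun y => th j y - th k y) (b := fun y => bt j y - bt k y) (b1 := fun y => bt1 j y - bt1 k y)
      (fun g _ => φd g) φc.continuousOn (fun g _ => φ1d g) φ1c.continuousOn φ2c.continuousOn
      (fun y => (th_deriv j y).sub (th_deriv k y)) (fun y => (bt_deriv j y).sub (bt_deriv k y))
      ((bt1_cont j).sub (bt1_cont k))
    have bdry : ∀ x : ℝ, ((∀ v ∈ Ioo a b, s.p v x ≤ k) ∨ u + w * x = 0) →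
        φ x * (bt j (s.p v x) - bt k (s.p v x)) * s.F v x - s.K x * φ1 x * (th j (s.p v x) - th k (s.p v x)) = 0 := by
      intro x hx
      rcases hx with hx | hx
      · have := hx v hv
        rw [bt_one hj0 (this.trans hkj), bt_one hk0 this, th_eq hj0 (s.pnn _ _) (this.trans hkj),
          th_eq hk0 (s.pnn _ _) this]; ring
      · simp only [hφ, hφ1, hx]; ring
    rw [bdry x1 hx1, bdry x2 hx2] at ib
    have pc : ContinuousOn (s.p v) (Icc 0 s.X) := s.pcg v hv'
    have tj := thc.comp_continuousOn pc
    have tk := thc'.comp_continuousOn pc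
    have bj := btc.comp_continuousOn pc
    have bk := btc'.comp_continuousOn pc
    have rc : ContinuousOn s.r (Icc 0 s.X) := s.rc.continuousOn
    have c1 : ContinuousOn (fun g => φ g * (bt j (s.p v g) - bt k (s.p v g)) * s.S v g) (Icc 0 s.X) :=
      (φc.continuousOn.mul (bj.sub bk)).mul (s.Sc v hv')
    have ck : ∀ i, ContinuousOn (s.kap i v) (Icc 0 s.X) := fun i =>
      ((th_cont i).comp_continuousOn pc).sub (((bt_cont i).comp_continuousOn pc).mul pc)
    have c3 : ContinuousOn (fun g => φ g * (s.r g * (s.kap k v g - s.kap j v g))) (Icc 0 s.X) :=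
      φc.continuousOn.mul (rc.mul ((ck k).sub (ck j)))
    have c4 : ContinuousOn (fun g => φ g * (s.al j v g - s.al k v g)) (Icc 0 s.X) :=
      φc.continuousOn.mul ((al_cont hv').sub (al_cont hv'))
    have c5 : ContinuousOn (f2 v) (Icc 0 s.X) := φ2c.continuousOn.mul (tj.sub tk)
    have e2 : s.E Ψ Ψ' v = (∫ g in x1..x2, φ g * (bt j (s.p v g) - bt k (s.p v g)) * s.S v g) +
        ∫ g in x1..x2, φ g * (s.r g * (s.kap k v g - s.kap j v g)) := by
      rw [← intervalIntegral.integral_add (ii_of_cont c1 hx h0 hX) (ii_of_cont c3 hx h0 hX), e1,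
        intervalIntegral.integral_of_le hx]
      congr 1; ext g; simp only [kap]; ring
    have e3 : ∫ g in x1..x2, φ g * (bt1 j (s.p v g) - bt1 k (s.p v g)) * (s.F v g ^ 2 / s.K g) =
        - ∫ g in x1..x2, φ g * (s.al j v g - s.al k v g) := by
      rw [← intervalIntegral.integral_neg]; congr 1; ext g; simp only [al]; ring
    have e4 : ∫ g in Ioc x1 x2, f v g = (∫ g in x1..x2, φ g * (s.al j v g - s.al k v g)) +
        ∫ g in x1..x2, φ g * (s.r g * (s.kap k v g - s.kap j v g)) := by
      rw [← intervalIntegral.integral_add (ii_of_cont c4 hx h0 hX) (ii_of_cont c3 hx h0 hX),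
        intervalIntegral.integral_of_le hx]
      congr 1; ext g; simp only [hf]; ring
    rw [e2, ib, e3, e4, ← intervalIntegral.integral_of_le hx]
    ring
  -- integrability
  have hle : (volume.restrict (Ioo a b)).prod (volume.restrict (Ioc x1 x2)) ≤
      (volume.restrict (Ioo a b)).prod (volume.restrict (Ioc 0 s.X)) :=
    by rw [Measure.prod_restrict, Measure.prod_restrict]; exact Measure.restrict_mono (prod_mono le_rfl hIs) le_rfl
  have alI : ∀ i, s.k0 ≤ i → Integrable (fun x : ℝ × ℝ => s.al i x.1 x.2 - s.r x.2 * s.kap i x.1 x.2)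
      ((volume.restrict (Ioo a b)).prod (volume.restrict (Ioc x1 x2))) := fun i hi =>
    ((al_int ha hab hb hbase hi).sub (rkap_int (s.hk0.trans_le hi))).mono_measure hle
  have φm : AEStronglyMeasurable (fun x : ℝ × ℝ => φ x.2) ((volume.restrict (Ioo a b)).prod (volume.restrict (Ioc x1 x2))) :=
    (φc.measurable.comp measurable_snd).aestronglyMeasurable
  have aeM : ∀ᵐ x ∂((volume.restrict (Ioo a b)).prod (volume.restrict (Ioc x1 x2))), x.2 ∈ Icc 0 s.X := by
    rw [Measure.prod_restrict]
    refine (ae_restrict_mem (measurableSet_Ioo.prod measurableSet_Ioc)).mono fun x hx => ?_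
    exact Ioc_subset_Icc_self (hIs hx.2)
  have fI : Integrable (Function.uncurry f) ((volume.restrict (Ioo a b)).prod (volume.restrict (Ioc x1 x2))) :=
    ((alI j hj).sub (alI k hk)).bdd_mul (c := Cφ) φm (aeM.mono fun x hx => hCφ _ hx)
  have f2I : Integrable (Function.uncurry f2) ((volume.restrict (Ioo a b)).prod (volume.restrict (Ioc x1 x2))) := by
    refine Integrable.of_bound (C := C2 * (2 * j)) ?_ (aeM.mono fun x hx => ?_)
    · have h : Measurable fun x : ℝ × ℝ => s.p x.1 x.2 := s.pm
      exact ((φ2c.measurable.comp measurable_snd).mul ((thc.measurable.comp h).sub (thc'.measurable.comp h))).aestronglyMeasurable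
    · simp only [Function.uncurry, hf2]
      rw [norm_mul]
      exact mul_le_mul (hC2 _ hx) (thd _ (s.pnn _ _)) (norm_nonneg _) hC20
  have i1 := fI.integral_prod_left
  have i2 := f2I.integral_prod_left
  simp only [Function.uncurry] at i1 i2
  have hEI : IntervalIntegrable (s.E Ψ Ψ') volume a b := by
    rw [intervalIntegrable_iff_integrableOn_Ioo_of_le hab]
    refine (i1.add i2).congr ?_
    refine (ae_restrict_mem measurableSet_Ioo).mono fun v hv => ?_
    simp only [hEid v hv, Pi.add_apply]
  obtain ⟨-, hb1⟩ := hbase _ _ _ hT (fun v => - s.E Ψ Ψ' v) hEI.neg (fun v _ => by simp)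
  have e5 : ∫ v in a..b, s.E Ψ Ψ' v = (∫ v in Ioo a b, ∫ g in Ioc x1 x2, f v g) + ∫ v in Ioo a b, ∫ g in Ioc x1 x2, f2 v g := by
    rw [intervalIntegral.integral_of_le hab, integral_Ioc_eq_integral_Ioo, ← integral_add i1 i2]
    exact setIntegral_congr_fun measurableSet_Ioo hEid
  have e6 : s.Φ Ψ b - s.Φ Ψ a = ∫ g in Ioc x1 x2, φ g * (s.dd a b j g - s.dd a b k g) := by
    have hΦ : ∀ v ∈ Icc 0 s.V, s.Φ Ψ v = ∫ g in Ioc x1 x2, φ g * (s.R v g * (th j (s.p v g) - th k (s.p v g))) ∧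
        IntegrableOn (fun g => φ g * (s.R v g * (th j (s.p v g) - th k (s.p v g)))) (Ioc x1 x2) := by
      intro v hv
      constructor
      · rw [← int_ind h0 hx hX]
        unfold Φ
        congr 1; ext g
        simp only [hΨ]
        by_cases hm : g ∈ Ioc x1 x2
        · simp only [indicator_of_mem hm]; ring
        · simp only [indicator_of_notMem hm]; ring
      · refine Integrable.of_bound (C := Cφ * (s.M * (2 * j))) ?_ ((ae_restrict_mem measurableSet_Ioc).mono fun g hg => ?_)
        · exact (φc.measurable.mul ((Rcontg v).measurable.mul ((thc.measurable.comp (pmg v)).sub (thc'.measurable.comp (pmg v))))).aestronglyMeasurable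
        · have hg' := Ioc_subset_Icc_self (hIs hg)
          rw [norm_mul, norm_mul]
          refine mul_le_mul (hCφ _ hg') (mul_le_mul (s.RM hg' hv) (thd _ (s.pnn _ _)) (norm_nonneg _) s.M0) (by positivity) hCφ0
    rw [(hΦ b ⟨ha.trans hab, hb⟩).1, (hΦ a ⟨ha, hab.trans hb⟩).1, ← integral_sub (hΦ b ⟨ha.trans hab, hb⟩).2 (hΦ a ⟨ha, hab.trans hb⟩).2]
    congr 1; ext g; simp only [dd]; ring
  have e7 : ∫ v in Ioo a b, ∫ g in Ioc x1 x2, f v g = ∫ g in Ioc x1 x2, ∫ v in Ioo a b, f v g :=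
    integral_integral_swap fI
  have e8 : ∀ᵐ g ∂(volume.restrict (Ioc x1 x2)), ∫ v in Ioo a b, f v g =
      φ g * ((s.aa a b j g - s.cc a b j g) - (s.aa a b k g - s.cc a b k g)) := by
    have q := fun i hi => ((al_int ha hab hb hbase (j := i) hi).mono_measure hle).prod_left_ae
    have q' := fun i (hi : s.k0 ≤ i) => ((rkap_int (s := s) (a := a) (b := b) (s.hk0.trans_le hi)).mono_measure hle).prod_left_ae
    filter_upwards [q j hj, q k hk, q' j hj, q' k hk] with g q1 q2 q3 q4
    simp only [Function.uncurry] at q1 q2 q3 q4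
    simp only [hf, aa, cc]
    have w1 : Integrable (fun v => s.al j v g - s.r g * s.kap j v g) (volume.restrict (Ioo a b)) := q1.sub q3
    have w2 : Integrable (fun v => s.al k v g - s.r g * s.kap k v g) (volume.restrict (Ioo a b)) := q2.sub q4
    rw [integral_const_mul, integral_sub w1 w2, integral_sub q1 q3, integral_sub q2 q4]
  rw [e7, integral_congr_ae e8] at e5
  have dI : ∀ i, s.k0 ≤ i → IntegrableOn (s.dd a b i) (Ioc x1 x2) := fun i hi =>
    (dd_int ha hab hb (s.hk0.trans_le hi)).mono_set hIs
  have acI : ∀ i, s.k0 ≤ i → IntegrableOn (fun g => s.aa a b i g - s.cc a b i g) (Ioc x1 x2) := fun i hi =>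
    ((aa_int ha hab hb hbase hi).sub (cc_int (s.hk0.trans_le hi))).mono_set hIs
  have φm' : AEStronglyMeasurable φ (volume.restrict (Ioc x1 x2)) := φc.aestronglyMeasurable
  have aeM' : ∀ᵐ g ∂(volume.restrict (Ioc x1 x2)), ‖φ g‖ ≤ Cφ :=
    (ae_restrict_mem measurableSet_Ioc).mono fun g hg => hCφ _ (Ioc_subset_Icc_self (hIs hg))
  have z1 : Integrable (fun g => φ g * ((s.aa a b j g - s.cc a b j g) - (s.aa a b k g - s.cc a b k g))) (volume.restrict (Ioc x1 x2)) :=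
    ((acI j hj).sub (acI k hk)).bdd_mul (c := Cφ) φm' aeM'
  have z2 : Integrable (fun g => φ g * (s.dd a b j g - s.dd a b k g)) (volume.restrict (Ioc x1 x2)) :=
    ((dI j hj).sub (dI k hk)).bdd_mul (c := Cφ) φm' aeM'
  have e9 : ∫ g in Ioc x1 x2, φ g * (s.Hj a b j g - s.Hj a b k g) =
      (∫ g in Ioc x1 x2, φ g * ((s.aa a b j g - s.cc a b j g) - (s.aa a b k g - s.cc a b k g))) -
      ∫ g in Ioc x1 x2, φ g * (s.dd a b j g - s.dd a b k g) := by
    rw [← integral_sub z1 z2]; congr 1; ext g; simp only [Hj]; ring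
  rw [e9, ← e6, hb1, e5]; ring

end Sys
end

section
namespace Sys
variable {s : Sys}

variable (s)
def Fk (a b k : ℝ) : Set ℝ := {g ∈ Icc 0 s.G | ∀ v ∈ Ioo a b, s.p v g ≤ k}
def err (a b j : ℝ) : ℝ := ∫ g in Ioc 0 s.X, (|s.cc a b j g| + |s.dd a b j g - s.di a b g|)
def hk (a b k g : ℝ) : ℝ := s.Hj a b k g + s.di a b g
def An (a b : ℝ) (n : ℕ) (x : ℝ) : ℝ := ∫ g in Ioc 0 x, s.aa a b (s.k0 + n) g
variable {s}

lemma di_m (a b : ℝ) : Measurable (s.di a b) :=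
  ((Rcontg b).measurable.mul (pmg b)).sub ((Rcontg a).measurable.mul (pmg a))

lemma k0n (n : ℕ) : s.k0 ≤ s.k0 + n := by linarith [(Nat.cast_nonneg n : (0:ℝ) ≤ n)]

lemma ev_le (y : ℝ) : ∀ᶠ n : ℕ in atTop, y ≤ s.k0 + n := by
  obtain ⟨N, hN⟩ := exists_nat_ge (y - s.k0)
  filter_upwards [eventually_ge_atTop N] with n hn
  have : (N:ℝ) ≤ n := by exact_mod_cast hn
  linarith

lemma p_int {a b : ℝ} (ha : 0 ≤ a) (hb : b ≤ s.V) : Integrable (fun x : ℝ × ℝ => s.p x.1 x.2)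
      ((volume.restrict (Ioo a b)).prod (volume.restrict (Ioc 0 s.X))) := by
  have h := s.pint
  rw [IntegrableOn, Measure.volume_eq_prod, ← Measure.prod_restrict] at h
  rw [← restrict_Ioo_eq_restrict_Ioc]
  refine h.mono_measure ?_
  rw [Measure.prod_restrict, Measure.prod_restrict]
  exact Measure.restrict_mono (prod_mono (Ioo_subset_Ioo ha hb) le_rfl) le_rfl

lemma err_tend {a b : ℝ} (ha : 0 ≤ a) (hab : a ≤ b) (hb : b ≤ s.V)
    (hRa : IntegrableOn (fun g => s.R a g * s.p a g) (Ioc 0 s.X))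
    (hRb : IntegrableOn (fun g => s.R b g * s.p b g) (Ioc 0 s.X)) :
    Tendsto (fun n : ℕ => s.err a b (s.k0 + n)) atTop (𝓝 0) := by
  have pos : ∀ n : ℕ, 0 < s.k0 + n := fun n => s.hk0.trans_le (k0n n)
  have dI : ∀ n : ℕ, IntegrableOn (fun g => s.dd a b (s.k0 + n) g - s.di a b g) (Ioc 0 s.X) :=
    fun n : ℕ => (dd_int (s := s) ha hab hb (pos n)).sub (hRb.sub hRa)
  have e : ∀ n : ℕ, s.err a b (s.k0 + n) =
      (∫ x, s.r x.2 * s.kap (s.k0 + n) x.1 x.2 ∂((volume.restrict (Ioo a b)).prod (volume.restrict (Ioc 0 s.X)))) +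
      ∫ g in Ioc 0 s.X, |s.dd a b (s.k0 + n) g - s.di a b g| := by
    intro n
    unfold err
    rw [integral_add (cc_int (a := a) (b := b) (pos n)).abs (dI n).abs]
    congr 1
    rw [integral_prod_symm _ (rkap_int (pos n))]
    refine setIntegral_congr_fun measurableSet_Ioc fun g hg => ?_
    simp only [cc]
    exact abs_of_nonneg (integral_nonneg fun v => mul_nonneg (s.rnn g (Ioc_subset_Icc_self hg)) (kap_nonneg (pos n) v g))
  simp only [e]
  have t1 : Tendsto (fun n : ℕ => ∫ x, s.r x.2 * s.kap (s.k0 + n) x.1 x.2 ∂((volume.restrict (Ioo a b)).prod (volume.restrict (Ioc 0 s.X)))) atTop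
      (𝓝 (∫ x : ℝ × ℝ, (0:ℝ) ∂((volume.restrict (Ioo a b)).prod (volume.restrict (Ioc 0 s.X))))) := by
    refine tendsto_integral_of_dominated_convergence (fun x : ℝ × ℝ => s.M * s.p x.1 x.2) (fun n => ?_) ?_ (fun n => ?_) ?_
    · exact (rkap_int (pos n)).aestronglyMeasurable
    · exact (p_int ha hb).const_mul _
    · rw [Measure.prod_restrict]
      refine (ae_restrict_mem (measurableSet_Ioo.prod measurableSet_Ioc)).mono fun x hx => ?_
      have hg := Ioc_subset_Icc_self hx.2
      rw [Real.norm_eq_abs, abs_mul, abs_of_nonneg (s.rnn _ hg), abs_of_nonneg (kap_nonneg (pos n) _ _)]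
      exact mul_le_mul (s.rM hg) (kap_le _ _ _) (kap_nonneg (pos n) _ _) s.M0
    · refine Eventually.of_forall fun x => ?_
      refine tendsto_const_nhds.congr' ?_
      filter_upwards [ev_le (s := s) (s.p x.1 x.2)] with n hn
      rw [kap_zero (pos n) hn, mul_zero]
  have t2 : Tendsto (fun n : ℕ => ∫ g in Ioc 0 s.X, |s.dd a b (s.k0 + n) g - s.di a b g|) atTop
      (𝓝 (∫ g in Ioc 0 s.X, (0:ℝ))) := by
    refine tendsto_integral_of_dominated_convergence (fun g => |s.R b g * s.p b g| + |s.R a g * s.p a g|) (fun n => ?_) ?_ (fun n => ?_) ?_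
    · exact ((dd_m a b _).sub (di_m a b)).norm.aestronglyMeasurable
    · exact hRb.abs.add hRa.abs
    · refine Eventually.of_forall fun g => ?_
      have aux : ∀ v, |s.R v g * th (s.k0 + n) (s.p v g) - s.R v g * s.p v g| ≤ |s.R v g * s.p v g| := by
        intro v
        rw [← mul_sub, abs_mul, abs_mul]
        refine mul_le_mul_of_nonneg_left ?_ (abs_nonneg _)
        have h1 := th_nonneg (j := s.k0 + n) (s.pnn v g)
        have h2 := th_le (j := s.k0 + n) (s.pnn v g)
        rw [abs_of_nonneg (s.pnn v g), abs_le]; constructor <;> linarith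
      rw [Real.norm_eq_abs, abs_abs]
      have : s.dd a b (s.k0 + n) g - s.di a b g = (s.R b g * th (s.k0 + n) (s.p b g) - s.R b g * s.p b g) -
          (s.R a g * th (s.k0 + n) (s.p a g) - s.R a g * s.p a g) := by simp only [dd, di]; ring
      rw [this]
      exact (abs_sub _ _).trans (add_le_add (aux b) (aux a))
    · refine Eventually.of_forall fun g => ?_
      refine tendsto_const_nhds.congr' ?_
      filter_upwards [ev_le (s := s) (s.p a g), ev_le (s := s) (s.p b g)] with n h1 h2
      simp only [dd, di]
      rw [th_eq (pos n) (s.pnn _ _) h1, th_eq (pos n) (s.pnn _ _) h2]; simp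
  simpa using t1.add t2

lemma hk_int {a b j : ℝ} (ha : 0 ≤ a) (hab : a ≤ b) (hb : b ≤ s.V) (h : s.base a b) (hj : s.k0 ≤ j)
    (hRa : IntegrableOn (fun g => s.R a g * s.p a g) (Ioc 0 s.X))
    (hRb : IntegrableOn (fun g => s.R b g * s.p b g) (Ioc 0 s.X)) :
    IntegrableOn (s.hk a b j) (Ioc 0 s.X) := (Hj_int ha hab hb h hj).add (hRb.sub hRa)

lemma keyL {a b : ℝ} (ha : 0 ≤ a) (hab : a ≤ b) (hb : b ≤ s.V) (h : s.base a b)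
    (hRa : IntegrableOn (fun g => s.R a g * s.p a g) (Ioc 0 s.X))
    (hRb : IntegrableOn (fun g => s.R b g * s.p b g) (Ioc 0 s.X)) {j k : ℝ}
    (hk : s.k0 ≤ k) (hkj : k ≤ j) {x1 x2 : ℝ} (h0 : 0 ≤ x1) (hX : x2 ≤ s.X) {φ : ℝ → ℝ}
    (φc : Continuous φ) (φ0 : ∀ g ∈ Icc x1 x2, 0 ≤ φ g) (φ1 : ∀ g ∈ Icc x1 x2, φ g ≤ 1) :
    |(∫ g in Ioc x1 x2, φ g * s.aa a b j g) - (∫ g in Ioc x1 x2, φ g * s.hk a b k g)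
      - ∫ g in Ioc x1 x2, φ g * (s.Hj a b j g - s.Hj a b k g)| ≤ s.err a b j := by
  have hj := hk.trans hkj
  have hj0 := s.hk0.trans_le hj
  have hIs : Ioc x1 x2 ⊆ Ioc 0 s.X := Ioc_subset_Ioc h0 hX
  have φm : AEStronglyMeasurable φ (volume.restrict (Ioc x1 x2)) := φc.aestronglyMeasurable
  have φb : ∀ᵐ g ∂(volume.restrict (Ioc x1 x2)), ‖φ g‖ ≤ 1 :=
    (ae_restrict_mem measurableSet_Ioc).mono fun g hg => by
      rw [Real.norm_eq_abs, abs_of_nonneg (φ0 g (Ioc_subset_Icc_self hg))]; exact φ1 g (Ioc_subset_Icc_self hg)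
  have i1 : Integrable (fun g => φ g * s.aa a b j g) (volume.restrict (Ioc x1 x2)) :=
    ((aa_int ha hab hb h hj).mono_set hIs).bdd_mul φm φb
  have i2 : Integrable (fun g => φ g * s.hk a b k g) (volume.restrict (Ioc x1 x2)) :=
    ((hk_int ha hab hb h hk hRa hRb).mono_set hIs).bdd_mul φm φb
  have i3 : Integrable (fun g => φ g * (s.Hj a b j g - s.Hj a b k g)) (volume.restrict (Ioc x1 x2)) :=
    (((Hj_int ha hab hb h hj).sub (Hj_int ha hab hb h hk)).mono_set hIs).bdd_mul φm φb
  have i12 : Integrable (fun g => φ g * s.aa a b j g - φ g * s.hk a b k g) (volume.restrict (Ioc x1 x2)) := i1.sub i2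
  have i4 : IntegrableOn (fun g => |s.cc a b j g| + |s.dd a b j g - s.di a b g|) (Ioc 0 s.X) :=
    (cc_int hj0).abs.add ((dd_int ha hab hb hj0).sub (hRb.sub hRa)).abs
  rw [← integral_sub i1 i2, ← integral_sub i12 i3]
  calc _ ≤ ∫ g in Ioc x1 x2, (|s.cc a b j g| + |s.dd a b j g - s.di a b g|) := by
        rw [← Real.norm_eq_abs]
        refine norm_integral_le_of_norm_le (i4.mono_set hIs) ?_
        filter_upwards [φb] with g hg
        have e : φ g * s.aa a b j g - φ g * s.hk a b k g - φ g * (s.Hj a b j g - s.Hj a b k g) =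
          φ g * (s.cc a b j g + (s.dd a b j g - s.di a b g)) := by simp only [Sys.hk, Hj]; ring
        rw [e, norm_mul]
        calc _ ≤ 1 * ‖s.cc a b j g + (s.dd a b j g - s.di a b g)‖ := by gcongr
          _ ≤ _ := by rw [one_mul]; exact norm_add_le _ _
    _ ≤ _ := setIntegral_mono_set i4 (Eventually.of_forall fun g => by positivity) hIs.eventuallyLE

lemma aa_nonneg {a b j : ℝ} (hj : 0 < j) (g : ℝ) : 0 ≤ s.aa a b j g :=
  integral_nonneg fun v => al_nonneg hj v g

lemma U6 {a b : ℝ} (ha : 0 ≤ a) (hab : a ≤ b) (hb : b ≤ s.V) (h : s.base a b)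
    (hRa : IntegrableOn (fun g => s.R a g * s.p a g) (Ioc 0 s.X))
    (hRb : IntegrableOn (fun g => s.R b g * s.p b g) (Ioc 0 s.X)) {j k : ℝ}
    (hk : s.k0 ≤ k) (hkj : k ≤ j) {x1 x2 : ℝ} (h0 : 0 ≤ x1) (hx : x1 ≤ x2) (hG : x2 ≤ s.G) (u w : ℝ)
    (hx1 : (∀ v ∈ Ioo a b, s.p v x1 ≤ k) ∨ u + w * x1 = 0)
    (hx2 : (∀ v ∈ Ioo a b, s.p v x2 ≤ k) ∨ u + w * x2 = 0)
    (hu0 : ∀ g ∈ Icc x1 x2, 0 ≤ u + w * g) (hu1 : ∀ g ∈ Icc x1 x2, u + w * g ≤ 1)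
    (hw : s.M ^ 2 ≤ |w|) {y1 y2 : ℝ} (hy1 : x1 ≤ y1) (hy2 : y2 ≤ x2)
    (hy : ∀ g ∈ Icc y1 y2, 1 / 2 ≤ u + w * g) :
    ∫ g in Ioc y1 y2, s.aa a b j g ≤ 4 * ((∫ g in Ioc x1 x2, |s.hk a b k g|) + s.err a b j) := by
  have hj := hk.trans hkj
  have hj0 := s.hk0.trans_le hj
  have hk0 := s.hk0.trans_le hk
  have hX : x2 ≤ s.X := hG.trans s.hGX.le
  have hIs : Ioc x1 x2 ⊆ Ioc 0 s.X := Ioc_subset_Ioc h0 hX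
  have hd := D0 ha hab hb h hk hkj h0 hx hG u w hx1 hx2
  have φc : Continuous fun g : ℝ => (u + w * g)^2 := by fun_prop
  have φ1 : ∀ g ∈ Icc x1 x2, (u + w * g)^2 ≤ 1 := fun g hg => by
    have := hu0 g hg; have := hu1 g hg; nlinarith
  have kl := keyL ha hab hb h hRa hRb hk hkj h0 hX φc (fun g _ => sq_nonneg _) φ1
  have neg : ∫ g in Ioc x1 x2, (u + w * g)^2 * (s.Hj a b j g - s.Hj a b k g) ≤ 0 := by
    rw [hd, neg_nonpos]
    refine integral_nonneg fun v => setIntegral_nonneg measurableSet_Ioc fun g hg => ?_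
    have hg' := Ioc_subset_Icc_self (hIs hg)
    refine mul_nonneg ?_ (by linarith [th_mono_j hk0 hkj (s.pnn v g)])
    have q1 := hu0 g (Ioc_subset_Icc_self hg)
    have q2 := hu1 g (Ioc_subset_Icc_self hg)
    have q3 : |s.K1 g * (w * (u + w * g))| ≤ s.M * (|w| * 1) := by
      rw [abs_mul, abs_mul, abs_of_nonneg q1]
      exact mul_le_mul (s.K1M hg') (by gcongr) (by positivity) s.M0
    have q4 : s.M * |w| ≤ s.K g * w ^ 2 := by
      have k1 := s.KiM hg'
      have kp := s.Kpos g
      rw [div_le_iff₀ kp] at k1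
      have : s.M ≤ s.K g * |w| := by
        calc s.M = s.M * 1 := by ring
          _ ≤ s.M * (s.M * s.K g) := by gcongr; exact s.M0
          _ = s.K g * s.M^2 := by ring
          _ ≤ _ := by gcongr
      calc s.M * |w| ≤ (s.K g * |w|) * |w| := by gcongr
        _ = s.K g * |w|^2 := by ring
        _ = _ := by rw [sq_abs]
    have := neg_abs_le (s.K1 g * (w * (u + w * g)))
    nlinarith
  have φm : AEStronglyMeasurable (fun g : ℝ => (u + w * g)^2) (volume.restrict (Ioc x1 x2)) := φc.aestronglyMeasurable
  have φb : ∀ᵐ g ∂(volume.restrict (Ioc x1 x2)), ‖(u + w * g)^2‖ ≤ 1 :=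
    (ae_restrict_mem measurableSet_Ioc).mono fun g hg => by
      rw [Real.norm_eq_abs, abs_of_nonneg (sq_nonneg _)]; exact φ1 g (Ioc_subset_Icc_self hg)
  have aI := (aa_int ha hab hb h hj).mono_set hIs
  have i1 : Integrable (fun g => (u + w * g)^2 * s.aa a b j g) (volume.restrict (Ioc x1 x2)) :=
    aI.bdd_mul φm φb
  have hI := (hk_int ha hab hb h hk hRa hRb).mono_set hIs
  have i2 : Integrable (fun g => (u + w * g)^2 * s.hk a b k g) (volume.restrict (Ioc x1 x2)) :=
    hI.bdd_mul φm φb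
  have up : ∫ g in Ioc x1 x2, (u + w * g)^2 * s.hk a b k g ≤ ∫ g in Ioc x1 x2, |s.hk a b k g| := by
    refine integral_mono_ae i2 hI.abs ?_
    filter_upwards [φb] with g hg
    calc _ ≤ ‖(u + w * g)^2 * s.hk a b k g‖ := le_abs_self _
      _ ≤ 1 * ‖s.hk a b k g‖ := by rw [norm_mul]; gcongr
      _ = _ := by rw [one_mul]; rfl
  have hYs : Ioc y1 y2 ⊆ Ioc x1 x2 := Ioc_subset_Ioc hy1 hy2
  have lo : ∫ g in Ioc y1 y2, s.aa a b j g ≤ 4 * ∫ g in Ioc x1 x2, (u + w * g)^2 * s.aa a b j g := by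
    rw [← integral_const_mul]
    calc _ ≤ ∫ g in Ioc y1 y2, 4 * ((u + w * g)^2 * s.aa a b j g) := by
          refine setIntegral_mono_on (aI.mono_set hYs) ((i1.const_mul 4).mono_measure (Measure.restrict_mono hYs le_rfl)) measurableSet_Ioc fun g hg => ?_
          have q := hy g (Ioc_subset_Icc_self hg)
          have q' := aa_nonneg (s := s) (a := a) (b := b) hj0 g
          have : 1 ≤ 4 * (u + w * g)^2 := by nlinarith
          nlinarith
      _ ≤ _ := by
          refine setIntegral_mono_set (i1.const_mul 4) (Eventually.of_forall fun g => ?_) hYs.eventuallyLE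
          have q' := aa_nonneg (s := s) (a := a) (b := b) hj0 g
          simp only [Pi.zero_apply]; positivity
  have := (abs_le.1 kl).2
  linarith

lemma E6 {a b : ℝ} (ha : 0 ≤ a) (hab : a ≤ b) (hb : b ≤ s.V) (h : s.base a b)
    (hRa : IntegrableOn (fun g => s.R a g * s.p a g) (Ioc 0 s.X))
    (hRb : IntegrableOn (fun g => s.R b g * s.p b g) (Ioc 0 s.X)) {j k : ℝ}
    (hk : s.k0 ≤ k) (hkj : k ≤ j) {x1 x2 : ℝ} (hx : x1 ≤ x2)
    (hx1 : x1 ∈ s.Fk a b k) (hx2 : x2 ∈ s.Fk a b k) :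
    |(∫ g in Ioc x1 x2, s.aa a b j g) - ∫ g in Ioc x1 x2, s.hk a b k g| ≤ s.err a b j := by
  have hd := D0 ha hab hb h hk hkj hx1.1.1 hx hx2.1.2 1 0 (Or.inl hx1.2) (Or.inl hx2.2)
  have kl := keyL ha hab hb h hRa hRb hk hkj hx1.1.1 (hx2.1.2.trans s.hGX.le) (φ := fun g => (1 + 0 * g)^2)
    (by fun_prop) (fun g _ => sq_nonneg _) (fun g _ => by simp)
  rw [hd] at kl
  simpa using kl

theorem L6 {a b : ℝ} (ha : 0 ≤ a) (hab : a < b) (hb : b ≤ s.V) (h : s.base a b)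
    (hRa : IntegrableOn (fun g => s.R a g * s.p a g) (Ioc 0 s.X))
    (hRb : IntegrableOn (fun g => s.R b g * s.p b g) (Ioc 0 s.X)) :
    Tendsto (fun n : ℕ => ∫ v in a..b, s.alT (s.k0 + n) v) atTop (𝓝 0) := by
  have pos : ∀ n : ℕ, 0 < s.k0 + n := fun n => s.hk0.trans_le (k0n n)
  have he := err_tend ha hab.le hb hRa hRb
  have hsub : Ioo a b ⊆ Ioo 0 s.V := Ioo_subset_Ioo ha hb
  set F : ℕ → Set ℝ := fun m => s.Fk a b (s.k0 + m) with hF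
  have hGX := s.hGX
  have hG := s.hG
  have hXX : Icc 0 s.G ⊆ Icc 0 s.X := Icc_subset_Icc_right hGX.le
  have F0 : ∀ m, (0:ℝ) ∈ F m := fun m => ⟨⟨le_rfl, hG.le⟩, fun v _ => (s.pk00 v).trans (k0n m)⟩
  have FG : ∀ m, s.G ∈ F m := fun m => ⟨⟨hG.le, le_rfl⟩, fun v _ => (s.pk0 v _ ⟨le_rfl, hGX.le⟩).trans (k0n m)⟩
  have Fcl : ∀ m, IsClosed (F m) := by
    intro m
    have : F m = Icc 0 s.G ∩ ⋂ v ∈ Ioo a b, {g ∈ Icc 0 s.X | s.p v g ≤ s.k0 + m} := by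
      ext g
      simp only [hF, Fk, mem_inter_iff, mem_iInter, mem_ofPred_eq]
      exact ⟨fun hh => ⟨hh.1, fun v hv => ⟨hXX hh.1, hh.2 v hv⟩⟩, fun hh => ⟨hh.1, fun v hv => (hh.2 v hv).2⟩⟩
    rw [this]
    refine isClosed_Icc.inter (isClosed_biInter fun v hv => ?_)
    exact (s.pcg v (hsub hv)).preimage_isClosed_of_isClosed isClosed_Icc isClosed_Iic
  have FU : Icc 0 s.G ⊆ ⋃ m, F m := by
    intro g hg
    obtain ⟨c, hc⟩ := (isCompact_Icc (a := a) (b := b)).exists_bound_of_continuousOn (s.pcv g).continuousOn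
    obtain ⟨m, hm⟩ := (ev_le (s := s) c).exists
    refine mem_iUnion.2 ⟨m, hg, fun v hv => ?_⟩
    exact ((le_abs_self _).trans (hc v (Ioo_subset_Icc_self hv))).trans hm
  set A := s.An a b with hA
  set τ : ℝ → ℝ := fun x => limUnder atTop (fun n => A n x) with hτ
  have hI := fun m : ℕ => hk_int ha hab.le hb h (k0n m) hRa hRb
  have aI := fun n : ℕ => aa_int ha hab.le hb h (k0n n)
  have T0 : ∀ m, ∀ x ∈ F m, Tendsto (fun n => A n x) atTop (𝓝 (∫ g in Ioc 0 x, s.hk a b (s.k0 + m) g)) := by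
    intro m x hx
    rw [tendsto_iff_norm_sub_tendsto_zero]
    refine squeeze_zero' (Eventually.of_forall fun n => norm_nonneg _) ?_ he
    filter_upwards [eventually_ge_atTop m] with n hn
    have : (m:ℝ) ≤ n := by exact_mod_cast hn
    exact E6 ha hab.le hb h hRa hRb (k0n m) (by linarith) hx.1.1 (F0 m) hx
  have Tτ : ∀ m, ∀ x ∈ F m, τ x = ∫ g in Ioc 0 x, s.hk a b (s.k0 + m) g := fun m x hx => (T0 m x hx).limUnder_eq
  have T1 : ∀ x ∈ Icc 0 s.G, Tendsto (fun n => A n x) atTop (𝓝 (τ x)) := by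
    intro x hx
    obtain ⟨m, hm⟩ := mem_iUnion.1 (FU hx)
    rw [Tτ m x hm]; exact T0 m x hm
  have Asub : ∀ n x y, 0 ≤ x → x ≤ y → y ≤ s.G → A n y - A n x = ∫ g in Ioc x y, s.aa a b (s.k0 + n) g := by
    intro n x y hx hxy hy
    have ii : ∀ z, z ≤ s.G → IntegrableOn (s.aa a b (s.k0 + n)) (Ioc 0 z) := fun z hz =>
      (aI n).mono_set (Ioc_subset_Ioc_right (hz.trans hGX.le))
    simp only [hA, An]
    rw [← Ioc_union_Ioc_eq_Ioc hx hxy, setIntegral_union (Ioc_disjoint_Ioc_of_le le_rfl) measurableSet_Ioc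
      (ii x (hxy.trans hy)) ((ii y hy).mono_set (Ioc_subset_Ioc_left hx))]
    ring
  have Amono : ∀ n x y, 0 ≤ x → x ≤ y → y ≤ s.G → A n x ≤ A n y := by
    intro n x y hx hxy hy
    have := Asub n x y hx hxy hy
    have h2 : 0 ≤ ∫ g in Ioc x y, s.aa a b (s.k0 + n) g := integral_nonneg fun g => aa_nonneg (pos n) g
    linarith
  have τmono : ∀ x y, 0 ≤ x → x ≤ y → y ≤ s.G → τ x ≤ τ y := fun x y hx hxy hy =>
    le_of_tendsto_of_tendsto' (T1 x ⟨hx, hxy.trans hy⟩) (T1 y ⟨hx.trans hxy, hy⟩) (fun n => Amono n x y hx hxy hy)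
  -- h vanishes on F
  have hF0 : ∀ m, ∀ x ∈ F m, s.hk a b (s.k0 + m) x = 0 := by
    intro m x hx
    have cl : ∀ v ∈ Icc a b, s.p v x ≤ s.k0 + m := by
      intro v hv
      rw [← closure_Ioo hab.ne] at hv
      exact (isClosed_le (s.pcv x) continuous_const).closure_subset_iff.2 (fun v hv => hx.2 v hv) hv
    have e1 : s.aa a b (s.k0 + m) x = 0 := by
      unfold aa
      rw [setIntegral_congr_fun measurableSet_Ioo (fun v hv => al_zero (pos m) (hx.2 v hv))]; simp
    have e2 : s.cc a b (s.k0 + m) x = 0 := by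
      unfold cc
      rw [setIntegral_congr_fun (g := fun _ => (0:ℝ)) measurableSet_Ioo (fun v hv => by
        simp only; rw [kap_zero (pos m) (hx.2 v hv), mul_zero])]; simp
    unfold Sys.hk Hj dd di
    rw [e1, e2, th_eq (pos m) (s.pnn _ _) (cl b (right_mem_Icc.2 hab.le)), th_eq (pos m) (s.pnn _ _) (cl a (left_mem_Icc.2 hab.le))]
    ring
  set ht : ℕ → ℝ → ℝ := fun m => (Ioc 0 s.X).indicator (s.hk a b (s.k0 + m)) with hht
  have htI : ∀ m, Integrable (ht m) := fun m => (integrable_indicator_iff measurableSet_Ioc).2 (hI m)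
  have hteq : ∀ (m : ℕ) (x y : ℝ), 0 ≤ x → x ≤ y → y ≤ s.G → ∫ g in Ioc x y, |s.hk a b (s.k0 + m) g| = ∫ g in x..y, |ht m g| := by
    intro m x y hx hxy hy
    rw [intervalIntegral.integral_of_le hxy]
    refine setIntegral_congr_fun measurableSet_Ioc fun g hg => ?_
    have : g ∈ Ioc 0 s.X := ⟨hx.trans_lt hg.1, (hg.2.trans hy).trans hGX.le⟩
    simp only [hht, indicator_of_mem this]
  have null : ∀ m, volume (τ '' F m) = 0 := by
    intro m
    refine image_null (Fcl m).measurableSet ?_ (htI m) ?_ ?_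
    · exact ((measure_mono (fun x hx => hx.1)).trans_lt (measure_Icc_lt_top (a := (0:ℝ)) (b := s.G))).ne
    · intro x hx
      by_cases hm : x ∈ Ioc 0 s.X
      · simp only [hht, indicator_of_mem hm, hF0 m x hx]
      · simp only [hht, indicator_of_notMem hm]
    · intro x hx y hy hxy
      rw [← hteq m x y hx.1.1 hxy hy.1.2, Tτ m x hx, Tτ m y hy]
      have ii : ∀ z, z ≤ s.G → IntegrableOn (s.hk a b (s.k0 + m)) (Ioc 0 z) := fun z hz =>
        (hI m).mono_set (Ioc_subset_Ioc_right (hz.trans hGX.le))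
      rw [← Ioc_union_Ioc_eq_Ioc hx.1.1 hxy, setIntegral_union (Ioc_disjoint_Ioc_of_le le_rfl) measurableSet_Ioc
        (ii x hx.1.2) ((ii y hy.1.2).mono_set (Ioc_subset_Ioc_left hx.1.1)), add_sub_cancel_left]
      exact abs_integral_le_integral_abs
  -- one sided estimates
  have M0 : 0 < s.M := zero_lt_one.trans_le s.M1
  have est : ∀ m, ∀ x1 x2 y1 y2 u w : ℝ, 0 ≤ x1 → x1 ≤ x2 → x2 ≤ s.G →
      ((x1 ∈ F m) ∨ u + w * x1 = 0) → ((x2 ∈ F m) ∨ u + w * x2 = 0) →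
      (∀ g ∈ Icc x1 x2, 0 ≤ u + w * g) → (∀ g ∈ Icc x1 x2, u + w * g ≤ 1) → s.M^2 ≤ |w| →
      x1 ≤ y1 → y1 ≤ y2 → y2 ≤ x2 → (∀ g ∈ Icc y1 y2, 1 / 2 ≤ u + w * g) →
      τ y2 - τ y1 ≤ 4 * ∫ g in x1..x2, |ht m g| := by
    intro m x1 x2 y1 y2 u w h0 hx hG' h1 h2 hu0 hu1 hw hy1 hy hy2 hyy
    rw [← hteq m x1 x2 h0 hx hG']
    have l1 := (T1 y2 ⟨h0.trans (hy1.trans hy), hy2.trans hG'⟩).sub (T1 y1 ⟨h0.trans hy1, (hy.trans hy2).trans hG'⟩)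
    have l2 : Tendsto (fun n : ℕ => 4 * ((∫ g in Ioc x1 x2, |s.hk a b (s.k0 + m) g|) + s.err a b (s.k0 + n))) atTop
      (𝓝 (4 * ((∫ g in Ioc x1 x2, |s.hk a b (s.k0 + m) g|) + 0))) := (he.const_add _).const_mul 4
    rw [add_zero] at l2
    refine le_of_tendsto_of_tendsto l1 l2 ?_
    filter_upwards [eventually_ge_atTop m] with n hn
    have hmn : (m:ℝ) ≤ n := by exact_mod_cast hn
    rw [Asub n y1 y2 (h0.trans hy1) hy (hy2.trans hG')]
    exact U6 ha hab.le hb h hRa hRb (k0n m) (by linarith) h0 hx hG' u w (h1.imp_left (fun q => q.2)) (h2.imp_left (fun q => q.2))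
      hu0 hu1 hw hy1 hy2 hyy
  have τc : ContinuousOn τ (Icc 0 s.G) := by
    intro x hx
    obtain ⟨m, hm⟩ := mem_iUnion.1 (FU hx)
    rw [Metric.continuousWithinAt_iff]
    intro η hη
    have Pc : Continuous fun y => ∫ g in x..y, |ht m g| :=
      intervalIntegral.continuous_primitive (fun _ _ => (htI m).abs.intervalIntegrable) x
    obtain ⟨δ, hδ, hδ'⟩ := Metric.continuous_iff.1 Pc x (η / 4) (by positivity)
    have hbig : ∀ y, |y - x| < δ → |(∫ g in x..y, |ht m g|)| < η / 4 := by
      intro y hy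
      have := hδ' y (by rwa [Real.dist_eq])
      simpa [Real.dist_eq] using this
    have M2 : 0 < 1 / s.M^2 := by positivity
    -- right
    have right : ∃ d > 0, ∀ y ∈ Icc 0 s.G, x ≤ y → y - x < d → τ y - τ x < η := by
      rcases eq_or_lt_of_le hx.2 with hxG | hxG
      · refine ⟨1, one_pos, fun y hy hxy _ => ?_⟩
        have : y = x := le_antisymm (hxG ▸ hy.2) hxy
        rw [this, sub_self]; exact hη
      obtain ⟨ε, hε, hε1, hε2, hε3⟩ : ∃ ε > 0, ε ≤ 1 / s.M^2 ∧ ε < δ ∧ x + ε ≤ s.G := by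
        refine ⟨min (1 / s.M^2) (min (δ / 2) (s.G - x)), lt_min M2 (lt_min (by positivity) (by linarith)), min_le_left _ _, ?_, ?_⟩
        · exact ((min_le_right _ _).trans (min_le_left _ _)).trans_lt (by linarith)
        · linarith [(min_le_right (1 / s.M^2) (min (δ / 2) (s.G - x))).trans (min_le_right _ _)]
      refine ⟨ε / 2, by positivity, fun y hy hxy hd => ?_⟩
      have lin : ∀ g : ℝ, (x + ε) / ε + (-1 / ε) * g = (x + ε - g) / ε := fun g => by field_simp; ring
      have := est m x (x + ε) x y ((x + ε) / ε) (-1 / ε) hx.1 (by linarith) hε3 (Or.inl hm)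
        (Or.inr (by rw [lin]; simp)) (fun g hg => by rw [lin]; exact div_nonneg (by linarith [hg.2]) hε.le)
        (fun g hg => by rw [lin, div_le_one hε]; linarith [hg.1])
        (by rw [abs_div, abs_neg, abs_one, abs_of_pos hε, le_div_iff₀ hε]
            rw [le_div_iff₀ (by positivity)] at hε1; linarith) le_rfl hxy (by linarith)
        (fun g hg => by rw [lin, le_div_iff₀ hε]; linarith [hg.2])
      have h2 := hbig (x + ε) (by rw [add_sub_cancel_left, abs_of_pos hε]; exact hε2)
      linarith [(abs_lt.1 h2).2]
    have left : ∃ d > 0, ∀ y ∈ Icc 0 s.G, y ≤ x → x - y < d → τ x - τ y < η := by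
      rcases eq_or_lt_of_le hx.1 with hxG | hxG
      · refine ⟨1, one_pos, fun y hy hxy _ => ?_⟩
        have : y = x := le_antisymm hxy (hxG ▸ hy.1)
        rw [this, sub_self]; exact hη
      obtain ⟨ε, hε, hε1, hε2, hε3⟩ : ∃ ε > 0, ε ≤ 1 / s.M^2 ∧ ε < δ ∧ 0 ≤ x - ε := by
        refine ⟨min (1 / s.M^2) (min (δ / 2) x), lt_min M2 (lt_min (by positivity) hxG), min_le_left _ _, ?_, ?_⟩
        · exact ((min_le_right _ _).trans (min_le_left _ _)).trans_lt (by linarith)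
        · linarith [(min_le_right (1 / s.M^2) (min (δ / 2) x)).trans (min_le_right _ _)]
      refine ⟨ε / 2, by positivity, fun y hy hxy hd => ?_⟩
      have lin : ∀ g : ℝ, (ε - x) / ε + (1 / ε) * g = (ε - x + g) / ε := fun g => by field_simp
      have := est m (x - ε) x y x ((ε - x) / ε) (1 / ε) hε3 (by linarith) hx.2
        (Or.inr (by rw [lin]; simp)) (Or.inl hm) (fun g hg => by rw [lin]; exact div_nonneg (by linarith [hg.1]) hε.le)
        (fun g hg => by rw [lin, div_le_one hε]; linarith [hg.2])
        (by rw [abs_div, abs_one, abs_of_pos hε, le_div_iff₀ hε]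
            rw [le_div_iff₀ (by positivity)] at hε1; linarith) (by linarith) hxy le_rfl
        (fun g hg => by rw [lin, le_div_iff₀ hε]; linarith [hg.1])
      have h2 := hbig (x - ε) (by rw [show x - ε - x = -ε by ring, abs_neg, abs_of_pos hε]; exact hε2)
      rw [intervalIntegral.integral_symm] at h2
      linarith [(abs_lt.1 h2).1]
    obtain ⟨d1, hd1, r1⟩ := right
    obtain ⟨d2, hd2, r2⟩ := left
    refine ⟨min d1 d2, lt_min hd1 hd2, fun {y} hy hd => ?_⟩
    rw [Real.dist_eq] at hd ⊢
    rcases le_total x y with hxy | hxy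
    · rw [abs_of_nonneg (by linarith)] at hd
      rw [abs_of_nonneg (by linarith [τmono x y hx.1 hxy hy.2])]
      exact r1 y hy hxy (hd.trans_le (min_le_left _ _))
    · rw [abs_of_nonpos (by linarith)] at hd
      rw [abs_of_nonpos (by linarith [τmono y x hy.1 hxy hx.2])]
      linarith [r2 y hy hxy (by linarith [min_le_right d1 d2])]
  have tz := tau_zero hG.le τc F FU null
  have τ0 : τ 0 = 0 := by rw [Tτ 0 0 (F0 0)]; simp
  have τG : τ s.G = 0 := le_antisymm (by linarith) (by linarith [τmono 0 s.G le_rfl hG.le le_rfl])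
  have lim := T1 s.G ⟨hG.le, le_rfl⟩
  rw [τG] at lim
  refine lim.congr fun n => ?_
  have e1 : ∫ v in a..b, s.alT (s.k0 + n) v = ∫ g in Ioc 0 s.X, s.aa a b (s.k0 + n) g := by
    rw [intervalIntegral.integral_of_le hab.le, integral_Ioc_eq_integral_Ioo]
    unfold aa
    rw [← integral_integral_swap (al_int ha hab.le hb h (k0n n))]
    congr 1; ext v; unfold alT; rw [intervalIntegral.integral_of_le s.hX.le]
  rw [e1]
  simp only [hA, An]
  refine (setIntegral_eq_of_subset_of_forall_diff_eq_zero measurableSet_Ioc (Ioc_subset_Ioc_right hGX.le) ?_).symm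
  intro g hg
  have : g ∈ Icc s.G s.X := by
    refine ⟨?_, hg.1.2⟩
    by_contra hc
    exact hg.2 ⟨hg.1.1, (not_le.1 hc).le⟩
  unfold aa
  simp [al_G (k0n n) this]

end Sys
end

section
namespace Sys
variable (s : Sys)

structure W (N w : ℝ) : Prop where
  mem : w ∈ Ioo 0 s.V
  b0 : ∀ g ∈ Icc 0 s.X, s.p w g ≤ N
  b1 : ∀ x ∈ Icc 0 s.X, ∀ y ∈ Icc 0 s.X, |s.p w x - s.p w y| ≤ N * |x - y|
  b2 : ∀ x y h, 0 ≤ x → 0 ≤ y → 0 ≤ h → x + h ≤ s.X → y + h ≤ s.X →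
    |s.p w (x + h) - s.p w x - (s.p w (y + h) - s.p w y)| ≤ N * |x - y| * h
  b3 : ∀ v ∈ Ioo 0 s.V, |s.p v (s.γ w) - s.p w (s.γ w)| ≤ N * |v - w|

variable {s}
lemma W.N0 {N w : ℝ} (h : s.W N w) : 0 < N :=
  (s.ppos w h.mem 0 (left_mem_Icc.2 s.hX.le)).trans_le (h.b0 0 (left_mem_Icc.2 s.hX.le))

lemma W.Fb {N w : ℝ} (h : s.W N w) {g : ℝ} (hg : g ∈ Ioo 0 s.X) : |s.F w g / s.K g| ≤ N := by
  refine (s.pder w h.mem g hg).le_of_lip' h.N0.le ?_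
  filter_upwards [isOpen_Ioo.mem_nhds hg] with x hx
  exact h.b1 x (Ioo_subset_Icc_self hx) g (Ioo_subset_Icc_self hg)

lemma W.Flip {N w : ℝ} (h : s.W N w) {x y : ℝ} (hx : x ∈ Ioo 0 s.X) (hy : y ∈ Ioo 0 s.X) :
    |s.F w x / s.K x - s.F w y / s.K y| ≤ N * |x - y| := by
  have t1 := (s.pder w h.mem x hx).tendsto_slope_zero_right
  have t2 := (s.pder w h.mem y hy).tendsto_slope_zero_right
  refine le_of_tendsto (t1.sub t2).abs ?_
  have m1 : Ioo (0:ℝ) (s.X - x) ∈ 𝓝[>] (0:ℝ) := Ioo_mem_nhdsGT (by linarith [hx.2])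
  have m2 : Ioo (0:ℝ) (s.X - y) ∈ 𝓝[>] (0:ℝ) := Ioo_mem_nhdsGT (by linarith [hy.2])
  filter_upwards [m1, m2] with t ht1 ht2
  have := h.b2 x y t hx.1.le hy.1.le ht1.1.le (by linarith [ht1.2]) (by linarith [ht2.2])
  simp only [smul_eq_mul]
  rw [← mul_sub, abs_mul, abs_of_pos (inv_pos.2 ht1.1), inv_mul_le_iff₀ ht1.1]
  linarith

lemma W.Sb' {N w : ℝ} (h : s.W N w) {g : ℝ} (hg : g ∈ Ioo 0 s.X) : |s.S w g| ≤ 2 * s.M * N := by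
  have hK := (s.Kpos g)
  have hd := (s.Fder w h.mem g hg).div (s.Kder g) hK.ne'
  have h1 := hd.le_of_lip' h.N0.le (by
    filter_upwards [isOpen_Ioo.mem_nhds hg] with x hx
    exact h.Flip hx hg)
  rw [Real.norm_eq_abs] at h1
  have h2 := h.Fb hg
  have hg' := Ioo_subset_Icc_self hg
  have e : s.S w g = s.K g * ((s.S w g * s.K g - s.F w g * s.K1 g) / s.K g ^ 2) + s.K1 g * (s.F w g / s.K g) := by
    field_simp; ring
  have a1 : |s.K g * ((s.S w g * s.K g - s.F w g * s.K1 g) / s.K g ^ 2)| ≤ s.M * N := by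
    rw [abs_mul, abs_of_pos hK]
    exact mul_le_mul (s.KM hg') h1 (abs_nonneg _) s.M0
  have a2 : |s.K1 g * (s.F w g / s.K g)| ≤ s.M * N := by
    rw [abs_mul]
    exact mul_le_mul (s.K1M hg') h2 (abs_nonneg _) s.M0
  rw [e]
  exact (abs_add_le _ _).trans (by linarith)

lemma W.Sb {N w : ℝ} (h : s.W N w) {g : ℝ} (hg : g ∈ Icc 0 s.X) : |s.S w g| ≤ 2 * s.M * N := by
  rw [← closure_Ioo s.hX.ne] at hg
  have hc := (s.Sc w h.mem).abs
  rw [← closure_Ioo s.hX.ne] at hc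
  exact le_on_closure (fun x hx => h.Sb' hx) hc continuousOn_const hg

/-- indicator of an interval as a real function -/
def ind (x1 x2 g : ℝ) : ℝ := (Ioc x1 x2).indicator (fun _ => (1:ℝ)) g
lemma ind_m (x1 x2 : ℝ) : Measurable (ind x1 x2) := measurable_const.indicator measurableSet_Ioc
lemma ind_in {x1 x2 g : ℝ} (h : g ∈ Ioc x1 x2) : ind x1 x2 g = 1 := indicator_of_mem h _
lemma ind_out {x1 x2 g : ℝ} (h : g ∉ Ioc x1 x2) : ind x1 x2 g = 0 := indicator_of_notMem h _
lemma ind_or (x1 x2 g : ℝ) : ind x1 x2 g = 0 ∨ ind x1 x2 g = 1 := by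
  by_cases h : g ∈ Ioc x1 x2
  · exact Or.inr (ind_in h)
  · exact Or.inl (ind_out h)
lemma ind_abs (x1 x2 g : ℝ) : |ind x1 x2 g| ≤ 1 := by
  rcases ind_or x1 x2 g with h | h <;> simp [h]

lemma TFpiece {N w j ς x1 x2 : ℝ} (h : s.W N w) (hj : 0 < j) (hς : |ς| = 1) {B b b1 : ℝ → ℝ}
    (hB : ∀ y, HasDerivAt B (b y) y) (hb : ∀ y, HasDerivAt b (b1 y) y)
    (b0 : ∀ y, 0 ≤ b y) (bl : ∀ y, b y ≤ 1) (B0 : ∀ y, 0 ≤ B y) (Bl : ∀ y, B y ≤ |y|) :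
    s.TF (2 * j + N + 1) (fun g y => ind x1 x2 g * (s.ψ g * B (ς * (th j y - s.p w g))))
      (fun g y => ind x1 x2 g * (s.ψ g * (b (ς * (th j y - s.p w g)) * (ς * bt j y)))) := by
  have hN := h.N0
  have Bc : Continuous B := continuous_iff_continuousAt.2 fun y => (hB y).continuousAt
  have bc : Continuous b := continuous_iff_continuousAt.2 fun y => (hb y).continuousAt
  have m1 : Measurable fun x : ℝ × ℝ => ind x1 x2 x.1 := (ind_m x1 x2).comp measurable_fst
  have m2 : Measurable fun x : ℝ × ℝ => s.ψ x.1 := s.ψc.measurable.comp measurable_fst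
  have m3 : Measurable fun x : ℝ × ℝ => ς * (th j x.2 - s.p w x.1) :=
    (((th_cont j).measurable.comp measurable_snd).sub ((pmg w).comp measurable_fst)).const_mul ς
  have m4 : Measurable fun x : ℝ × ℝ => ς * bt j x.2 :=
    ((bt_cont j).measurable.comp measurable_snd).const_mul ς
  refine ⟨by linarith, m1.mul (m2.mul (Bc.measurable.comp m3)),
    m1.mul (m2.mul ((bc.measurable.comp m3).mul m4)), ?_, ?_, ?_, ?_⟩
  · intro g hg y hy
    have hz : |ς * (th j y - s.p w g)| ≤ 2 * j + N := by
      rw [abs_mul, hς, one_mul, abs_le]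
      constructor <;> linarith [th_nonneg (j := j) hy, th_le_two hj hy, s.pnn w g, h.b0 g hg]
    have h1 := Bl (ς * (th j y - s.p w g))
    have h2 := B0 (ς * (th j y - s.p w g))
    rw [abs_mul, abs_mul, abs_of_nonneg (s.ψnn g), abs_of_nonneg h2]
    calc _ ≤ 1 * (s.ψ g * (2 * j + N + 1)) := by
          refine mul_le_mul (ind_abs _ _ _) (mul_le_mul_of_nonneg_left (by linarith) (s.ψnn g))
            (mul_nonneg (s.ψnn g) h2) zero_le_one
      _ = _ := by ring
  · intro g hg y hy
    have h2 := b0 (ς * (th j y - s.p w g))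
    have h3 : b (ς * (th j y - s.p w g)) * (bt j y) ≤ 1 := 
      mul_le_one₀ (bl _) (bt_nonneg _ _) (bt_le_one _ _)
    rw [abs_mul, abs_mul, abs_of_nonneg (s.ψnn g), abs_mul, abs_mul, abs_of_nonneg h2, hς, one_mul,
      abs_of_nonneg (bt_nonneg j y)]
    calc _ ≤ 1 * (s.ψ g * (2 * j + N + 1)) := by
          refine mul_le_mul (ind_abs _ _ _) (mul_le_mul_of_nonneg_left (by linarith) (s.ψnn g))
            (mul_nonneg (s.ψnn g) (mul_nonneg h2 (bt_nonneg _ _))) zero_le_one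
      _ = _ := by ring
  · intro g hg
    have hth := th_cont j
    exact Continuous.continuousOn (by fun_prop)
  · intro g hg y hy
    have d1 : HasDerivAt (fun y => ς * (th j y - s.p w g)) (ς * bt j y) y :=
      ((th_deriv j y).sub_const _).const_mul ς
    exact (((hB _).comp y d1).const_mul _).const_mul _

lemma E_piece {N w v j ς x1 x2 c ε : ℝ} (h : s.W N w) (hv : v ∈ Ioo 0 s.V) (hj : s.k0 ≤ j) (hjN : N ≤ j)
    (hς : ς = 1 ∨ ς = -1) (hc : 0 ≤ c) (hε : 0 ≤ ε) {B b b1 : ℝ → ℝ}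
    (hB : ∀ y, HasDerivAt B (b y) y) (hb : ∀ y, HasDerivAt b (b1 y) y) (hb1c : Continuous b1)
    (b0 : ∀ y, 0 ≤ b y) (bl : ∀ y, b y ≤ 1) (b10 : ∀ y, 0 ≤ b1 y)
    (bz : ∀ y, y ≤ c → b y = 0) (Bz : ∀ y, y ≤ c → B y = 0)
    (B0 : ∀ y, 0 ≤ B y) (Blow : ∀ y, y - c - ε ≤ B y) (Bl : ∀ y, B y ≤ |y|)
    (h0 : 0 ≤ x1) (hx : x1 ≤ x2) (hX : x2 ≤ s.X)
    (e1 : x1 = 0 ∨ |s.p v x1 - s.p w x1| ≤ c) (e2 : x2 = s.X ∨ |s.p v x2 - s.p w x2| ≤ c) :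
    s.E (fun g y => ind x1 x2 g * (s.ψ g * B (ς * (th j y - s.p w g))))
      (fun g y => ind x1 x2 g * (s.ψ g * (b (ς * (th j y - s.p w g)) * (ς * bt j y)))) v ≤
    s.X * (s.M * (s.k0 + N) + 2 * s.M * N + s.M * (N + c + ε)) + s.alT j v := by
  have hN := h.N0
  have hj0 : 0 < j := s.hk0.trans_le hj
  have hw := h.mem
  have hςa : |ς| = 1 := by rcases hς with h | h <;> simp [h]
  have i1 : Ioo x1 x2 ⊆ Ioo 0 s.X := Ioo_subset_Ioo h0 hX
  have i2 : Icc x1 x2 ⊆ Icc 0 s.X := Icc_subset_Icc h0 hX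
  set z : ℝ → ℝ := fun g => ς * (th j (s.p v g) - s.p w g) with hz
  set Fz : ℝ → ℝ := fun g => ς * (bt j (s.p v g) * s.F v g - s.F w g) with hFz
  set Sz : ℝ → ℝ := fun g => ς * (bt j (s.p v g) * s.S v g - s.al j v g - s.S w g) with hSz
  have Bc : Continuous B := continuous_iff_continuousAt.2 fun y => (hB y).continuousAt
  have bc : Continuous b := continuous_iff_continuousAt.2 fun y => (hb y).continuousAt
  have pv := s.pcg v hv
  have pw := s.pcg w hw
  have zc : ContinuousOn z (Icc 0 s.X) :=
    continuousOn_const.mul (((th_cont j).comp_continuousOn pv).sub pw)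
  have btc : ContinuousOn (fun g => bt j (s.p v g)) (Icc 0 s.X) := (bt_cont j).comp_continuousOn pv
  have Fzc : ContinuousOn Fz (Icc 0 s.X) := continuousOn_const.mul ((btc.mul (s.Fc v hv)).sub (s.Fc w hw))
  have Szc : ContinuousOn Sz (Icc 0 s.X) :=
    continuousOn_const.mul (((btc.mul (s.Sc v hv)).sub (al_cont hv)).sub (s.Sc w hw))
  have key := ibp1 hx (K := s.K) (φ := s.ψ) (φ1 := s.ψ1) (φ2 := s.ψ2) (z := z) (Fz := Fz) (Sz := Sz)
    (B := B) (b := b) (b1 := b1) (fun g _ => (s.Kpos g).ne') s.Kc.continuousOn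
    (fun g _ => s.ψder g) s.ψc.continuousOn (fun g _ => s.ψ1der g) s.ψ1c.continuousOn s.ψ2c.continuousOn
    (by
      intro g hg
      have hg := i1 hg
      have d := (((th_deriv j _).comp g (s.pder v hv g hg)).sub (s.pder w hw g hg)).const_mul ς
      refine d.congr_deriv ?_
      simp only [hFz]; ring)
    (zc.mono i2)
    (by
      intro g hg
      have hg := i1 hg
      have d := ((((bt_deriv j _).comp g (s.pder v hv g hg)).mul (s.Fder v hv g hg)).sub
        (s.Fder w hw g hg)).const_mul ς
      refine d.congr_deriv ?_
      simp only [hSz, al, Function.comp]; ring)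
    (Fzc.mono i2) (Szc.mono i2) hB hb hb1c
  have zle : ∀ g ∈ Icc 0 s.X, |s.p v g - s.p w g| ≤ c → z g ≤ c := by
    intro g hg hh
    have t : th j (s.p w g) = s.p w g := th_eq hj0 (s.pnn _ _) ((h.b0 g hg).trans hjN)
    have t2 := th_abs j (s.p v g) (s.p w g)
    rw [t] at t2
    refine (le_abs_self _).trans ?_
    simp only [hz]
    rw [abs_mul, hςa, one_mul]; linarith
  have bd2 : s.ψ x2 * b (z x2) * Fz x2 - s.K x2 * s.ψ1 x2 * B (z x2) = 0 := by
    rcases e2 with e | e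
    · rw [e, s.ψX, s.ψ1X]; ring
    · have := zle x2 ⟨h0.trans hx, hX⟩ e
      rw [bz _ this, Bz _ this]; ring
  have bd1 : s.ψ x1 * b (z x1) * Fz x1 - s.K x1 * s.ψ1 x1 * B (z x1) = 0 := by
    rcases e1 with e | e
    · have : Fz x1 = 0 := by simp only [hFz]; rw [e, s.F0 v hv, s.F0 w hw]; ring
      rw [this, e, s.ψ1low 0 s.hG.le]; ring
    · have := zle x1 ⟨h0, hx.trans hX⟩ e
      rw [bz _ this, Bz _ this]; ring
  have nn : 0 ≤ ∫ g in x1..x2, s.ψ g * b1 (z g) * (Fz g ^ 2 / s.K g) :=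
    intervalIntegral.integral_nonneg hx fun g _ =>
      mul_nonneg (mul_nonneg (s.ψnn g) (b10 _)) (div_nonneg (sq_nonneg _) (s.Kpos g).le)
  -- expression for E
  have hE : s.E (fun g y => ind x1 x2 g * (s.ψ g * B (ς * (th j y - s.p w g))))
      (fun g y => ind x1 x2 g * (s.ψ g * (b (ς * (th j y - s.p w g)) * (ς * bt j y)))) v =
      ∫ g in x1..x2, (s.ψ g * b (z g) * Sz g + (s.ψ g * b (z g) * (ς * (s.al j v g + s.S w g)) +
        s.r g * s.ψ g * (ς * b (z g) * bt j (s.p v g) * s.p v g - B (z g)))) := by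
    rw [intervalIntegral.integral_of_le hx, ← int_ind h0 hx hX]
    unfold E
    refine intervalIntegral.integral_congr fun g _ => ?_
    unfold Hh
    by_cases hg : g ∈ Ioc x1 x2
    · rw [indicator_of_mem hg]
      simp only [ind_in hg, hz, hSz]; ring
    · rw [indicator_of_notMem hg]
      simp only [ind_out hg]; ring
  have c1 : ContinuousOn (fun g => s.ψ g * b (z g)) (Icc 0 s.X) :=
    s.ψc.continuousOn.mul (bc.comp_continuousOn zc)
  have cA : ContinuousOn (fun g => s.ψ g * b (z g) * Sz g) (Icc 0 s.X) := c1.mul Szc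
  have cB : ContinuousOn (fun g => s.ψ g * b (z g) * (ς * (s.al j v g + s.S w g)) +
        s.r g * s.ψ g * (ς * b (z g) * bt j (s.p v g) * s.p v g - B (z g))) (Icc 0 s.X) :=
    (c1.mul (continuousOn_const.mul ((al_cont hv).add (s.Sc w hw)))).add
      ((s.rc.continuousOn.mul s.ψc.continuousOn).mul
        ((((continuousOn_const.mul (bc.comp_continuousOn zc)).mul btc).mul pv).sub (Bc.comp_continuousOn zc)))
  have cD : ContinuousOn (fun g => s.ψ2 g * B (z g)) (Icc 0 s.X) :=
    s.ψ2c.continuousOn.mul (Bc.comp_continuousOn zc)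
  rw [hE, intervalIntegral.integral_add (ii_of_cont cA hx h0 hX) (ii_of_cont cB hx h0 hX), key, bd1, bd2]
  have fin : (∫ g in x1..x2, s.ψ2 g * B (z g)) + ∫ g in x1..x2, (s.ψ g * b (z g) * (ς * (s.al j v g + s.S w g)) +
        s.r g * s.ψ g * (ς * b (z g) * bt j (s.p v g) * s.p v g - B (z g))) ≤
      ∫ g in x1..x2, ((s.M * (s.k0 + N) + 2 * s.M * N + s.M * (N + c + ε)) + s.al j v g) := by
    rw [← intervalIntegral.integral_add (ii_of_cont cD hx h0 hX) (ii_of_cont cB hx h0 hX)]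
    refine intervalIntegral.integral_mono_on hx ((ii_of_cont cD hx h0 hX).add (ii_of_cont cB hx h0 hX))
      (ii_of_cont (continuousOn_const.add (al_cont hv)) hx h0 hX) ?_
    intro g hg
    have hg := i2 hg
    have pn := s.pnn v g
    have pn' := s.pnn w g
    have pN := h.b0 g hg
    have hM := s.M1
    have q1 : s.ψ2 g * B (z g) ≤ s.M * (s.k0 + N) := by
      rcases le_total g s.G with hG | hG
      · rw [s.ψ2low g hG, zero_mul]; have := s.hk0; positivity
      · have p1 := s.pk0 v g ⟨hG, hg.2⟩
        have t1 := th_le (j := j) pn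
        have t2 := th_nonneg (j := j) pn
        have : B (z g) ≤ s.k0 + N := by
          refine (Bl _).trans ?_
          simp only [hz]
          rw [abs_mul, hςa, one_mul, abs_le]
          constructor <;> linarith [s.hk0]
        calc _ ≤ |s.ψ2 g| * B (z g) := mul_le_mul_of_nonneg_right (le_abs_self _) (B0 _)
          _ ≤ _ := mul_le_mul (s.ψ2M hg) this (B0 _) s.M0
    have psb0 : 0 ≤ s.ψ g * b (z g) := mul_nonneg (s.ψnn g) (b0 _)
    have psb1 : s.ψ g * b (z g) ≤ 1 := mul_le_one₀ (s.ψle g) (b0 _) (bl _)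
    have q2 : s.ψ g * b (z g) * (ς * (s.al j v g + s.S w g)) ≤ s.al j v g + 2 * s.M * N := by
      have a0 := al_nonneg (s := s) hj0 v g
      have h1 : ς * (s.al j v g + s.S w g) ≤ s.al j v g + 2 * s.M * N := by
        have := abs_le.1 (h.Sb hg)
        rcases hς with h | h <;> rw [h] <;> linarith
      calc _ ≤ s.ψ g * b (z g) * (s.al j v g + 2 * s.M * N) := mul_le_mul_of_nonneg_left h1 psb0
        _ ≤ 1 * _ := mul_le_mul_of_nonneg_right psb1 (by positivity)
        _ = _ := one_mul _
    have q3 : s.r g * s.ψ g * (ς * b (z g) * bt j (s.p v g) * s.p v g - B (z g)) ≤ s.M * (N + c + ε) := by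
      have u : ς * b (z g) * bt j (s.p v g) * s.p v g - B (z g) ≤ N + c + ε := by
        have t0 := bt_mul_le hj0 pn
        have t1 := b0 (z g)
        have t2 := bl (z g)
        have t3 := mul_nonneg (bt_nonneg j (s.p v g)) pn
        rcases hς with h | h
        · have hzz : th j (s.p v g) = z g + s.p w g := by simp only [hz, h]; ring
          have t4 : b (z g) * (bt j (s.p v g) * s.p v g) ≤ b (z g) * z g + N := by
            calc _ ≤ b (z g) * (z g + s.p w g) := mul_le_mul_of_nonneg_left (by linarith) t1
              _ = b (z g) * z g + b (z g) * s.p w g := by ring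
              _ ≤ _ := by nlinarith
          have t5 : b (z g) * z g ≤ max (z g) 0 := by
            rcases le_total (z g) 0 with hh | hh
            · exact (mul_nonpos_of_nonneg_of_nonpos t1 hh).trans (le_max_right _ _)
            · refine le_trans ?_ (le_max_left _ _); nlinarith
          have t6 : max (z g) 0 ≤ B (z g) + c + ε := max_le (by linarith [Blow (z g)]) (by linarith [B0 (z g)])
          rw [h]; nlinarith
        · have : b (z g) * (bt j (s.p v g) * s.p v g) ≥ 0 := mul_nonneg t1 t3
          rw [h]; linarith [B0 (z g)]
      have rψ0 : 0 ≤ s.r g * s.ψ g := mul_nonneg (s.rnn g hg) (s.ψnn g)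
      have rψ1 : s.r g * s.ψ g ≤ s.M := by
        have := mul_le_mul (s.rM hg) (s.ψle g) (s.ψnn g) s.M0
        linarith
      calc _ ≤ s.r g * s.ψ g * (N + c + ε) := mul_le_mul_of_nonneg_left u rψ0
        _ ≤ _ := mul_le_mul_of_nonneg_right rψ1 (by positivity)
    linarith
  have fin2 : ∫ g in x1..x2, ((s.M * (s.k0 + N) + 2 * s.M * N + s.M * (N + c + ε)) + s.al j v g) ≤
      s.X * (s.M * (s.k0 + N) + 2 * s.M * N + s.M * (N + c + ε)) + s.alT j v := by
    rw [intervalIntegral.integral_add (by simp) (ii_of_cont (al_cont hv) hx h0 hX), intervalIntegral.integral_const]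
    have t1 : ∫ g in x1..x2, s.al j v g ≤ s.alT j v :=
      intervalIntegral.integral_mono_interval h0 hx hX (Eventually.of_forall fun g => al_nonneg hj0 v g)
        (ii_of_cont (al_cont hv) s.hX.le le_rfl le_rfl)
    have t2 : 0 ≤ s.M * (s.k0 + N) + 2 * s.M * N + s.M * (N + c + ε) := by
      have := s.M0; have := s.hk0; positivity
    have t3 := mul_le_mul_of_nonneg_right (show x2 - x1 ≤ s.X by linarith) t2
    rw [smul_eq_mul]; linarith
  linarith
end Sys
end

section
namespace Sys
variable {s : Sys}

lemma W.bdRp {N w : ℝ} (h : s.W N w) : IntegrableOn (fun g => s.R w g * s.p w g) (Ioc 0 s.X) := by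
  refine Measure.integrableOn_of_bounded (M := s.M * N) (by simp)
    ((Rcontg w).measurable.mul (pmg w)).aestronglyMeasurable ?_
  refine (ae_restrict_iff' measurableSet_Ioc).2 (Eventually.of_forall fun g hg => ?_)
  have hg := Ioc_subset_Icc_self hg
  rw [Real.norm_eq_abs, abs_mul, abs_of_nonneg (s.pnn w g)]
  exact mul_le_mul (s.RM hg (Ioo_subset_Icc_self h.mem)) (h.b0 g hg) (s.pnn _ _) s.M0

variable (s)
def K0 (N : ℝ) : ℝ := s.X * (s.M * (s.k0 + N) + 2 * s.M * N + s.M * (N + N * s.V + s.V))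
variable {s}

lemma piece_int {N w l u j ς x1 x2 c ε : ℝ} (h : s.W N w) (hl : 0 ≤ l) (hlu : l ≤ u) (hu : u ≤ s.V)
    (hbase : s.base l u) (hj : s.k0 ≤ j) (hjN : N ≤ j)
    (hς : ς = 1 ∨ ς = -1) (hc : 0 ≤ c) (hε : 0 ≤ ε) (hcV : c ≤ N * s.V) (hεV : ε ≤ s.V) {B b b1 : ℝ → ℝ}
    (hB : ∀ y, HasDerivAt B (b y) y) (hb : ∀ y, HasDerivAt b (b1 y) y) (hb1c : Continuous b1)
    (b0 : ∀ y, 0 ≤ b y) (bl : ∀ y, b y ≤ 1) (b10 : ∀ y, 0 ≤ b1 y)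
    (bz : ∀ y, y ≤ c → b y = 0) (Bz : ∀ y, y ≤ c → B y = 0)
    (B0 : ∀ y, 0 ≤ B y) (Blow : ∀ y, y - c - ε ≤ B y) (Bl : ∀ y, B y ≤ |y|)
    (h0 : 0 ≤ x1) (hx : x1 ≤ x2) (hX : x2 ≤ s.X)
    (e1 : ∀ v ∈ Ioo l u, x1 = 0 ∨ |s.p v x1 - s.p w x1| ≤ c)
    (e2 : ∀ v ∈ Ioo l u, x2 = s.X ∨ |s.p v x2 - s.p w x2| ≤ c) :
    s.Φ (fun g y => ind x1 x2 g * (s.ψ g * B (ς * (th j y - s.p w g)))) u -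
      s.Φ (fun g y => ind x1 x2 g * (s.ψ g * B (ς * (th j y - s.p w g)))) l ≤
      s.K0 N * (u - l) + ∫ v in l..u, s.alT j v := by
  have hςa : |ς| = 1 := by rcases hς with h | h <;> simp [h]
  have hT := TFpiece (x1 := x1) (x2 := x2) h (s.hk0.trans_le hj) hςa hB hb b0 bl B0 Bl
  have ia := alT_int hl hlu hu hbase hj
  have ie : IntervalIntegrable (fun v => s.K0 N + s.alT j v) volume l u :=
    intervalIntegrable_const.add ia
  have hEe : ∀ v ∈ Ioo l u, s.E (fun g y => ind x1 x2 g * (s.ψ g * B (ς * (th j y - s.p w g))))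
      (fun g y => ind x1 x2 g * (s.ψ g * (b (ς * (th j y - s.p w g)) * (ς * bt j y)))) v ≤
      s.K0 N + s.alT j v := by
    intro v hv
    have := E_piece h ⟨hl.trans_lt hv.1, hv.2.trans_le hu⟩ hj hjN hς hc hε hB hb hb1c b0 bl b10 bz Bz B0
      Blow Bl h0 hx hX (e1 v hv) (e2 v hv)
    refine this.trans ?_
    unfold K0
    have := s.M0; have := s.hX
    gcongr
  obtain ⟨i, e⟩ := hbase.upper hT _ ie hEe
  rw [e]
  have e3 : ∫ v in l..u, (s.K0 N + s.alT j v) = s.K0 N * (u - l) + ∫ v in l..u, s.alT j v := by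
    rw [intervalIntegral.integral_add intervalIntegrable_const ia, intervalIntegral.integral_const, smul_eq_mul,
      mul_comm]
  rw [← e3]
  exact intervalIntegral.integral_mono_on_of_le_Ioo hlu i ie hEe

lemma bdi {f : ℝ → ℝ} (hf : Measurable f) {c : ℝ} (h : ∀ g ∈ Ioc 0 s.X, |f g| ≤ c) :
    IntervalIntegrable f volume 0 s.X := by
  rw [intervalIntegrable_iff_integrableOn_Ioc_of_le s.hX.le]
  exact Measure.integrableOn_of_bounded (M := c) (by simp) hf.aestronglyMeasurable
    ((ae_restrict_iff' measurableSet_Ioc).2 (Eventually.of_forall h))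

set_option maxHeartbeats 1000000 in
theorem L7 {N l u : ℝ} (hl : s.W N l) (hu : s.W N u) (hlu : l < u) (hbase : s.base l u) :
    ∫ g in (0:ℝ)..s.X, s.ψ g * |s.R l g| * |s.p u g - s.p l g| ≤
      (4 * s.K0 N + s.X * (s.M * (9 * N + 1))) * (u - l) := by
  have hN := hl.N0
  have l0 := hl.mem.1
  have uV := hu.mem.2
  have D0 : 0 < u - l := by linarith
  have DV : u - l ≤ s.V := by linarith
  have lI : l ∈ Icc 0 s.V := ⟨l0.le, by linarith⟩
  have uI : u ∈ Icc 0 s.V := ⟨by linarith, uV.le⟩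
  have lim := L6 l0.le hlu uV.le hbase hl.bdRp hu.bdRp
  obtain ⟨B, b, b1, hB, hb, hb1c, b0, bl, b10, bz, Bz, B0, Blow, Bl⟩ :=
    exists_cvx (N * (u - l)) (u - l) (by positivity) D0
  have Bc : Continuous B := continuous_iff_continuousAt.2 fun y => (hB y).continuousAt
  have g1 := s.γmem l hl.mem
  have g2 := s.γmem u hu.mem
  have gX := s.hGX
  have c1 : N * (u - l) ≤ N * s.V := by gcongr
  have c0 : 0 ≤ N * (u - l) := by positivity
  have thp : ∀ w, s.W N w → ∀ j, N ≤ j → ∀ g ∈ Icc 0 s.X, th j (s.p w g) = s.p w g := fun w hw j hj g hg =>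
    th_eq (hN.trans_le hj) (s.pnn _ _) ((hw.b0 g hg).trans hj)
  set f1 : ℝ → ℝ → ℝ := fun ς g => s.R u g * (ind (s.γ l) s.X g * (s.ψ g * B (ς * (s.p u g - s.p l g)))) with hf1
  set f2 : ℝ → ℝ → ℝ := fun ς g => s.R l g * (ind 0 (s.γ u) g * (s.ψ g * B (ς * (s.p l g - s.p u g)))) with hf2
  have P1 : ∀ ς, ς = 1 ∨ ς = -1 → ∫ g in (0:ℝ)..s.X, f1 ς g ≤ s.K0 N * (u - l) := by
    intro ς hς
    have lim' := lim.const_add (s.K0 N * (u - l))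
    rw [add_zero] at lim'
    refine ge_of_tendsto lim' ?_
    filter_upwards [ev_le (s := s) N] with n hn
    have := piece_int (x1 := s.γ l) (x2 := s.X) hl l0.le hlu.le uV.le hbase (k0n n) hn hς c0 D0.le c1 DV hB hb hb1c b0 bl b10 bz Bz B0 Blow Bl
      g1.1.le (by linarith [g1.2]) le_rfl
      (fun v hv => Or.inr ((hl.b3 v ⟨l0.trans hv.1, hv.2.trans uV⟩).trans (by
        rw [abs_of_pos (by linarith [hv.1])]; gcongr; exact hv.2.le))) (fun v hv => Or.inl rfl)
    refine le_trans (le_of_eq ?_) this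
    have z : s.Φ (fun g y => ind (s.γ l) s.X g * (s.ψ g * B (ς * (th (s.k0 + n) y - s.p l g)))) l = 0 := by
      unfold Φ
      rw [intervalIntegral.integral_congr (g := fun _ => (0:ℝ))]
      · simp
      · intro g hg
        rw [uIcc_of_le s.hX.le] at hg
        simp only
        rw [thp l hl _ hn g hg, sub_self, mul_zero, Bz 0 c0]; ring
    rw [z, sub_zero]
    unfold Φ
    refine intervalIntegral.integral_congr fun g hg => ?_
    rw [uIcc_of_le s.hX.le] at hg
    simp only [hf1]
    rw [thp u hu _ hn g hg]
  have P2 : ∀ ς, ς = 1 ∨ ς = -1 → - ∫ g in (0:ℝ)..s.X, f2 ς g ≤ s.K0 N * (u - l) := by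
    intro ς hς
    have lim' := lim.const_add (s.K0 N * (u - l))
    rw [add_zero] at lim'
    refine ge_of_tendsto lim' ?_
    filter_upwards [ev_le (s := s) N] with n hn
    have := piece_int (x1 := 0) (x2 := s.γ u) hu l0.le hlu.le uV.le hbase (k0n n) hn hς c0 D0.le c1 DV hB hb hb1c b0 bl b10 bz Bz B0 Blow Bl
      le_rfl g2.1.le (by linarith [g2.2]) (fun v hv => Or.inl rfl)
      (fun v hv => Or.inr ((hu.b3 v ⟨l0.trans hv.1, hv.2.trans uV⟩).trans (by
        rw [abs_sub_comm, abs_of_pos (by linarith [hv.2])]; gcongr; exact hv.1.le)))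
    refine le_trans (le_of_eq ?_) this
    have z : s.Φ (fun g y => ind 0 (s.γ u) g * (s.ψ g * B (ς * (th (s.k0 + n) y - s.p u g)))) u = 0 := by
      unfold Φ
      rw [intervalIntegral.integral_congr (g := fun _ => (0:ℝ))]
      · simp
      · intro g hg
        rw [uIcc_of_le s.hX.le] at hg
        simp only
        rw [thp u hu _ hn g hg, sub_self, mul_zero, Bz 0 c0]; ring
    rw [z, zero_sub]
    unfold Φ
    congr 1
    refine intervalIntegral.integral_congr fun g hg => ?_
    rw [uIcc_of_le s.hX.le] at hg
    simp only [hf2]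
    rw [thp l hl _ hn g hg]
  -- measurability, boundedness
  have ml := pmg (s := s) l
  have mu := pmg (s := s) u
  have mψ := s.ψc.measurable
  have mB := Bc.measurable
  have pd : ∀ g ∈ Icc 0 s.X, |s.p u g - s.p l g| ≤ N := by
    intro g hg
    rw [abs_le]
    constructor <;> linarith [s.pnn u g, s.pnn l g, hl.b0 g hg, hu.b0 g hg]
  have Bd : ∀ ς, ς = 1 ∨ ς = -1 → ∀ g, B (ς * (s.p u g - s.p l g)) ≤ |s.p u g - s.p l g| := by
    intro ς hς g
    refine (Bl _).trans (le_of_eq ?_)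
    rcases hς with h | h <;> simp [h, abs_sub_comm]
  have Bd' : ∀ ς, ς = 1 ∨ ς = -1 → ∀ g, B (ς * (s.p l g - s.p u g)) ≤ |s.p u g - s.p l g| := by
    intro ς hς g
    refine (Bl _).trans (le_of_eq ?_)
    rcases hς with h | h <;> simp [h, abs_sub_comm]
  have aux : ∀ R i y : ℝ, ∀ g ∈ Icc 0 s.X, |R| ≤ s.M → |i| ≤ 1 → 0 ≤ y → y ≤ N → |R * (i * (s.ψ g * y))| ≤ s.M * N := by
    intro R i y g hg hR hi hy hyN
    rw [abs_mul, abs_mul, abs_of_nonneg (mul_nonneg (s.ψnn g) hy)]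
    have h1 : s.ψ g * y ≤ 1 * N := mul_le_mul (s.ψle g) hyN hy zero_le_one
    have h2 : |i| * (s.ψ g * y) ≤ 1 * (1 * N) := mul_le_mul hi h1 (mul_nonneg (s.ψnn g) hy) zero_le_one
    rw [one_mul, one_mul] at h2
    exact mul_le_mul hR h2 (mul_nonneg (abs_nonneg _) (mul_nonneg (s.ψnn g) hy)) s.M0
  have I1 : ∀ ς, ς = 1 ∨ ς = -1 → IntervalIntegrable (f1 ς) volume 0 s.X := by
    intro ς hς
    refine bdi (c := s.M * N) ((Rcontg u).measurable.mul ((ind_m _ _).mul (mψ.mul (mB.comp ((mu.sub ml).const_mul ς))))) ?_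
    intro g hg
    have hg := Ioc_subset_Icc_self hg
    exact aux _ _ _ g hg (s.RM hg uI) (ind_abs _ _ _) (B0 _) ((Bd ς hς g).trans (pd g hg))
  have I2 : ∀ ς, ς = 1 ∨ ς = -1 → IntervalIntegrable (f2 ς) volume 0 s.X := by
    intro ς hς
    refine bdi (c := s.M * N) ((Rcontg l).measurable.mul ((ind_m _ _).mul (mψ.mul (mB.comp ((ml.sub mu).const_mul ς))))) ?_
    intro g hg
    have hg := Ioc_subset_Icc_self hg
    exact aux _ _ _ g hg (s.RM hg lI) (ind_abs _ _ _) (B0 _) ((Bd' ς hς g).trans (pd g hg))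
  have o1 : (1:ℝ) = 1 ∨ (1:ℝ) = -1 := Or.inl rfl
  have o2 : (-1:ℝ) = 1 ∨ (-1:ℝ) = -1 := Or.inr rfl
  set κ : ℝ := s.M * (9 * N + 1) * (u - l) with hκ
  have I3 : IntervalIntegrable (fun g => (f1 1 g + f1 (-1) g) - (f2 1 g + f2 (-1) g) + κ) volume 0 s.X :=
    (((I1 1 o1).add (I1 _ o2)).sub ((I2 1 o1).add (I2 _ o2))).add intervalIntegrable_const
  have I4 : IntervalIntegrable (fun g => s.ψ g * |s.R l g| * |s.p u g - s.p l g|) volume 0 s.X := by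
    have mR : Measurable fun g => |s.R l g| := (Rcontg l).abs.measurable
    refine bdi (c := s.M * N) ((mψ.mul mR).mul ((mu.sub ml).abs)) ?_
    intro g hg
    have hg := Ioc_subset_Icc_self hg
    have := aux |s.R l g| 1 |s.p u g - s.p l g| g hg (by rw [abs_abs]; exact s.RM hg lI) (by simp) (abs_nonneg _) (pd g hg)
    convert this using 2; ring
  have fin : ∫ g in (0:ℝ)..s.X, s.ψ g * |s.R l g| * |s.p u g - s.p l g| ≤
      ∫ g in (0:ℝ)..s.X, ((f1 1 g + f1 (-1) g) - (f2 1 g + f2 (-1) g) + κ) := by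
    refine intervalIntegral.integral_mono_on_of_le_Ioo s.hX.le I4 I3 ?_
    intro g hg
    have hgI := Ioo_subset_Icc_self hg
    set d := s.p u g - s.p l g with hd
    have B2 : f1 1 g + f1 (-1) g = s.R u g * (ind (s.γ l) s.X g * (s.ψ g * (B d + B (-d)))) := by
      simp only [hf1, ← hd, one_mul, neg_one_mul]; ring
    have B3 : f2 1 g + f2 (-1) g = s.R l g * (ind 0 (s.γ u) g * (s.ψ g * (B d + B (-d)))) := by
      have : s.p l g - s.p u g = - d := by rw [hd]; ring
      simp only [hf2, this, one_mul, neg_one_mul, neg_neg]; ring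
    rw [B2, B3]
    set y := B d + B (-d) with hy
    have y0 : 0 ≤ y := add_nonneg (B0 _) (B0 _)
    have yu : y ≤ 2 * N := by
      have h1 := (Bl d).trans (pd g hgI)
      have h2 := Bl (-d)
      rw [abs_neg] at h2
      linarith [pd g hgI]
    have yl : |d| - (N + 1) * (u - l) ≤ y := by
      rcases abs_cases d with ⟨h, _⟩ | ⟨h, _⟩ <;> rw [h]
      · linarith [Blow d, B0 (-d)]
      · linarith [Blow (-d), B0 d]
    have hdN := pd g hgI
    have d0 := abs_nonneg d
    have hr0 := s.rnn g hgI
    have hrM := s.rM hgI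
    have hψ0 := s.ψnn g
    have hψ1 := s.ψle g
    have hM0 := s.M0
    have hRM := s.RM hgI lI
    have hRu : s.R u g = s.R l g - s.r g * (u - l) := by unfold R; ring
    have rψ : s.r g * s.ψ g ≤ s.M := by
      have := mul_le_mul hrM hψ1 hψ0 hM0
      linarith
    have rψ0 : 0 ≤ s.r g * s.ψ g := by positivity
    have rψy : s.r g * s.ψ g * y ≤ s.M * (2 * N) := mul_le_mul rψ yu y0 hM0
    have rψyD : s.r g * s.ψ g * y * (u - l) ≤ s.M * (2 * N) * (u - l) := mul_le_mul_of_nonneg_right rψy D0.le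
    have κe : κ = s.M * (2 * N) * (u - l) + s.M * (N + 1) * (u - l) + s.M * N * (u - l) + 5 * (s.M * N * (u - l)) := by
      rw [hκ]; ring
    have k1 : 0 ≤ s.M * N * (u - l) := by positivity
    have k2 : 0 ≤ s.M * (N + 1) * (u - l) := by positivity
    have key : s.ψ g * |s.R l g| * (|d| - (N + 1) * (u - l)) ≤ s.ψ g * |s.R l g| * y :=
      mul_le_mul_of_nonneg_left yl (by positivity)
    have key2 : s.ψ g * |s.R l g| * ((N + 1) * (u - l)) ≤ s.M * (N + 1) * (u - l) := by
      have : s.ψ g * |s.R l g| ≤ 1 * s.M := mul_le_mul hψ1 hRM (abs_nonneg _) zero_le_one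
      have := mul_le_mul_of_nonneg_right this (show 0 ≤ (N + 1) * (u - l) by positivity)
      linarith
    rcases le_or_gt g (s.γ l) with hgl | hgl <;> rcases le_or_gt g (s.γ u) with hgu | hgu
    · rw [ind_out (fun h => absurd h.1 (not_lt.2 hgl)), ind_in ⟨hg.1, hgu⟩]
      have hR : s.R l g ≤ 0 := s.γneg l hl.mem g hgI hgl
      rw [abs_of_nonpos hR] at key key2 ⊢
      have h5 : s.R u g * (0 * (s.ψ g * y)) - s.R l g * (1 * (s.ψ g * y)) = s.ψ g * (- s.R l g) * y := by ring
      rw [h5]; linarith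
    · rw [ind_out (fun h => absurd h.1 (not_lt.2 hgl)), ind_out (fun h => absurd h.2 (not_le.2 hgu))]
      have hR : s.R l g ≤ 0 := s.γneg l hl.mem g hgI hgl
      have hR2 : 0 ≤ s.R u g := s.γpos u hu.mem g hgI hgu.le
      have : 0 ≤ s.r g * (u - l) := by positivity
      have : s.R l g = 0 := by linarith
      rw [this]; simp only [abs_zero, mul_zero, zero_mul]; linarith
    · rw [ind_in ⟨hgl, hg.2.le⟩, ind_in ⟨hg.1, hgu⟩]
      have hR : 0 ≤ s.R l g := s.γpos l hl.mem g hgI hgl.le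
      have hR2 : s.R u g ≤ 0 := s.γneg u hu.mem g hgI hgu
      have h3 : s.R l g ≤ s.r g * (u - l) := by linarith
      rw [abs_of_nonneg hR]
      have h4 : s.ψ g * s.R l g * |d| ≤ s.M * N * (u - l) := by
        calc _ ≤ s.ψ g * (s.r g * (u - l)) * N := by gcongr
          _ = s.r g * s.ψ g * (N * (u - l)) := by ring
          _ ≤ s.M * (N * (u - l)) := by gcongr
          _ = _ := by ring
      have h5 : s.R u g * (1 * (s.ψ g * y)) - s.R l g * (1 * (s.ψ g * y)) = - (s.r g * s.ψ g * y * (u - l)) := by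
        rw [hRu]; ring
      rw [h5]; linarith
    · rw [ind_in ⟨hgl, hg.2.le⟩, ind_out (fun h => absurd h.2 (not_le.2 hgu))]
      have hR : 0 ≤ s.R l g := s.γpos l hl.mem g hgI hgl.le
      rw [abs_of_nonneg hR] at key key2 ⊢
      have h5 : s.R u g * (1 * (s.ψ g * y)) - s.R l g * (0 * (s.ψ g * y)) = s.ψ g * s.R l g * y - (s.r g * s.ψ g * y * (u - l)) := by
        rw [hRu]; ring
      rw [h5]; linarith
  have e : ∫ g in (0:ℝ)..s.X, ((f1 1 g + f1 (-1) g) - (f2 1 g + f2 (-1) g) + κ) =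
      (∫ g in (0:ℝ)..s.X, f1 1 g) + (∫ g in (0:ℝ)..s.X, f1 (-1) g) - ((∫ g in (0:ℝ)..s.X, f2 1 g) + (∫ g in (0:ℝ)..s.X, f2 (-1) g)) + s.X * κ := by
    rw [intervalIntegral.integral_add (((I1 1 o1).add (I1 _ o2)).sub ((I2 1 o1).add (I2 _ o2))) intervalIntegrable_const,
      intervalIntegral.integral_sub ((I1 1 o1).add (I1 _ o2)) ((I2 1 o1).add (I2 _ o2)),
      intervalIntegral.integral_add (I1 1 o1) (I1 _ o2), intervalIntegral.integral_add (I2 1 o1) (I2 _ o2)]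
    simp
  have := P1 1 o1
  have := P1 (-1) o2
  have := P2 1 o1
  have := P2 (-1) o2
  rw [e, hκ] at fin
  linarith
end Sys
end

section

lemma mvt_lip {f f' : ℝ → ℝ} {a b C : ℝ} (hc : ContinuousOn f (Icc a b))
    (hd : ∀ x ∈ Ioo a b, HasDerivAt f (f' x) x) (hb : ∀ x ∈ Ioo a b, |f' x| ≤ C) {x y : ℝ}
    (hx : x ∈ Icc a b) (hy : y ∈ Icc a b) : |f x - f y| ≤ C * |x - y| := by
  have aux : ∀ x y : ℝ, x ∈ Icc a b → y ∈ Icc a b → x < y → |f y - f x| ≤ C * |y - x| := by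
    intro x y hx hy hxy
    have i : Ioo x y ⊆ Ioo a b := Ioo_subset_Ioo hx.1 hy.2
    obtain ⟨c, hc, e⟩ := exists_hasDerivAt_eq_slope f f' hxy
      (hc.mono (Icc_subset_Icc hx.1 hy.2)) (fun z hz => hd z (i hz))
    have hyx : y - x ≠ 0 := by linarith
    have : f y - f x = f' c * (y - x) := by rw [e]; field_simp
    rw [this, abs_mul]
    gcongr
    exact hb c (i hc)
  rcases lt_trichotomy x y with hxy | hxy | hxy
  · rw [abs_sub_comm, abs_sub_comm x]; exact aux x y hx hy hxy
  · simp [hxy]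
  · exact aux y x hy hx hxy

namespace Sys
variable {s : Sys}

lemma W.mono {N N' w : ℝ} (h : s.W N w) (hN : N ≤ N') : s.W N' w where
  mem := h.mem
  b0 g hg := (h.b0 g hg).trans hN
  b1 x hx y hy := (h.b1 x hx y hy).trans (by gcongr)
  b2 x y t hx hy ht h1 h2 := (h.b2 x y t hx hy ht h1 h2).trans (by gcongr)
  b3 v hv := (h.b3 v hv).trans (by gcongr)

lemma bdd_Icc {f : ℝ → ℝ} {a b : ℝ} (hf : ContinuousOn f (Icc a b)) : ∃ c, 0 ≤ c ∧ ∀ x ∈ Icc a b, |f x| ≤ c := by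
  obtain ⟨c, hc⟩ := isCompact_Icc.exists_bound_of_continuousOn hf
  exact ⟨max c 0, le_max_right _ _, fun x hx => (hc x hx).trans (le_max_left _ _)⟩

lemma W_exists {w : ℝ} (hw : w ∈ Ioo 0 s.V) : ∃ n : ℕ, s.W n w := by
  have hKc := s.Kc
  have K0 : ∀ g ∈ Icc 0 s.X, s.K g ≠ 0 := fun g _ => (s.Kpos g).ne'
  obtain ⟨c0, n0, h0⟩ := bdd_Icc (s.pcg w hw)
  have qc : ContinuousOn (fun g => s.F w g / s.K g) (Icc 0 s.X) := (s.Fc w hw).div hKc.continuousOn K0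
  obtain ⟨c1, n1, h1⟩ := bdd_Icc qc
  have q1c : ContinuousOn (fun g => (s.S w g * s.K g - s.F w g * s.K1 g) / s.K g ^ 2) (Icc 0 s.X) :=
    (((s.Sc w hw).mul hKc.continuousOn).sub ((s.Fc w hw).mul s.K1c.continuousOn)).div
      (hKc.continuousOn.pow 2) (fun g hg => pow_ne_zero _ (K0 g hg))
  obtain ⟨c2, n2, h2⟩ := bdd_Icc q1c
  have qlip : ∀ x ∈ Icc 0 s.X, ∀ y ∈ Icc 0 s.X, |s.F w x / s.K x - s.F w y / s.K y| ≤ c2 * |x - y| :=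
    fun x hx y hy => mvt_lip qc (fun g hg => (s.Fder w hw g hg).div (s.Kder g) (s.Kpos g).ne')
      (fun g hg => h2 g (Ioo_subset_Icc_self hg)) hx hy
  have hγ : s.γ w ∈ Ioo 0 s.X := ⟨(s.γmem w hw).1, (s.γmem w hw).2.trans s.hGX⟩
  obtain ⟨c3, hc3⟩ := (s.pvder w hw _ hγ).isBigO_sub.bound
  obtain ⟨δ, hδ, hball⟩ := Metric.eventually_nhds_iff.1 hc3
  obtain ⟨c4, n4, h4⟩ := bdd_Icc (a := 0) (b := s.V) (s.pcv (s.γ w)).continuousOn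
  obtain ⟨n, hn⟩ := exists_nat_ge (c0 + c1 + c2 + max c3 0 + 2 * c4 / δ)
  have p3 : 0 ≤ max c3 0 := le_max_right _ _
  have p4 : 0 ≤ 2 * c4 / δ := by positivity
  refine ⟨n, hw, ?_, ?_, ?_, ?_⟩
  · intro g hg
    linarith [h0 g hg, le_abs_self (s.p w g)]
  · intro x hx y hy
    refine (mvt_lip (s.pcg w hw) (s.pder w hw) (fun g hg => h1 g (Ioo_subset_Icc_self hg)) hx hy).trans ?_
    gcongr; linarith
  · intro x y t hx hy ht hxt hyt
    have hh : |s.p w (x + t) - s.p w x - (s.p w (y + t) - s.p w y)| ≤ (c2 * t) * |x - y| := by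
      refine mvt_lip (f := fun x => s.p w (x + t) - s.p w x)
        (f' := fun x => s.F w (x + t) / s.K (x + t) - s.F w x / s.K x) (a := 0) (b := s.X - t) ?_ ?_ ?_
        ⟨hx, by linarith⟩ ⟨hy, by linarith⟩
      · refine ContinuousOn.sub ((s.pcg w hw).comp (by fun_prop) ?_) ((s.pcg w hw).mono ?_)
        · intro z hz; exact ⟨by linarith [hz.1], by linarith [hz.2]⟩
        · intro z hz; exact ⟨by linarith [hz.1], by linarith [hz.2]⟩
      · intro z hz
        refine HasDerivAt.sub ?_ (s.pder w hw z ⟨hz.1, by linarith [hz.2]⟩)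
        exact (s.pder w hw (z + t) ⟨by linarith [hz.1], by linarith [hz.2]⟩).comp_add_const z t
      · intro z hz
        have := qlip (z + t) ⟨by linarith [hz.1], by linarith [hz.2]⟩ z ⟨by linarith [hz.1], by linarith [hz.2]⟩
        rwa [add_sub_cancel_left, abs_of_nonneg ht] at this
    refine hh.trans ?_
    have : c2 * t * |x - y| = c2 * |x - y| * t := by ring
    rw [this]; gcongr; linarith
  · intro v hv
    by_cases hd : dist v w < δ
    · have := hball hd
      rw [Real.norm_eq_abs, Real.norm_eq_abs] at this
      refine this.trans ?_
      gcongr; linarith [le_max_left c3 0]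
    · rw [Real.dist_eq, not_lt] at hd
      have t1 := abs_le.1 (h4 v (Ioo_subset_Icc_self hv))
      have t2 := abs_le.1 (h4 w (Ioo_subset_Icc_self hw))
      have : |s.p v (s.γ w) - s.p w (s.γ w)| ≤ 2 * c4 := by
        rw [abs_le]; constructor <;> linarith
      refine this.trans ?_
      calc 2 * c4 = 2 * c4 / δ * δ := by field_simp
        _ ≤ 2 * c4 / δ * |v - w| := by gcongr
        _ ≤ _ := by gcongr; linarith

lemma W_closed {N w : ℝ} {u : ℕ → ℝ} (hu : ∀ n, s.W N (u n)) (lim : Tendsto u atTop (𝓝 w))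
    (hw : w ∈ Ioo 0 s.V) : s.W N w := by
  have t : ∀ g, Tendsto (fun n => s.p (u n) g) atTop (𝓝 (s.p w g)) := fun g =>
    ((s.pcv g).tendsto w).comp lim
  have tγ : Tendsto (fun n => s.γ (u n)) atTop (𝓝 (s.γ w)) :=
    ((s.γc.continuousAt (isOpen_Ioo.mem_nhds hw)).tendsto).comp lim
  have hI : ∀ v ∈ Ioo 0 s.V, s.γ v ∈ Ioo 0 s.X := fun v hv =>
    ⟨(s.γmem v hv).1, (s.γmem v hv).2.trans s.hGX⟩
  refine ⟨hw, ?_, ?_, ?_, ?_⟩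
  · exact fun g hg => le_of_tendsto' (t g) fun n => (hu n).b0 g hg
  · exact fun x hx y hy => le_of_tendsto' ((t x).sub (t y)).abs fun n => (hu n).b1 x hx y hy
  · intro x y k hx hy hk h1 h2
    exact le_of_tendsto' (((t _).sub (t _)).sub ((t _).sub (t _))).abs fun n => (hu n).b2 x y k hx hy hk h1 h2
  · intro v hv
    have a1 : Tendsto (fun n => s.p v (s.γ (u n))) atTop (𝓝 (s.p v (s.γ w))) :=
      (((s.pcg v hv).continuousAt (Icc_mem_nhds (hI w hw).1 (hI w hw).2)).tendsto).comp tγ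
    have a2 : Tendsto (fun n => s.p (u n) (s.γ (u n)) - s.p (u n) (s.γ w)) atTop (𝓝 0) := by
      have z : Tendsto (fun n => N * |s.γ (u n) - s.γ w|) atTop (𝓝 0) := by
        have := ((tγ.sub_const (s.γ w)).abs).const_mul N
        simpa using this
      refine squeeze_zero_norm (fun n => ?_) z
      exact (hu n).b1 _ (Ioo_subset_Icc_self (hI _ (hu n).mem)) _ (Ioo_subset_Icc_self (hI w hw))
    have a3 : Tendsto (fun n => s.p (u n) (s.γ (u n))) atTop (𝓝 (s.p w (s.γ w))) := by
      have := a2.add (t (s.γ w))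
      simpa using this
    exact le_of_tendsto_of_tendsto' (a1.sub a3).abs ((lim.const_sub v).abs.const_mul N)
      fun n => (hu n).b3 v hv
end Sys
end

section
namespace Sys
variable {s : Sys}

lemma TF.bM {C : ℝ} {Ψ Ψ' : ℝ → ℝ → ℝ} (h : s.TF C Ψ Ψ') {v g : ℝ} (hv : v ∈ Icc 0 s.V) (hg : g ∈ Icc 0 s.X) :
    |s.R v g * Ψ g (s.p v g)| ≤ s.M * C := by
  rw [abs_mul]
  refine mul_le_mul (s.RM hg hv) ?_ (abs_nonneg _) s.M0
  have := h.bd g hg _ (s.pnn v g)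
  have h2 : C * s.ψ g ≤ C * 1 := mul_le_mul_of_nonneg_left (s.ψle g) h.C0
  linarith

lemma TF.Φint {C : ℝ} {Ψ Ψ' : ℝ → ℝ → ℝ} (h : s.TF C Ψ Ψ') {v : ℝ} (hv : v ∈ Icc 0 s.V) :
    IntervalIntegrable (fun g => s.R v g * Ψ g (s.p v g)) volume 0 s.X :=
  bdi (c := s.M * C) ((Rcontg v).measurable.mul (h.meas.comp (measurable_const.prodMk measurable_id)))
    (fun g hg => h.bM hv (Ioc_subset_Icc_self hg))

set_option maxHeartbeats 1000000 in
theorem gap_base {N a b : ℝ} {Q : Set ℝ} (hQ : IsClosed Q) (hQs : Q ⊆ Icc a b) (ha : a ∈ Q) (hb : b ∈ Q)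
    (hab : a < b) (hW : ∀ v ∈ Q, s.W N v)
    (hgap : ∀ l ∈ Q, ∀ u ∈ Q, l < u → (∀ w ∈ Ioo l u, w ∉ Q) → s.base l u) : s.base a b := by
  intro C Ψ Ψ' hT e he hE
  have hN := (hW a ha).N0
  have a0 := (hW a ha).mem.1
  have bV := (hW b hb).mem.2
  have hM := s.M0
  have hC := hT.C0
  have hX := s.hX
  have mlo : Measurable (gapLo Q a) := (gapLo_mono ha).measurable
  have mup : Measurable (gapUp Q b) := (gapUp_mono hb).measurable
  have QV : ∀ v ∈ Q, v ∈ Icc 0 s.V := fun v hv => Ioo_subset_Icc_self (hW v hv).mem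
  -- gap facts
  have gf : ∀ v ∈ Ioo a b \ Q, gapLo Q a v ∈ Q ∧ gapUp Q b v ∈ Q ∧ gapLo Q a v < v ∧ v < gapUp Q b v ∧
      a ≤ gapLo Q a v ∧ gapUp Q b v ≤ b ∧ s.base (gapLo Q a v) (gapUp Q b v) := by
    intro v hv
    have h1 := (gapLo_mem hQ ha v).1
    have h2 := (gapUp_mem hQ hb v).1
    have h3 := gapLo_lt hQ ha hv.1.1.le hv.2
    have h4 := lt_gapUp hQ hb hv.1.2.le hv.2
    exact ⟨h1, h2, h3, h4, (hQs h1).1, (hQs h2).2, hgap _ h1 _ h2 (h3.trans h4)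
      (fun w hw => gap_not_mem hw.1 hw.2)⟩
  set f : ℝ → ℝ → ℝ := fun v g => s.R v g * Ψ g (s.p v g) with hf
  have fm : Measurable (Function.uncurry f) := s.Rm.mul hT.meas
  set U : Set ℝ := Ioo a b \ Q with hU
  have Um : MeasurableSet U := measurableSet_Ioo.diff hQ.measurableSet
  set sl : ℝ × ℝ → ℝ := fun x => (f (gapUp Q b x.1) x.2 - f (gapLo Q a x.1) x.2) / (gapUp Q b x.1 - gapLo Q a x.1) with hsl
  have slm : Measurable sl :=
    ((fm.comp ((mup.comp measurable_fst).prodMk measurable_snd)).sub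
      (fm.comp ((mlo.comp measurable_fst).prodMk measurable_snd))).div
      ((mup.comp measurable_fst).sub (mlo.comp measurable_fst))
  classical
  set d : ℝ × ℝ → ℝ := fun x => if x.1 ∈ Q then s.Hh Ψ Ψ' x.1 x.2 else sl x with hd
  have dm : Measurable d := Measurable.ite (measurable_fst hQ.measurableSet) hT.Hm slm
  set μ := (volume : Measure ℝ).restrict (Ioo a b) with hμ
  set ν := (volume : Measure ℝ).restrict (Ioc 0 s.X) with hν
  haveI : IsFiniteMeasure μ := ⟨by simp [hμ]⟩
  haveI : IsFiniteMeasure ν := ⟨by simp [hν]⟩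
  have νX : ν.real univ = s.X := by simp [hν, Measure.real, hX.le]
  -- slice bounds
  have bQ : ∀ v ∈ Q, ∀ g ∈ Ioc 0 s.X, |s.Hh Ψ Ψ' v g| ≤ C * (3 * s.M * N + s.M) := by
    intro v hv g hg
    have hg := Ioc_subset_Icc_self hg
    have w := hW v hv
    have c1 : ∀ y, |y| ≤ C * s.ψ g → |y| ≤ C := fun y hy => hy.trans (by
      have := mul_le_mul_of_nonneg_left (s.ψle g) hC; linarith)
    have h1 := c1 _ (hT.bd g hg _ (s.pnn v g))
    have h2 := c1 _ (hT.bd' g hg _ (s.pnn v g))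
    have h3 : |s.S v g + s.r g * s.p v g| ≤ 3 * s.M * N := by
      have h4 : |s.r g * s.p v g| ≤ s.M * N := by
        rw [abs_mul, abs_of_nonneg (s.rnn g hg), abs_of_nonneg (s.pnn v g)]
        exact mul_le_mul (s.rM hg) (w.b0 g hg) (s.pnn v g) hM
      refine (abs_add_le _ _).trans ?_
      linarith [w.Sb hg]
    unfold Hh
    refine (abs_sub _ _).trans ?_
    rw [abs_mul, abs_mul (s.r g), abs_of_nonneg (s.rnn g hg)]
    have h5 := mul_le_mul h2 h3 (abs_nonneg _) hC
    have h6 := mul_le_mul (s.rM hg) h1 (abs_nonneg _) hM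
    linarith
  have bU : ∀ v ∈ U, ∀ g ∈ Ioc 0 s.X, |sl (v, g)| ≤
      (C * (s.ψ g * |s.R (gapLo Q a v) g| * |s.p (gapUp Q b v) g - s.p (gapLo Q a v) g|)) / (gapUp Q b v - gapLo Q a v) + s.M * C := by
    intro v hv g hg
    have hg := Ioc_subset_Icc_self hg
    obtain ⟨h1, h2, h3, h4, h5, h6, _⟩ := gf v hv
    set l := gapLo Q a v with hl
    set u := gapUp Q b v with hu
    have ul : 0 < u - l := by linarith
    have e1 : sl (v, g) = (f u g - f l g) / (u - l) := rfl
    rw [e1, abs_div, abs_of_pos ul, div_add' _ _ _ ul.ne', div_le_div_iff_of_pos_right ul]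
    have e2 : f u g - f l g = s.R l g * (Ψ g (s.p u g) - Ψ g (s.p l g)) - s.r g * (u - l) * Ψ g (s.p u g) := by
      simp only [hf, R]; ring
    rw [e2]
    refine (abs_sub _ _).trans ?_
    rw [abs_mul, abs_mul (s.r g * (u - l)), abs_of_nonneg (mul_nonneg (s.rnn g hg) ul.le)]
    have t1 := mul_le_mul_of_nonneg_left (hT.lip hg (s.pnn u g) (s.pnn l g)) (abs_nonneg (s.R l g))
    have t2 : |Ψ g (s.p u g)| ≤ C := (hT.bd g hg _ (s.pnn u g)).trans (by
      have := mul_le_mul_of_nonneg_left (s.ψle g) hC; linarith)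
    have t3 : s.r g * (u - l) * |Ψ g (s.p u g)| ≤ s.M * (u - l) * C := by
      have := s.rM hg
      have := s.rnn g hg
      gcongr
    linarith
  set Kc : ℝ := C * (3 * s.M * N + s.M) * s.X + (C * (4 * s.K0 N + s.X * (s.M * (9 * N + 1))) + s.M * C * s.X) with hKc
  have K0n : 0 ≤ s.K0 N := by unfold K0; have := s.hk0; have := s.hV; positivity
  have memUQ : ∀ v ∈ Ioo a b, v ∉ Q → v ∈ U := fun v hv hq => ⟨hv, hq⟩
  have slice : ∀ v ∈ Ioo a b, Integrable (fun g => d (v, g)) ν ∧ ∫ g, ‖d (v, g)‖ ∂ν ≤ Kc := by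
    intro v hv
    have dmv : Measurable fun g => d (v, g) := dm.comp (measurable_const.prodMk measurable_id)
    by_cases hq : v ∈ Q
    · have e1 : ∀ g, d (v, g) = s.Hh Ψ Ψ' v g := fun g => if_pos hq
      have hi : Integrable (fun g => d (v, g)) ν := by
        refine Integrable.of_bound dmv.aestronglyMeasurable (C * (3 * s.M * N + s.M)) ?_
        refine (ae_restrict_iff' measurableSet_Ioc).2 (Eventually.of_forall fun g hg => ?_)
        rw [e1]; exact bQ v hq g hg
      refine ⟨hi, ?_⟩
      have : ∫ g, ‖d (v, g)‖ ∂ν ≤ ∫ g, (C * (3 * s.M * N + s.M)) ∂ν := by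
        refine integral_mono_ae hi.norm (integrable_const _) ?_
        refine (ae_restrict_iff' measurableSet_Ioc).2 (Eventually.of_forall fun g hg => ?_)
        simp only [e1]; exact bQ v hq g hg
      rw [integral_const, νX, smul_eq_mul] at this
      rw [hKc]
      have : 0 ≤ C * (4 * s.K0 N + s.X * (s.M * (9 * N + 1))) + s.M * C * s.X := by positivity
      linarith
    · have hvU := memUQ v hv hq
      have e1 : ∀ g, d (v, g) = sl (v, g) := fun g => if_neg hq
      obtain ⟨h1, h2, h3, h4, h5, h6, hbase⟩ := gf v hvU
      have l7 := L7 (hW _ h1) (hW _ h2) (h3.trans h4) hbase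
      have bu := bU v hvU
      set l := gapLo Q a v with hl
      set u := gapUp Q b v with hu
      have ul : 0 < u - l := by linarith
      set φ : ℝ → ℝ := fun g => s.ψ g * |s.R l g| * |s.p u g - s.p l g| with hφ
      have φi : Integrable φ ν := by
        have ml := pmg (s := s) l
        have mu := pmg (s := s) u
        have mR : Measurable fun g => |s.R l g| := (Rcontg l).abs.measurable
        refine Integrable.of_bound ((s.ψc.measurable.mul mR).mul ((mu.sub ml).abs)).aestronglyMeasurable (1 * s.M * N) ?_
        refine (ae_restrict_iff' measurableSet_Ioc).2 (Eventually.of_forall fun g hg => ?_)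
        have hg := Ioc_subset_Icc_self hg
        have pd : |s.p u g - s.p l g| ≤ N := by
          rw [abs_le]
          constructor <;> linarith [s.pnn u g, s.pnn l g, (hW _ h1).b0 g hg, (hW _ h2).b0 g hg]
        have := s.ψnn g
        rw [Real.norm_eq_abs, abs_of_nonneg (by positivity)]
        exact mul_le_mul (mul_le_mul (s.ψle g) (s.RM hg (QV l h1)) (abs_nonneg _) zero_le_one) pd (abs_nonneg _) (by positivity)
      have domi : Integrable (fun g => C * φ g / (u - l) + s.M * C) ν :=
        ((φi.const_mul C).div_const _).add (integrable_const _)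
      have hae : ∀ᵐ g ∂ν, ‖d (v, g)‖ ≤ C * φ g / (u - l) + s.M * C :=
        (ae_restrict_iff' measurableSet_Ioc).2 (Eventually.of_forall fun g hg => by rw [e1]; exact bu g hg)
      have hi := domi.mono' dmv.aestronglyMeasurable hae
      refine ⟨hi, ?_⟩
      have := integral_mono_ae hi.norm domi hae
      rw [integral_add ((φi.const_mul C).div_const _) (integrable_const _), integral_const, νX, smul_eq_mul,
        integral_div, integral_const_mul] at this
      rw [intervalIntegral.integral_of_le hX.le] at l7
      have t : C * (∫ g, φ g ∂ν) / (u - l) ≤ C * (4 * s.K0 N + s.X * (s.M * (9 * N + 1))) := by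
        rw [div_le_iff₀ ul, mul_assoc]
        exact mul_le_mul_of_nonneg_left l7 hC
      rw [hKc]
      have : 0 ≤ C * (3 * s.M * N + s.M) * s.X := by positivity
      linarith
  have dint : Integrable d (μ.prod ν) := by
    rw [integrable_prod_iff dm.aestronglyMeasurable]
    refine ⟨(ae_restrict_iff' measurableSet_Ioo).2 (Eventually.of_forall fun v hv => (slice v hv).1), ?_⟩
    refine Integrable.of_bound (dm.norm.stronglyMeasurable.integral_prod_right').aestronglyMeasurable Kc ?_
    refine (ae_restrict_iff' measurableSet_Ioo).2 (Eventually.of_forall fun v hv => ?_)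
    rw [Real.norm_eq_abs, abs_of_nonneg (integral_nonneg fun _ => norm_nonneg _)]
    exact (slice v hv).2
  set D : ℝ → ℝ := fun v => ∫ g, d (v, g) ∂ν with hD
  have Dint : Integrable D μ := dint.integral_prod_left
  -- Fubini
  have FB : ∫ v, D v ∂μ = s.Φ Ψ b - s.Φ Ψ a := by
    have e1 : ∫ v, D v ∂μ = ∫ g, ∫ v, d (v, g) ∂μ ∂ν := integral_integral_swap dint
    rw [e1]
    have e2 : ∫ g, ∫ v, d (v, g) ∂μ ∂ν = ∫ g, (f b g - f a g) ∂ν := by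
      have h1 := dint.prod_left_ae
      refine integral_congr_ae ?_
      have hne : ∀ᵐ g ∂ν, g ∈ Ioo 0 s.X := by
        rw [hν, ← restrict_Ioo_eq_restrict_Ioc]
        exact ae_restrict_mem measurableSet_Ioo
      filter_upwards [h1, hne] with g hg hgI
      have key := gap_ftc hQ hQs ha hb (fun v => f v g) (fun v => s.Hh Ψ Ψ' v g) (fun v => d (v, g))
        (fun v hv => hT.hder (hW v hv).mem hgI) (fun v hv => if_pos hv) (fun v hv => if_neg hv.2)
        ((intervalIntegrable_iff_integrableOn_Ioo_of_le hab.le).2 hg)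
      rw [intervalIntegral.integral_of_le hab.le, integral_Ioc_eq_integral_Ioo] at key
      exact key
    have i1 := hT.Φint (QV a ha)
    have i2 := hT.Φint (QV b hb)
    rw [e2, ← intervalIntegral.integral_of_le hX.le, intervalIntegral.integral_sub i2 i1]
    rfl
  have DQ : ∀ v ∈ Q, D v = s.E Ψ Ψ' v := by
    intro v hv
    simp only [hD, E]
    rw [intervalIntegral.integral_of_le hX.le]
    exact integral_congr_ae (Eventually.of_forall fun g => if_pos hv)
  have DU : ∀ v ∈ U, D v = (s.Φ Ψ (gapUp Q b v) - s.Φ Ψ (gapLo Q a v)) / (gapUp Q b v - gapLo Q a v) := by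
    intro v hv
    obtain ⟨h1, h2, _⟩ := gf v hv
    have e1 : D v = ∫ g, sl (v, g) ∂ν := integral_congr_ae (Eventually.of_forall fun g => if_neg hv.2)
    rw [e1]
    simp only [hsl]
    rw [integral_div, ← intervalIntegral.integral_of_le hX.le,
      intervalIntegral.integral_sub (hT.Φint (QV _ h2)) (hT.Φint (QV _ h1))]
    rfl
  -- negative part
  have Em := hT.Em
  set e0 : ℝ → ℝ := (Ioo a b).indicator (fun v => max (- s.E Ψ Ψ' v) 0) with he0
  have e0m : Measurable e0 := (Em.neg.max measurable_const).indicator measurableSet_Ioo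
  have e0n : ∀ v, 0 ≤ e0 v := fun v => indicator_nonneg (fun _ _ => le_max_right _ _) v
  have e0E : ∀ v ∈ Ioo a b, 0 ≤ s.E Ψ Ψ' v + e0 v := by
    intro v hv
    rw [he0, indicator_of_mem hv]
    linarith [le_max_left (- s.E Ψ Ψ' v) 0]
  have e0i : Integrable e0 := by
    rw [he0, integrable_indicator_iff measurableSet_Ioo]
    have : IntegrableOn e (Ioo a b) := (intervalIntegrable_iff_integrableOn_Ioo_of_le hab.le).1 he
    refine this.abs.mono' (Em.neg.max measurable_const).aestronglyMeasurable ?_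
    refine (ae_restrict_iff' measurableSet_Ioo).2 (Eventually.of_forall fun v hv => ?_)
    rw [Real.norm_eq_abs, abs_of_nonneg (le_max_right _ _)]
    exact max_le (by linarith [hE v hv, le_abs_self (e v)]) (abs_nonneg _)
  set P : ℝ → ℝ := fun x => ∫ v in a..x, e0 v with hP
  have Pc : Continuous P := intervalIntegral.continuous_primitive (fun _ _ => e0i.intervalIntegrable) a
  set A : ℝ → ℝ := fun v => (P (gapUp Q b v) - P (gapLo Q a v)) / (gapUp Q b v - gapLo Q a v) with hA
  have Am : Measurable A :=
    ((Pc.measurable.comp mup).sub (Pc.measurable.comp mlo)).div (mup.sub mlo)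
  have Aeq : ∀ v ∈ U, A v = (∫ w in Ioo (gapLo Q a v) (gapUp Q b v), e0 w) / (gapUp Q b v - gapLo Q a v) := by
    intro v hv
    obtain ⟨h1, h2, h3, h4, _⟩ := gf v hv
    simp only [hA, hP]
    rw [intervalIntegral.integral_interval_sub_left e0i.intervalIntegrable e0i.intervalIntegrable,
      intervalIntegral.integral_of_le (h3.trans h4).le, integral_Ioc_eq_integral_Ioo]
  have A0 : ∀ v ∈ U, 0 ≤ A v := by
    intro v hv
    obtain ⟨h1, h2, h3, h4, _⟩ := gf v hv
    rw [Aeq v hv]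
    exact div_nonneg (integral_nonneg e0n) (by linarith)
  have av1 := gap_avg hQ ha hb (fun v => ENNReal.ofReal (e0 v)) e0m.ennreal_ofReal
  have av2 := gap_avg hQ ha hb (fun v => ENNReal.ofReal (s.E Ψ Ψ' v + e0 v)) (Em.add e0m).ennreal_ofReal
  have L1 : ∫⁻ v in U, ENNReal.ofReal (A v) = ∫⁻ v in U, ENNReal.ofReal (e0 v) := by
    rw [← av1]
    refine setLIntegral_congr_fun Um fun v hv => ?_
    obtain ⟨h1, h2, h3, h4, _⟩ := gf v hv
    have ul : 0 < gapUp Q b v - gapLo Q a v := by linarith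
    rw [Aeq v hv, ← ofReal_integral_eq_lintegral_ofReal e0i.integrableOn (Eventually.of_forall e0n),
      ← ENNReal.ofReal_mul (by positivity)]
    congr 1; ring
  have EDA : ∀ v ∈ U, IntegrableOn (fun w => s.E Ψ Ψ' w + e0 w) (Ioo (gapLo Q a v) (gapUp Q b v)) ∧
      (∫ w in Ioo (gapLo Q a v) (gapUp Q b v), (s.E Ψ Ψ' w + e0 w)) / (gapUp Q b v - gapLo Q a v) = D v + A v := by
    intro v hv
    obtain ⟨h1, h2, h3, h4, h5, h6, hbase⟩ := gf v hv
    have lu := (h3.trans h4).le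
    obtain ⟨i, ee⟩ := hbase C Ψ Ψ' hT e (he.mono_set (by
      rw [uIcc_of_le lu, uIcc_of_le hab.le]; exact Icc_subset_Icc h5 h6))
      (fun w hw => hE w ⟨h5.trans_lt hw.1, hw.2.trans_le h6⟩)
    have i' := (intervalIntegrable_iff_integrableOn_Ioo_of_le lu).1 i
    refine ⟨i'.add e0i.integrableOn, ?_⟩
    rw [integral_add i' e0i.integrableOn, add_div, ← Aeq v hv, DU v hv, ee, intervalIntegral.integral_of_le lu,
      integral_Ioc_eq_integral_Ioo]
  have subI : ∀ v ∈ U, Ioo (gapLo Q a v) (gapUp Q b v) ⊆ Ioo a b := fun v hv => by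
    obtain ⟨h1, h2, h3, h4, h5, h6, hbase⟩ := gf v hv
    exact Ioo_subset_Ioo h5 h6
  have DA0 : ∀ v ∈ U, 0 ≤ D v + A v := by
    intro v hv
    obtain ⟨h1, h2, h3, h4, _⟩ := gf v hv
    rw [← (EDA v hv).2]
    refine div_nonneg (setIntegral_nonneg measurableSet_Ioo fun w hw => e0E w (subI v hv hw)) (by linarith)
  have L2 : ∫⁻ v in U, ENNReal.ofReal (D v + A v) = ∫⁻ v in U, ENNReal.ofReal (s.E Ψ Ψ' v + e0 v) := by
    rw [← av2]
    refine setLIntegral_congr_fun Um fun v hv => ?_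
    obtain ⟨h1, h2, h3, h4, _⟩ := gf v hv
    have ul : 0 < gapUp Q b v - gapLo Q a v := by linarith
    rw [← (EDA v hv).2, ← ofReal_integral_eq_lintegral_ofReal (EDA v hv).1
      ((ae_restrict_iff' measurableSet_Ioo).2 (Eventually.of_forall fun w hw => e0E w (subI v hv hw))),
      ← ENNReal.ofReal_mul (by positivity)]
    congr 1; ring
  have DiU : IntegrableOn D U := Dint.mono_measure (Measure.restrict_mono diff_subset le_rfl)
  have aeU : ∀ {F : ℝ → ℝ}, (∀ v ∈ U, 0 ≤ F v) → 0 ≤ᵐ[volume.restrict U] F := fun h =>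
    (ae_restrict_iff' Um).2 (Eventually.of_forall h)
  have AiU : IntegrableOn A U := by
    refine ⟨Am.aestronglyMeasurable, ?_⟩
    rw [hasFiniteIntegral_iff_ofReal (aeU A0), L1, ← hasFiniteIntegral_iff_ofReal (Eventually.of_forall e0n)]
    exact e0i.integrableOn.2
  have EiU0 : IntegrableOn (fun v => s.E Ψ Ψ' v + e0 v) U := by
    refine ⟨(Em.add e0m).aestronglyMeasurable, ?_⟩
    rw [hasFiniteIntegral_iff_ofReal (aeU fun v hv => e0E v hv.1), ← L2,
      ← hasFiniteIntegral_iff_ofReal (aeU DA0)]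
    exact (DiU.add AiU).2
  have EiU : IntegrableOn (s.E Ψ Ψ') U := by
    have := EiU0.sub (e0i.integrableOn (s := U))
    refine this.congr (Eventually.of_forall fun v => ?_)
    simp
  have I1 : ∫ v in U, A v = ∫ v in U, e0 v := by
    rw [integral_eq_lintegral_of_nonneg_ae (aeU A0) Am.aestronglyMeasurable, L1,
      ← integral_eq_lintegral_of_nonneg_ae (Eventually.of_forall e0n) e0m.aestronglyMeasurable]
  have I2 : ∫ v in U, (D v + A v) = ∫ v in U, (s.E Ψ Ψ' v + e0 v) := by
    rw [integral_eq_lintegral_of_nonneg_ae (aeU DA0) (DiU.add AiU).1, L2,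
      ← integral_eq_lintegral_of_nonneg_ae (aeU fun v hv => e0E v hv.1) EiU0.1]
  rw [integral_add DiU AiU, integral_add EiU e0i.integrableOn] at I2
  have I3 : ∫ v in U, D v = ∫ v in U, s.E Ψ Ψ' v := by linarith
  set Z := Ioo a b ∩ Q with hZ
  have Zm : MeasurableSet Z := measurableSet_Ioo.inter hQ.measurableSet
  have DiZ : IntegrableOn D Z := Dint.mono_measure (Measure.restrict_mono inter_subset_left le_rfl)
  have EiZ : IntegrableOn (s.E Ψ Ψ') Z := DiZ.congr_fun (fun v hv => DQ v hv.2) Zm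
  have I4 : ∫ v in Z, D v = ∫ v in Z, s.E Ψ Ψ' v := setIntegral_congr_fun Zm (fun v hv => DQ v hv.2)
  have hun : Ioo a b = U ∪ Z := (diff_union_inter _ _).symm
  have hdis : Disjoint U Z := disjoint_sdiff_inter
  have Ei : IntegrableOn (s.E Ψ Ψ') (Ioo a b) := by rw [hun]; exact EiU.union EiZ
  refine ⟨(intervalIntegrable_iff_integrableOn_Ioo_of_le hab.le).2 Ei, ?_⟩
  rw [← FB, intervalIntegral.integral_of_le hab.le, integral_Ioc_eq_integral_Ioo, hμ, hun,
    setIntegral_union hdis Zm DiU DiZ, setIntegral_union hdis Zm EiU EiZ, I3, I4]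
end Sys
end

section
namespace Sys
variable {s : Sys}

lemma isOpen_loc : IsOpen {v : ℝ | ∃ δ > 0, s.Good (v - δ) (v + δ)} := by
  rw [Metric.isOpen_iff]
  rintro v ⟨δ, hδ, h⟩
  refine ⟨δ / 2, by positivity, fun w hw => ⟨δ / 2, by positivity, ?_⟩⟩
  rw [Metric.mem_ball, Real.dist_eq, abs_lt] at hw
  exact h.mono (by linarith [hw.1]) (by linarith [hw.2])

/-- local step: if all bad points in `(c,d)` are uniformly regular then `(c,d)` is good -/
lemma good_of_W {N c d : ℝ} (hc : 0 ≤ c) (hd : d ≤ s.V)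
    (hW : ∀ v ∈ Ioo c d, (∃ δ > 0, s.Good (v - δ) (v + δ)) ∨ s.W N v) {x y : ℝ} (hx : c < x) (hxy : x ≤ y)
    (hy : y < d) : s.base x y := by
  set O := {v : ℝ | ∃ δ > 0, s.Good (v - δ) (v + δ)} with hO
  have Oo : IsOpen O := isOpen_loc
  have locb : ∀ l u, x ≤ l → l ≤ u → u ≤ y → (∀ w ∈ Ioo l u, w ∈ O) → s.base l u := by
    intro l u h1 h2 h3 h
    exact good_of_local (by linarith) (by linarith) h l u le_rfl h2 le_rfl
  set T := Icc x y \ O with hT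
  have Tc : IsCompact T := isCompact_Icc.diff Oo
  rcases T.eq_empty_or_nonempty with h0 | hne
  · refine locb x y le_rfl hxy le_rfl fun w hw => ?_
    by_contra h
    have : w ∈ T := ⟨Ioo_subset_Icc_self hw, h⟩
    rw [h0] at this; exact this
  obtain ⟨a', ha', la⟩ := Tc.exists_isLeast hne
  obtain ⟨b', hb', gb⟩ := Tc.exists_isGreatest hne
  have hab : a' ≤ b' := la hb'
  have B1 : s.base x a' := locb x a' le_rfl ha'.1.1 ha'.1.2 fun w hw => by
    by_contra h
    exact absurd (la ⟨⟨hw.1.le, hw.2.le.trans ha'.1.2⟩, h⟩) (not_le.2 hw.2)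
  have B3 : s.base b' y := locb b' y hb'.1.1 hb'.1.2 le_rfl fun w hw => by
    by_contra h
    exact absurd (gb ⟨⟨hb'.1.1.trans hw.1.le, hw.2.le⟩, h⟩) (not_le.2 hw.1)
  have B2 : s.base a' b' := by
    rcases eq_or_lt_of_le hab with e | hlt
    · rw [e]; exact base_refl _
    refine gap_base (Q := T) (N := N) Tc.isClosed (fun w hw => ⟨la hw, gb hw⟩) ha' hb' hlt ?_ ?_
    · intro v hv
      rcases hW v ⟨hx.trans_le hv.1.1, hv.1.2.trans_lt hy⟩ with h | h
      · exact absurd h hv.2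
      · exact h
    · intro l hl u hu hlu hn
      refine locb l u hl.1.1 hlu.le hu.1.2 fun w hw => ?_
      by_contra h
      exact hn w hw ⟨⟨hl.1.1.trans hw.1.le, hw.2.le.trans hu.1.2⟩, h⟩
  exact (B1.trans ha'.1.1 hab B2).trans (ha'.1.1.trans hab) hb'.1.2 B3

theorem L9 : s.Good 0 s.V := by
  refine good_of_local le_rfl le_rfl ?_
  by_contra hcon
  push Not at hcon
  set O := {v : ℝ | ∃ δ > 0, s.Good (v - δ) (v + δ)} with hO
  have Oo : IsOpen O := isOpen_loc
  set P := Ioo 0 s.V ∩ Oᶜ with hP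
  obtain ⟨v0, hv0, hn0⟩ := hcon
  have v0P : v0 ∈ P := ⟨hv0, by rintro ⟨δ, h1, h2⟩; exact hn0 δ h1 h2⟩
  have lc : IsLocallyClosed P := isOpen_Ioo.isLocallyClosed.inter Oo.isClosed_compl.isLocallyClosed
  have : LocallyCompactSpace P := lc.locallyCompactSpace
  have : Nonempty P := ⟨⟨v0, v0P⟩⟩
  obtain ⟨n, hn⟩ := nonempty_interior_of_iUnion_of_closed (X := P) (f := fun n : ℕ => {x : P | s.W n x}) (by
      intro n
      refine isClosed_of_closure_subset fun x hx => ?_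
      obtain ⟨u, hu, lim⟩ := mem_closure_iff_seq_limit.1 hx
      exact W_closed (u := fun k => (u k : ℝ)) hu ((continuous_subtype_val.tendsto x).comp lim) x.2.1) (by
      ext x
      simp only [mem_iUnion, mem_univ, iff_true]
      exact W_exists x.2.1)
  obtain ⟨w, hw⟩ := hn
  obtain ⟨ε, hε, hb⟩ := Metric.isOpen_iff.1 isOpen_interior w hw
  have hw0 := w.2.1
  set δ := min ε (min (w:ℝ) (s.V - w)) with hδ
  have δ0 : 0 < δ := lt_min hε (lt_min hw0.1 (by linarith [hw0.2]))
  have δ1 : δ ≤ w := (min_le_right _ _).trans (min_le_left _ _)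
  have δ2 : δ ≤ s.V - w := (min_le_right _ _).trans (min_le_right _ _)
  have δ3 : δ ≤ ε := min_le_left _ _
  refine w.2.2 ⟨δ / 2, by positivity, fun x y hx hxy hy => ?_⟩
  refine good_of_W (N := n) (c := w - δ) (d := w + δ) (by linarith) (by linarith) ?_ (by linarith) hxy (by linarith)
  intro v hv
  by_cases h : v ∈ O
  · exact Or.inl h
  · right
    have vP : v ∈ P := ⟨⟨by linarith [hv.1], by linarith [hv.2]⟩, h⟩
    have : (⟨v, vP⟩ : P) ∈ Metric.ball w ε := by
      rw [Metric.mem_ball, Subtype.dist_eq, Real.dist_eq, abs_lt]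
      constructor <;> simp only <;> linarith [hv.1, hv.2]
    have h2 : (⟨v, vP⟩ : P) ∈ {x : P | s.W n x} := interior_subset (hb this)
    exact h2

end Sys
end

section
namespace Sys
variable {s : Sys}

/-- the truncation test function -/
lemma TF_th {j : ℝ} (hj : 0 < j) : s.TF (2 * j + 1) (fun g y => s.ψ g * th j y) (fun g y => s.ψ g * bt j y) := by
  have hψ : Measurable fun x : ℝ × ℝ => s.ψ x.1 := s.ψc.measurable.comp measurable_fst
  refine ⟨by positivity, hψ.mul ((th_cont j).measurable.comp measurable_snd),
    hψ.mul ((bt_cont j).measurable.comp measurable_snd), ?_, ?_, ?_, ?_⟩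
  · intro g _ y hy
    rw [abs_mul, abs_of_nonneg (s.ψnn g), abs_of_nonneg (th_nonneg hy), mul_comm]
    exact mul_le_mul_of_nonneg_right (by linarith [th_le_two hj hy]) (s.ψnn g)
  · intro g _ y hy
    rw [abs_mul, abs_of_nonneg (s.ψnn g), abs_of_nonneg (bt_nonneg _ _), mul_comm]
    exact mul_le_mul_of_nonneg_right (by linarith [bt_le_one j y]) (s.ψnn g)
  · intro g _; exact (continuous_const.mul (th_cont j)).continuousOn
  · intro g _ y _; exact (th_deriv j y).const_mul _

lemma E_th_lower {j : ℝ} (hj : 0 < j) {v : ℝ} (hv : v ∈ Ioo 0 s.V) :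
    - (2 * s.M * s.ms v) ≤ s.E (fun g y => s.ψ g * th j y) (fun g y => s.ψ g * bt j y) v := by
  have hX := s.hX
  have pc := s.pcg v hv
  have thc : ContinuousOn (fun g => th j (s.p v g)) (Icc 0 s.X) := (th_cont j).comp_continuousOn pc
  have btc : ContinuousOn (fun g => bt j (s.p v g)) (Icc 0 s.X) := (bt_cont j).comp_continuousOn pc
  have B : ∀ y, HasDerivAt (th j) (bt j y) y := th_deriv j
  have ib := ibpP hv hX.le le_rfl le_rfl (φ := s.ψ) (φ1 := s.ψ1) (φ2 := s.ψ2)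
      (B := th j) (b := bt j) (b1 := bt1 j)
      (fun g _ => s.ψder g) s.ψc.continuousOn (fun g _ => s.ψ1der g) s.ψ1c.continuousOn s.ψ2c.continuousOn
      (th_deriv j) (bt_deriv j) (bt1_cont j)
  rw [s.ψX, s.ψ1X, s.ψ1low 0 s.hG.le, s.F0 v hv] at ib
  simp only [zero_mul, mul_zero, sub_zero, zero_sub] at ib
  have c1 : ContinuousOn (fun g => s.ψ g * bt j (s.p v g) * s.S v g) (Icc 0 s.X) :=
    (s.ψc.continuousOn.mul btc).mul (s.Sc v hv)
  have c2 : ContinuousOn (fun g => s.ψ2 g * th j (s.p v g)) (Icc 0 s.X) := s.ψ2c.continuousOn.mul thc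
  have c3 : ContinuousOn (fun g => s.r g * s.ψ g * (bt j (s.p v g) * s.p v g - th j (s.p v g))) (Icc 0 s.X) :=
    (s.rc.mul s.ψc).continuousOn.mul ((btc.mul pc).sub thc)
  have e1 : s.E (fun g y => s.ψ g * th j y) (fun g y => s.ψ g * bt j y) v =
      (∫ g in (0:ℝ)..s.X, s.ψ g * bt j (s.p v g) * s.S v g) +
      ∫ g in (0:ℝ)..s.X, s.r g * s.ψ g * (bt j (s.p v g) * s.p v g - th j (s.p v g)) := by
    rw [← intervalIntegral.integral_add (ii_of_cont c1 hX.le le_rfl le_rfl) (ii_of_cont c3 hX.le le_rfl le_rfl)]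
    unfold E Hh
    congr 1; ext g; ring
  have i0 : IntervalIntegrable (fun g => - (s.M * s.p v g)) volume 0 s.X :=
    ii_of_cont (continuousOn_const.mul pc).neg hX.le le_rfl le_rfl
  have m0 : ∫ g in (0:ℝ)..s.X, - (s.M * s.p v g) = - (s.M * s.ms v) := by
    rw [intervalIntegral.integral_neg, intervalIntegral.integral_const_mul]; rfl
  have l1 : - (s.M * s.ms v) ≤ ∫ g in (0:ℝ)..s.X, s.ψ2 g * th j (s.p v g) := by
    rw [← m0]
    refine intervalIntegral.integral_mono_on hX.le i0 (ii_of_cont c2 hX.le le_rfl le_rfl) fun g hg => ?_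
    have hp := s.pnn v g
    have h1 : |s.ψ2 g * th j (s.p v g)| ≤ s.M * s.p v g := by
      rw [abs_mul, abs_of_nonneg (th_nonneg hp)]
      exact mul_le_mul (s.ψ2M hg) (th_le hp) (th_nonneg hp) s.M0
    linarith [(abs_le.1 h1).1]
  have l2 : - (s.M * s.ms v) ≤ ∫ g in (0:ℝ)..s.X, s.r g * s.ψ g * (bt j (s.p v g) * s.p v g - th j (s.p v g)) := by
    rw [← m0]
    refine intervalIntegral.integral_mono_on hX.le i0 (ii_of_cont c3 hX.le le_rfl le_rfl) fun g hg => ?_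
    have hp := s.pnn v g
    have h1 : - s.p v g ≤ bt j (s.p v g) * s.p v g - th j (s.p v g) := by
      have := mul_nonneg (bt_nonneg j (s.p v g)) hp
      linarith [th_le (j := j) hp]
    have h2 : s.r g * s.ψ g ≤ s.M := by
      have := mul_le_mul (s.rM hg) (s.ψle g) (s.ψnn g) s.M0
      linarith
    have h3 : 0 ≤ s.r g * s.ψ g := mul_nonneg (s.rnn g hg) (s.ψnn g)
    have h4 := mul_le_mul_of_nonneg_left h1 h3
    have h5 := mul_le_mul_of_nonneg_right h2 hp
    linarith
  have l3 : ∫ g in (0:ℝ)..s.X, s.ψ g * bt1 j (s.p v g) * (s.F v g ^ 2 / s.K g) ≤ 0 := by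
    rw [← neg_nonneg, ← intervalIntegral.integral_neg]
    refine intervalIntegral.integral_nonneg hX.le fun g hg => ?_
    have h1 := bt1_nonpos hj (s.p v g)
    have h2 : 0 ≤ s.F v g ^ 2 / s.K g := div_nonneg (sq_nonneg _) (s.Kpos g).le
    have h3 : 0 ≤ s.ψ g * (- bt1 j (s.p v g)) * (s.F v g ^ 2 / s.K g) :=
      mul_nonneg (mul_nonneg (s.ψnn g) (by linarith)) h2
    linarith
  rw [e1, ib]
  linarith

theorem L10 (hR0 : ∀ g ∈ Icc 0 s.X, 0 ≤ s.R 0 g) :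
    IntegrableOn (fun g => s.R 0 g * s.p 0 g) (Ioc 0 s.X) := by
  have hX := s.hX
  have hV := s.hV
  set v1 := s.V / 2 with hv1
  have v1m : v1 ∈ Ioo 0 s.V := ⟨by positivity, by simp only [hv1]; linarith⟩
  have hb : s.base 0 v1 := L9 0 v1 le_rfl v1m.1.le v1m.2.le
  set c := s.M * s.ms v1 + ∫ v in (0:ℝ)..v1, 2 * s.M * s.ms v with hc
  have msi : IntervalIntegrable (fun v => 2 * s.M * s.ms v) volume 0 v1 :=
    ((s.ms_int).mono_set (by
      rw [uIcc_of_le v1m.1.le, uIcc_of_le hV.le]; exact Icc_subset_Icc_right v1m.2.le)).const_mul _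
  have main : ∀ j : ℝ, 0 < j → s.Φ (fun g y => s.ψ g * th j y) 0 ≤ c := by
    intro j hj
    obtain ⟨i, e⟩ := hb _ _ _ (TF_th hj) _ msi (fun v hv => E_th_lower hj ⟨hv.1, hv.2.trans v1m.2⟩)
    have h1 := intervalIntegral.integral_mono_on_of_le_Ioo v1m.1.le msi.neg i
      (fun v hv => E_th_lower hj ⟨hv.1, hv.2.trans v1m.2⟩)
    simp only [Pi.neg_apply] at h1
    rw [intervalIntegral.integral_neg] at h1
    have h2 : s.Φ (fun g y => s.ψ g * th j y) v1 ≤ s.M * s.ms v1 := by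
      unfold Φ ms
      rw [← intervalIntegral.integral_const_mul]
      refine intervalIntegral.integral_mono_on hX.le ((TF_th hj).Φint (Ioo_subset_Icc_self v1m))
        (ii_of_cont (continuousOn_const.mul (s.pcg v1 v1m)) hX.le le_rfl le_rfl) fun g hg => ?_
      have hp := s.pnn v1 g
      have h3 := (le_abs_self _).trans (s.RM hg (Ioo_subset_Icc_self v1m))
      have h4 : s.ψ g * th j (s.p v1 g) ≤ s.p v1 g := by
        have := mul_le_mul (s.ψle g) (th_le (j := j) hp) (th_nonneg hp) zero_le_one
        linarith
      have h5 : 0 ≤ s.ψ g * th j (s.p v1 g) := mul_nonneg (s.ψnn g) (th_nonneg hp)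
      exact (mul_le_mul_of_nonneg_right h3 h5).trans (mul_le_mul_of_nonneg_left h4 s.M0)
    linarith
  have m1 : Measurable fun g => s.R 0 g * s.p 0 g := (Rcontg 0).measurable.mul (pmg 0)
  have mψ : ∀ j, Measurable fun g => s.R 0 g * (s.ψ g * th j (s.p 0 g)) := fun j =>
    (Rcontg 0).measurable.mul (s.ψc.measurable.mul ((th_cont j).measurable.comp (pmg 0)))
  have I1 : IntegrableOn (fun g => s.R 0 g * (s.ψ g * s.p 0 g)) (Ioc 0 s.X) := by
    refine ⟨((Rcontg 0).measurable.mul (s.ψc.measurable.mul (pmg 0))).aestronglyMeasurable, ?_⟩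
    rw [hasFiniteIntegral_iff_ofReal ((ae_restrict_iff' measurableSet_Ioc).2 (Eventually.of_forall fun g hg =>
      mul_nonneg (hR0 g (Ioc_subset_Icc_self hg)) (mul_nonneg (s.ψnn g) (s.pnn 0 g))))]
    have fat := lintegral_liminf_le (u := atTop) (μ := volume.restrict (Ioc 0 s.X))
      (f := fun (n : ℕ) g => ENNReal.ofReal (s.R 0 g * (s.ψ g * th (n + 1) (s.p 0 g)))) (fun n => (mψ _).ennreal_ofReal)
    have eqn : ∀ g, liminf (fun n : ℕ => ENNReal.ofReal (s.R 0 g * (s.ψ g * th (n + 1) (s.p 0 g)))) atTop =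
        ENNReal.ofReal (s.R 0 g * (s.ψ g * s.p 0 g)) := by
      intro g
      refine Tendsto.liminf_eq (tendsto_const_nhds.congr' ?_)
      obtain ⟨N, hN⟩ := exists_nat_ge (s.p 0 g)
      filter_upwards [eventually_ge_atTop N] with n hn
      have : (N:ℝ) ≤ n := by exact_mod_cast hn
      rw [th_eq (by positivity) (s.pnn 0 g) (by linarith)]
    simp only [eqn] at fat
    refine fat.trans_lt (lt_of_le_of_lt (liminf_le_of_le (by isBoundedDefault) (a := ENNReal.ofReal c)
      fun b hb => ?_) ENNReal.ofReal_lt_top)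
    obtain ⟨n, hn⟩ := hb.exists
    refine hn.trans ?_
    have jp : (0:ℝ) < n + 1 := by positivity
    have hi := ((TF_th (s := s) jp).Φint (v := 0) ⟨le_rfl, hV.le⟩).1
    rw [← ofReal_integral_eq_lintegral_ofReal hi
      ((ae_restrict_iff' measurableSet_Ioc).2 (Eventually.of_forall fun g hg =>
      mul_nonneg (hR0 g (Ioc_subset_Icc_self hg)) (mul_nonneg (s.ψnn g) (th_nonneg (s.pnn 0 g)))))]
    refine ENNReal.ofReal_le_ofReal ?_
    have := main _ jp
    unfold Φ at this
    rwa [intervalIntegral.integral_of_le hX.le] at this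
  have I2 : IntegrableOn (fun _ : ℝ => s.M * s.k0) (Ioc 0 s.X) := by
    refine integrableOn_const (by simp)
  refine (I1.add I2).mono' m1.aestronglyMeasurable ((ae_restrict_iff' measurableSet_Ioc).2
    (Eventually.of_forall fun g hg => ?_))
  have hg' := Ioc_subset_Icc_self hg
  have hR := hR0 g hg'
  have hp := s.pnn 0 g
  rw [Real.norm_eq_abs, abs_of_nonneg (mul_nonneg hR hp)]
  simp only [Pi.add_apply]
  rcases le_total g s.G with h | h
  · rw [s.ψlow g h, one_mul]
    linarith [mul_nonneg s.M0 s.hk0.le]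
  · have h1 := s.pk0 0 g ⟨h, hg.2⟩
    have h2 := (le_abs_self _).trans (s.RM hg' (v := 0) ⟨le_rfl, hV.le⟩)
    have h3 := mul_le_mul h2 h1 hp s.M0
    have h4 : 0 ≤ s.R 0 g * (s.ψ g * s.p 0 g) := mul_nonneg hR (mul_nonneg (s.ψnn g) hp)
    linarith

theorem L6full (hR0 : ∀ g ∈ Icc 0 s.X, 0 ≤ s.R 0 g)
    (hRV : ∀ g ∈ Ioc 0 s.X, s.R s.V g * s.p s.V g = s.R 0 g * s.p 0 g) :
    Tendsto (fun n : ℕ => ∫ v in (0:ℝ)..s.V, s.alT (s.k0 + n) v) atTop (𝓝 0) :=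
  L6 le_rfl s.hV le_rfl (L9 0 s.V le_rfl s.hV.le le_rfl) (L10 hR0)
    ((L10 hR0).congr_fun (fun g hg => (hRV g hg).symm) measurableSet_Ioc)

end Sys
end

section

/-- truncated power functions -/
structure Bq (q L : ℝ) (β b b1 : ℝ → ℝ) : Prop where
  q1 : 1 ≤ q
  bc : Continuous b
  βd : ∀ y, HasDerivAt β (b y) y
  bd : ∀ y, 0 < y → HasDerivAt b (b1 y) y
  b1c : ContinuousOn b1 (Ioi 0)
  b1m : Measurable b1
  b1n : ∀ y, 0 < y → 0 ≤ b1 y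
  bn : ∀ y, 0 ≤ b y
  bL : ∀ y, b y ≤ L
  β0 : β 0 = 0
  βn : ∀ y, 0 ≤ y → 0 ≤ β y
  βq : ∀ y, 0 ≤ y → β y ≤ y ^ q
  bq : ∀ y, 0 ≤ y → y * b y ≤ q * y ^ q
  lam : ∀ y, 0 ≤ y → β y ≤ y * b y
  βL : ∀ y, 0 ≤ y → β y ≤ L * y

/-- weights -/
structure Wt (a σE gin gL G CB : ℝ) (w w1 w2 : ℝ → ℝ) : Prop where
  d : ∀ g, HasDerivAt w (w1 g) g
  d1 : ∀ g, HasDerivAt w1 (w2 g) g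
  c2 : Continuous w2
  nn : ∀ g, 0 ≤ g → 0 ≤ w g
  z1 : w1 0 = 0
  far : ∀ g, G ≤ g → w g = 0
  far1 : ∀ g, G ≤ g → w1 g = 0
  bd : ∀ g, 0 ≤ g → (a / σE) * |w2 g| + |w1 g| * |(g - gin) / σE| + |w1 g * ((g - gin) / σE) + w g / σE|
    + (g + gL) * w g ≤ CB * (g + gL) ^ 2

def mx (gin a g : ℝ) : ℝ := Real.exp (-(g - gin) ^ 2 / (2 * a))

lemma mx_pos (gin a g : ℝ) : 0 < mx gin a g := exp_pos _
lemma mx_der (gin : ℝ) {a : ℝ} (ha : 0 < a) (g : ℝ) : HasDerivAt (mx gin a) (-((g - gin) / a) * mx gin a g) g := by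
  have h1 : HasDerivAt (fun g => -(g - gin) ^ 2 / (2 * a)) (-((g - gin) / a)) g := by
    have := ((((hasDerivAt_id g).sub_const gin).pow 2).neg).div_const (2 * a)
    refine this.congr_deriv ?_
    simp; field_simp
  refine h1.exp.congr_deriv ?_
  unfold mx; ring
lemma mx_c (gin a : ℝ) : Continuous (mx gin a) := by unfold mx; fun_prop

namespace Sys
variable {s : Sys}
variable {a σE gin gL q L CB : ℝ} {β b b1 w w1 w2 : ℝ → ℝ}

lemma Wt.c (hw : Wt a σE gin gL s.G CB w w1 w2) : Continuous w :=
  continuous_iff_continuousAt.2 fun g => (hw.d g).continuousAt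
lemma Wt.c1 (hw : Wt a σE gin gL s.G CB w w1 w2) : Continuous w1 :=
  continuous_iff_continuousAt.2 fun g => (hw.d1 g).continuousAt
lemma Bq.βc (hB : Bq q L β b b1) : Continuous β :=
  continuous_iff_continuousAt.2 fun y => (hB.βd y).continuousAt

lemma th_pos {j y : ℝ} (hj : 0 < j) (hy : 0 < y) : 0 < th j y := by
  have h1 : th j (min y j) = min y j := th_eq hj (le_min hy.le hj.le) (min_le_right _ _)
  have h2 : th j (min y j) ≤ th j y := th_mono j (min_le_left _ _)
  have h3 : 0 < min y j := lt_min hy hj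
  linarith

/-- test functions -/
def Pw (gin a : ℝ) (w β : ℝ → ℝ) (j : ℝ) (g y : ℝ) : ℝ := w g / mx gin a g * β (mx gin a g * th j y)
def Pw' (gin a : ℝ) (w b : ℝ → ℝ) (j : ℝ) (g y : ℝ) : ℝ := w g * b (mx gin a g * th j y) * bt j y

lemma TF_Pw (hw : Wt a σE gin gL s.G CB w w1 w2) (hB : Bq q L β b b1) {j : ℝ} (hj : 0 < j) :
    ∃ C, s.TF C (Pw gin a w β j) (Pw' gin a w b j) := by
  obtain ⟨c, hc, hcb⟩ := bdd_Icc (f := w) (a := 0) (b := s.X) (Wt.c hw).continuousOn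
  have mc := mx_c gin a
  have L0 : 0 ≤ L := (hB.bn 0).trans (hB.bL 0)
  have wψ : ∀ g ∈ Icc 0 s.X, ∀ z d : ℝ, |z| ≤ d → |w g * z| ≤ (c * d) * s.ψ g := by
    intro g hg z d hz
    have hd := (abs_nonneg z).trans hz
    rcases le_total g s.G with h | h
    · rw [s.ψlow g h, mul_one, abs_mul]
      exact mul_le_mul (hcb g hg) hz (abs_nonneg _) hc
    · rw [hw.far g h, zero_mul, abs_zero]
      exact mul_nonneg (mul_nonneg hc hd) (s.ψnn g)
  have m1 : Measurable fun x : ℝ × ℝ => mx gin a x.1 * th j x.2 :=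
    (mc.measurable.comp measurable_fst).mul ((th_cont j).measurable.comp measurable_snd)
  have wm : Measurable fun x : ℝ × ℝ => w x.1 := (Wt.c hw).measurable.comp measurable_fst
  refine ⟨c * (L * (2 * j)) + c * L, by positivity, ?_, ?_, ?_, ?_, ?_, ?_⟩
  · exact (wm.div (mc.measurable.comp measurable_fst)).mul ((Bq.βc hB).measurable.comp m1)
  · exact (wm.mul (hB.bc.measurable.comp m1)).mul ((bt_cont j).measurable.comp measurable_snd)
  · intro g hg y hy
    have hm := mx_pos gin a g
    have e : Pw gin a w β j g y = w g * (β (mx gin a g * th j y) / mx gin a g) := by unfold Pw; ring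
    have t0 := th_nonneg (j := j) hy
    have h1 := hB.βL _ (mul_nonneg hm.le t0)
    have h0 := hB.βn _ (mul_nonneg hm.le t0)
    have h2 : |β (mx gin a g * th j y) / mx gin a g| ≤ L * (2 * j) := by
      rw [abs_of_nonneg (div_nonneg h0 hm.le), div_le_iff₀ hm]
      refine h1.trans ?_
      have := mul_le_mul_of_nonneg_left (th_le_two hj hy) (mul_nonneg L0 hm.le)
      linarith
    rw [e]
    refine (wψ g hg _ _ h2).trans ?_
    have := mul_nonneg (mul_nonneg hc L0) (s.ψnn g)
    linarith
  · intro g hg y hy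
    have e : Pw' gin a w b j g y = w g * (b (mx gin a g * th j y) * bt j y) := by unfold Pw'; ring
    have h2 : |b (mx gin a g * th j y) * bt j y| ≤ L := by
      rw [abs_of_nonneg (mul_nonneg (hB.bn _) (bt_nonneg _ _))]
      have := mul_le_mul (hB.bL (mx gin a g * th j y)) (bt_le_one j y) (bt_nonneg _ _) L0
      linarith
    rw [e]
    refine (wψ g hg _ _ h2).trans ?_
    have := mul_nonneg (mul_nonneg hc (mul_nonneg L0 (by positivity : 0 ≤ 2 * j))) (s.ψnn g)
    linarith
  · intro g _
    exact (continuous_const.mul ((Bq.βc hB).comp (continuous_const.mul (th_cont j)))).continuousOn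
  · intro g _ y _
    have h1 := (hB.βd (mx gin a g * th j y)).comp y ((th_deriv j y).const_mul (mx gin a g))
    refine (h1.const_mul (w g / mx gin a g)).congr_deriv ?_
    have hm := (mx_pos gin a g).ne'
    unfold Pw'; field_simp

variable (s) in
def Uj (gin a j v g : ℝ) : ℝ := mx gin a g * th j (s.p v g)
variable (s) in
def Ug (gin a j v g : ℝ) : ℝ :=
  -((g - gin) / a) * (mx gin a g * th j (s.p v g)) + mx gin a g * (bt j (s.p v g) * (s.F v g / s.K g))

set_option maxHeartbeats 1000000 in
lemma E_bound (ha : 0 < a) (hσ : 0 < σE) (hgin : 0 < gin) (hgL : 0 < gL)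
    (hK : ∀ g, s.K g = (a / σE) * mx gin a g) (hr : ∀ g, s.r g = (g + gL) * mx gin a g)
    (hw : Wt a σE gin gL s.G CB w w1 w2) (hB : Bq q L β b b1) {c : ℝ} (hcb : ∀ g ∈ Icc 0 s.X, w g ≤ c)
    {j : ℝ} (hj : 0 < j) {v : ℝ} (hv : v ∈ Ioo 0 s.V) :
    s.E (Pw gin a w β j) (Pw' gin a w b j) v +
      ∫ g in (0:ℝ)..s.X, (a / σE) * w g * b1 (s.Uj gin a j v g) * (s.Ug gin a j v g) ^ 2
    ≤ (∫ g in (0:ℝ)..s.X, CB * q * ((g + gL) ^ 2 * (mx gin a g * s.p v g) ^ q)) + c * L * s.alT j v := by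
  have hX := s.hX
  have pc := s.pcg v hv
  have L0 : 0 ≤ L := (hB.bn 0).trans (hB.bL 0)
  have c0 : 0 ≤ c := (hw.nn 0 le_rfl).trans (hcb 0 ⟨le_rfl, hX.le⟩)
  set U : ℝ → ℝ := fun g => s.Uj gin a j v g with hU
  set D : ℝ → ℝ := fun g => s.Ug gin a j v g with hD
  have mc := (mx_c gin a).continuousOn (s := Icc 0 s.X)
  have thc : ContinuousOn (fun g => th j (s.p v g)) (Icc 0 s.X) := (th_cont j).comp_continuousOn pc
  have btc : ContinuousOn (fun g => bt j (s.p v g)) (Icc 0 s.X) := (bt_cont j).comp_continuousOn pc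
  have Uc : ContinuousOn U (Icc 0 s.X) := mc.mul thc
  have Dc : ContinuousOn D (Icc 0 s.X) := by
    refine ContinuousOn.add (ContinuousOn.mul (by fun_prop) (mc.mul thc)) (mc.mul (btc.mul ((s.Fc v hv).div s.Kc.continuousOn
      (fun g _ => (s.Kpos g).ne'))))
  have Up : ∀ g ∈ Icc 0 s.X, 0 < U g := fun g hg => mul_pos (mx_pos _ _ _) (th_pos hj (s.ppos v hv g hg))
  have Ud : ∀ g ∈ Ioo 0 s.X, HasDerivAt U (D g) g := by
    intro g hg
    have h1 := (th_deriv j (s.p v g)).comp g (s.pder v hv g hg)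
    refine ((mx_der gin ha g).mul h1).congr_deriv ?_
    simp only [hD, Ug, Function.comp]; ring
  have FD : ∀ g, bt j (s.p v g) * s.F v g = (a / σE) * D g + (g - gin) / σE * U g := by
    intro g
    simp only [hD, hU, Ug, Uj]
    rw [hK g]
    have := (mx_pos gin a g).ne'
    field_simp
    ring
  set h : ℝ → ℝ := fun g => (g - gin) / σE with hh
  have hd : ∀ g, HasDerivAt h (1 / σE) g := fun g => by
    simpa using ((hasDerivAt_id g).sub_const gin).div_const σE
  have hc : Continuous h := continuous_iff_continuousAt.2 fun g => (hd g).continuousAt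
  set lm : ℝ → ℝ := fun y => y * b y - β y with hlm
  have lmd : ∀ y, 0 < y → HasDerivAt lm (y * b1 y) y := by
    intro y hy
    refine (((hasDerivAt_id y).mul (hB.bd y hy)).sub (hB.βd y)).congr_deriv ?_
    simp
  have lmc : Continuous lm := (continuous_id.mul hB.bc).sub (Bq.βc hB)
  have wc := (Wt.c hw).continuousOn (s := Icc 0 s.X)
  have w1c := (Wt.c1 hw).continuousOn (s := Icc 0 s.X)
  have w2c := hw.c2.continuousOn (s := Icc 0 s.X)
  have hcc := hc.continuousOn (s := Icc 0 s.X)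
  have bU : ContinuousOn (fun g => b (U g)) (Icc 0 s.X) := hB.bc.comp_continuousOn Uc
  have βU : ContinuousOn (fun g => β (U g)) (Icc 0 s.X) := (Bq.βc hB).comp_continuousOn Uc
  have lU : ContinuousOn (fun g => lm (U g)) (Icc 0 s.X) := lmc.comp_continuousOn Uc
  have b1U : ContinuousOn (fun g => b1 (U g)) (Icc 0 s.X) := hB.b1c.comp Uc (fun g hg => Up g hg)
  have alc : ContinuousOn (fun g => s.al j v g) (Icc 0 s.X) := al_cont hv
  -- the pieces
  set f1 : ℝ → ℝ := fun g => w g * b (U g) * bt j (s.p v g) * s.S v g with hf1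
  set f2 : ℝ → ℝ := fun g => (a / σE) * w g * b1 (U g) * D g ^ 2 with hf2
  set f3 : ℝ → ℝ := fun g => (a / σE) * w2 g * β (U g) - w1 g * h g * (U g * b (U g))
    + (w1 g * h g + w g / σE) * lm (U g) with hf3
  set f4 : ℝ → ℝ := fun g => w g * b (U g) * s.al j v g with hf4
  have f1c : ContinuousOn f1 (Icc 0 s.X) := ((wc.mul bU).mul btc).mul (s.Sc v hv)
  have f2c : ContinuousOn f2 (Icc 0 s.X) := ((continuousOn_const.mul wc).mul b1U).mul (Dc.pow 2)
  have f3c : ContinuousOn f3 (Icc 0 s.X) :=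
    ((((continuousOn_const.mul w2c).mul βU).sub ((w1c.mul hcc).mul (Uc.mul bU)))).add
      (((w1c.mul hcc).add (wc.div_const _)).mul lU)
  have f4c : ContinuousOn f4 (Icc 0 s.X) := (wc.mul bU).mul alc
  set H : ℝ → ℝ := fun g => w g * b (U g) * (bt j (s.p v g) * s.F v g) - (a / σE) * w1 g * β (U g)
    - w g * h g * lm (U g) with hH
  have Hc : ContinuousOn H (Icc 0 s.X) :=
    (((wc.mul bU).mul (btc.mul (s.Fc v hv))).sub ((continuousOn_const.mul w1c).mul βU)).sub ((wc.mul hcc).mul lU)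
  have Hd : ∀ g ∈ Ioo 0 s.X, HasDerivAt H (f1 g + f2 g - f3 g - f4 g) g := by
    intro g hg
    have hg' := Ioo_subset_Icc_self hg
    have u := Ud g hg
    have d1 := (hB.bd _ (Up g hg')).comp g u
    have d2 := (hB.βd (U g)).comp g u
    have d3 := (lmd _ (Up g hg')).comp g u
    have d4 := (bt_deriv j (s.p v g)).comp g (s.pder v hv g hg)
    have d5 := s.Fder v hv g hg
    have := ((((hw.d g).mul d1).mul (d4.mul d5)).sub (((hw.d1 g).const_mul (a / σE)).mul d2)).sub
      (((hw.d g).mul (hd g)).mul d3)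
    refine this.congr_deriv ?_
    have e := FD g
    simp only [Function.comp, hf1, hf2, hf3, hf4, hlm, al, Pi.mul_apply]
    have e1 : bt1 j (s.p v g) * (s.F v g / s.K g) * s.F v g = bt1 j (s.p v g) * (s.F v g ^ 2 / s.K g) := by ring
    have e2 : w1 g * b (U g) * (bt j (s.p v g) * s.F v g) = w1 g * b (U g) * ((a / σE) * D g + h g * U g) := by rw [e]
    have e3 : w g * (b1 (U g) * D g) * (bt j (s.p v g) * s.F v g) = w g * (b1 (U g) * D g) * ((a / σE) * D g + h g * U g) := by rw [e]
    linear_combination e2 + e3 + w g * b (U g) * e1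
  have ii : ∀ {f : ℝ → ℝ}, ContinuousOn f (Icc 0 s.X) → IntervalIntegrable f volume 0 s.X := fun hf =>
    ii_of_cont hf hX.le le_rfl le_rfl
  have ftc := intervalIntegral.integral_eq_sub_of_hasDerivAt_of_le hX.le Hc Hd
    (ii (((f1c.add f2c).sub f3c).sub f4c))
  have H0 : 0 ≤ H 0 := by
    simp only [hH, hh]
    rw [s.F0 v hv, hw.z1]
    have l0 : 0 ≤ lm (U 0) := by
      simp only [hlm]; linarith [hB.lam _ (Up 0 ⟨le_rfl, hX.le⟩).le]
    have : 0 ≤ w 0 * (gin / σE) * lm (U 0) := mul_nonneg (mul_nonneg (hw.nn 0 le_rfl) (by positivity)) l0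
    have e : w 0 * b (U 0) * (bt j (s.p v 0) * 0) - a / σE * 0 * β (U 0) - w 0 * ((0 - gin) / σE) * lm (U 0)
      = w 0 * (gin / σE) * lm (U 0) := by ring
    rw [e]; exact this
  have HX : H s.X = 0 := by
    simp only [hH]; rw [hw.far _ s.hGX.le, hw.far1 _ s.hGX.le]; ring
  have i12 : IntervalIntegrable (fun g => f1 g + f2 g) volume 0 s.X := ii (f1c.add f2c)
  have i123 : IntervalIntegrable (fun g => f1 g + f2 g - f3 g) volume 0 s.X := ii ((f1c.add f2c).sub f3c)
  rw [HX, intervalIntegral.integral_sub i123 (ii f4c),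
    intervalIntegral.integral_sub i12 (ii f3c), intervalIntegral.integral_add (ii f1c) (ii f2c)] at ftc
  set f5 : ℝ → ℝ := fun g => (g + gL) * w g * (b (U g) * (mx gin a g * (bt j (s.p v g) * s.p v g)) - β (U g)) with hf5
  have f5c : ContinuousOn f5 (Icc 0 s.X) :=
    (ContinuousOn.mul (by fun_prop) wc).mul ((bU.mul (mc.mul (btc.mul pc))).sub βU)
  have eE : s.E (Pw gin a w β j) (Pw' gin a w b j) v = (∫ g in (0:ℝ)..s.X, f1 g) + ∫ g in (0:ℝ)..s.X, f5 g := by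
    rw [← intervalIntegral.integral_add (ii f1c) (ii f5c)]
    unfold E Hh
    congr 1; ext g
    rw [hr g]
    simp only [hf1, hf5, Pw, Pw', hU, Uj]
    have := (mx_pos gin a g).ne'
    field_simp
    ring
  have qc : ContinuousOn (fun g => CB * q * ((g + gL) ^ 2 * (mx gin a g * s.p v g) ^ q)) (Icc 0 s.X) := by
    refine continuousOn_const.mul (ContinuousOn.mul (by fun_prop) ((mc.mul pc).rpow_const fun g hg => Or.inr ?_))
    linarith [hB.q1]
  have b35 : (∫ g in (0:ℝ)..s.X, f3 g) + ∫ g in (0:ℝ)..s.X, f5 g ≤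
      ∫ g in (0:ℝ)..s.X, CB * q * ((g + gL) ^ 2 * (mx gin a g * s.p v g) ^ q) := by
    rw [← intervalIntegral.integral_add (ii f3c) (ii f5c)]
    refine intervalIntegral.integral_mono_on hX.le (ii (f3c.add f5c)) (ii qc) fun g hg => ?_
    have hm := mx_pos gin a g
    have hp := s.pnn v g
    have up := (Up g hg).le
    have Uq : U g ^ q ≤ (mx gin a g * s.p v g) ^ q :=
      rpow_le_rpow up (mul_le_mul_of_nonneg_left (th_le hp) hm.le) (by linarith [hB.q1])
    set Z := (mx gin a g * s.p v g) ^ q with hZ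
    have U0 : 0 ≤ U g ^ q := rpow_nonneg up q
    have Z0 : 0 ≤ Z := U0.trans Uq
    have q1 := hB.q1
    have B1 : β (U g) ≤ q * Z := by
      have := hB.βq _ up
      have : 1 * Z ≤ q * Z := mul_le_mul_of_nonneg_right q1 Z0
      linarith
    have B0 := hB.βn _ up
    have B2 : U g * b (U g) ≤ q * Z := (hB.bq _ up).trans (mul_le_mul_of_nonneg_left Uq (by linarith))
    have B20 : 0 ≤ U g * b (U g) := mul_nonneg up (hB.bn _)
    have B3 : lm (U g) ≤ q * Z := by simp only [hlm]; linarith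
    have B30 : 0 ≤ lm (U g) := by simp only [hlm]; linarith [hB.lam _ up]
    have g0 : 0 ≤ (g + gL) * w g := mul_nonneg (by linarith [hg.1]) (hw.nn g hg.1)
    have as0 : 0 ≤ a / σE := by positivity
    have t1 : (a / σE) * w2 g * β (U g) ≤ (a / σE) * |w2 g| * (q * Z) :=
      mul_le_mul (mul_le_mul_of_nonneg_left (le_abs_self _) as0) B1 B0 (mul_nonneg as0 (abs_nonneg _))
    have t2 : - (w1 g * h g * (U g * b (U g))) ≤ |w1 g| * |h g| * (q * Z) := by
      rw [← abs_mul]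
      have h1 : - (w1 g * h g) * (U g * b (U g)) ≤ |w1 g * h g| * (q * Z) :=
        mul_le_mul (neg_le_abs _) B2 B20 (abs_nonneg _)
      linarith
    have t3 : (w1 g * h g + w g / σE) * lm (U g) ≤ |w1 g * h g + w g / σE| * (q * Z) :=
      mul_le_mul (le_abs_self _) B3 B30 (abs_nonneg _)
    have t4 : f5 g ≤ (g + gL) * w g * (q * Z) := by
      simp only [hf5]
      refine mul_le_mul_of_nonneg_left ?_ g0
      refine le_trans ?_ B3
      simp only [hlm]
      have : b (U g) * (mx gin a g * (bt j (s.p v g) * s.p v g)) ≤ b (U g) * U g :=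
        mul_le_mul_of_nonneg_left (mul_le_mul_of_nonneg_left (bt_mul_le hj hp) hm.le) (hB.bn _)
      linarith
    have t5 := mul_le_mul_of_nonneg_right (hw.bd g hg.1) (by positivity : 0 ≤ q * Z)
    have e3 : f3 g = (a / σE) * w2 g * β (U g) - w1 g * h g * (U g * b (U g))
      + (w1 g * h g + w g / σE) * lm (U g) := rfl
    have e6 : CB * (g + gL) ^ 2 * (q * Z) = CB * q * ((g + gL) ^ 2 * Z) := by ring
    have e7 : ((a / σE) * |w2 g| + |w1 g| * |(g - gin) / σE| + |w1 g * ((g - gin) / σE) + w g / σE|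
      + (g + gL) * w g) * (q * Z) = (a / σE) * |w2 g| * (q * Z) + |w1 g| * |h g| * (q * Z) +
      |w1 g * h g + w g / σE| * (q * Z) + (g + gL) * w g * (q * Z) := by simp only [hh]; ring
    rw [e6, e7] at t5
    rw [e3]
    linarith
  have b4 : ∫ g in (0:ℝ)..s.X, f4 g ≤ c * L * s.alT j v := by
    unfold alT
    rw [← intervalIntegral.integral_const_mul]
    refine intervalIntegral.integral_mono_on hX.le (ii f4c) (ii (continuousOn_const.mul alc)) fun g hg => ?_
    exact mul_le_mul_of_nonneg_right (mul_le_mul (hcb g hg) (hB.bL _) (hB.bn _) c0) (al_nonneg hj v g)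
  rw [eE]
  have : ∫ g in (0:ℝ)..s.X, f2 g = ∫ g in (0:ℝ)..s.X, (a / σE) * w g * b1 (s.Uj gin a j v g) * (s.Ug gin a j v g) ^ 2 := rfl
  rw [← this]
  linarith

end Sys
end

section
namespace Sys
variable {s : Sys}
variable {a σE gin gL q L CB : ℝ} {β b b1 w w1 w2 : ℝ → ℝ}

variable (s) in
def fD (a σE gin : ℝ) (w b1 : ℝ → ℝ) (j v g : ℝ) : ℝ :=
  (a / σE) * w g * b1 (s.Uj gin a j v g) * (s.Ug gin a j v g) ^ 2

lemma fD_cont (hw : Wt a σE gin gL s.G CB w w1 w2) (hB : Bq q L β b b1) {j : ℝ} (hj : 0 < j) {v : ℝ}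
    (hv : v ∈ Ioo 0 s.V) : ContinuousOn (s.fD a σE gin w b1 j v) (Icc 0 s.X) := by
  have pc := s.pcg v hv
  have mc := (mx_c gin a).continuousOn (s := Icc 0 s.X)
  have thc : ContinuousOn (fun g => th j (s.p v g)) (Icc 0 s.X) := (th_cont j).comp_continuousOn pc
  have btc : ContinuousOn (fun g => bt j (s.p v g)) (Icc 0 s.X) := (bt_cont j).comp_continuousOn pc
  have Uc : ContinuousOn (fun g => s.Uj gin a j v g) (Icc 0 s.X) := mc.mul thc
  have Dc : ContinuousOn (fun g => s.Ug gin a j v g) (Icc 0 s.X) := by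
    refine ContinuousOn.add (ContinuousOn.mul (by fun_prop) (mc.mul thc)) (mc.mul (btc.mul ((s.Fc v hv).div s.Kc.continuousOn
      (fun g _ => (s.Kpos g).ne'))))
  have Up : ∀ g ∈ Icc 0 s.X, 0 < s.Uj gin a j v g := fun g hg =>
    mul_pos (mx_pos _ _ _) (th_pos hj (s.ppos v hv g hg))
  exact ((continuousOn_const.mul (Wt.c hw).continuousOn).mul (hB.b1c.comp Uc (fun g hg => Up g hg))).mul (Dc.pow 2)

lemma fD_nn (ha : 0 < a) (hσ : 0 < σE) (hw : Wt a σE gin gL s.G CB w w1 w2) (hB : Bq q L β b b1) {j : ℝ} (hj : 0 < j) {v g : ℝ}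
    (hv : v ∈ Ioo 0 s.V) (hg : g ∈ Icc 0 s.X) : 0 ≤ s.fD a σE gin w b1 j v g :=
  mul_nonneg (mul_nonneg (mul_nonneg (by positivity) (hw.nn g hg.1))
    (hB.b1n _ (mul_pos (mx_pos _ _ _) (th_pos hj (s.ppos v hv g hg))))) (sq_nonneg _)

lemma fD_m (hw : Wt a σE gin gL s.G CB w w1 w2) (hB : Bq q L β b b1) (j : ℝ) :
    Measurable (fun x : ℝ × ℝ => s.fD a σE gin w b1 j x.1 x.2) := by
  have mm : Measurable fun x : ℝ × ℝ => mx gin a x.2 := (mx_c gin a).measurable.comp measurable_snd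
  have tm : Measurable fun x : ℝ × ℝ => th j (s.p x.1 x.2) := (th_cont j).measurable.comp s.pm
  have bm : Measurable fun x : ℝ × ℝ => bt j (s.p x.1 x.2) := (bt_cont j).measurable.comp s.pm
  have km : Measurable fun x : ℝ × ℝ => s.K x.2 := s.Kc.measurable.comp measurable_snd
  have wm : Measurable fun x : ℝ × ℝ => w x.2 := (Wt.c hw).measurable.comp measurable_snd
  have fm : Measurable fun x : ℝ × ℝ => s.F x.1 x.2 := s.Fm
  have um : Measurable fun x : ℝ × ℝ => s.Uj gin a j x.1 x.2 := mm.mul tm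
  have dm : Measurable fun x : ℝ × ℝ => s.Ug gin a j x.1 x.2 :=
    ((by fun_prop : Measurable fun x : ℝ × ℝ => -((x.2 - gin) / a)).mul (mm.mul tm)).add (mm.mul (bm.mul (fm.div km)))
  exact ((measurable_const.mul wm).mul (hB.b1m.comp um)).mul (dm.pow_const 2)

lemma Phi_tend (hw : Wt a σE gin gL s.G CB w w1 w2) (hB : Bq q L β b b1) {v : ℝ}
    (hR : IntegrableOn (fun g => s.R v g * s.p v g) (Ioc 0 s.X)) :
    IntervalIntegrable (fun g => s.R v g * (w g / mx gin a g * β (mx gin a g * s.p v g))) volume 0 s.X ∧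
    Tendsto (fun n : ℕ => s.Φ (Pw gin a w β (s.k0 + n)) v) atTop
      (𝓝 (∫ g in (0:ℝ)..s.X, s.R v g * (w g / mx gin a g * β (mx gin a g * s.p v g)))) := by
  obtain ⟨c, hc, hcb⟩ := bdd_Icc (f := w) (a := 0) (b := s.X) (Wt.c hw).continuousOn
  have hX := s.hX
  have L0 : 0 ≤ L := (hB.bn 0).trans (hB.bL 0)
  have mc := mx_c gin a
  have hi : IntervalIntegrable (fun g => c * L * |s.R v g * s.p v g|) volume 0 s.X := by
    rw [intervalIntegrable_iff_integrableOn_Ioc_of_le hX.le]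
    exact hR.abs.const_mul _
  have bound : ∀ g ∈ Ioc 0 s.X, ∀ t, 0 ≤ t → t ≤ s.p v g →
      |s.R v g * (w g / mx gin a g * β (mx gin a g * t))| ≤ c * L * |s.R v g * s.p v g| := by
    intro g hg t t0 tp
    have hm := mx_pos gin a g
    have hp := s.pnn v g
    have h0 := hB.βn _ (mul_nonneg hm.le t0)
    have h1 : β (mx gin a g * t) / mx gin a g ≤ L * s.p v g := by
      rw [div_le_iff₀ hm]
      refine (hB.βL _ (mul_nonneg hm.le t0)).trans ?_
      have := mul_le_mul_of_nonneg_left tp (mul_nonneg L0 hm.le)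
      linarith
    have h2 : |w g| * (β (mx gin a g * t) / mx gin a g) ≤ c * (L * s.p v g) :=
      mul_le_mul (hcb g (Ioc_subset_Icc_self hg)) h1 (div_nonneg h0 hm.le) hc
    have e : s.R v g * (w g / mx gin a g * β (mx gin a g * t)) =
      s.R v g * (w g * (β (mx gin a g * t) / mx gin a g)) := by ring
    rw [e, abs_mul, abs_mul, abs_mul, abs_of_nonneg (div_nonneg h0 hm.le), abs_of_nonneg hp]
    have := mul_le_mul_of_nonneg_left h2 (abs_nonneg (s.R v g))
    linarith
  have ms : ∀ (f : ℝ → ℝ), Measurable f → Measurable (fun g => s.R v g * (w g / mx gin a g * β (mx gin a g * f g))) :=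
    fun f hf => (Rcontg v).measurable.mul (((Wt.c hw).measurable.div mc.measurable).mul
      ((Bq.βc hB).measurable.comp (mc.measurable.mul hf)))
  constructor
  · rw [intervalIntegrable_iff_integrableOn_Ioc_of_le hX.le] at hi ⊢
    refine hi.mono' (ms _ (pmg v)).aestronglyMeasurable ((ae_restrict_iff' measurableSet_Ioc).2
      (Eventually.of_forall fun g hg => ?_))
    exact bound g hg _ (s.pnn v g) le_rfl
  · unfold Φ Pw
    refine intervalIntegral.tendsto_integral_filter_of_dominated_convergence _ ?_ ?_ hi ?_
    · exact Eventually.of_forall fun n => (ms _ ((th_cont _).measurable.comp (pmg v))).aestronglyMeasurable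
    · refine Eventually.of_forall fun n => Eventually.of_forall fun g hg => ?_
      rw [uIoc_of_le hX.le] at hg
      exact bound g hg _ (th_nonneg (s.pnn v g)) (th_le (s.pnn v g))
    · refine Eventually.of_forall fun g hg => tendsto_const_nhds.congr' ?_
      obtain ⟨N, hN⟩ := exists_nat_ge (s.p v g)
      filter_upwards [eventually_ge_atTop N] with n hn
      have h1 : (N:ℝ) ≤ n := by exact_mod_cast hn
      have h2 := s.hk0
      rw [th_eq (by positivity) (s.pnn v g) (by linarith)]

variable (s) in
def dq (gin a gL q v : ℝ) : ℝ := ∫ g in (0:ℝ)..s.X, (g + gL) ^ 2 * (mx gin a g * s.p v g) ^ q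

set_option maxHeartbeats 1000000 in
theorem L11 (ha : 0 < a) (hσ : 0 < σE) (hgin : 0 < gin) (hgL : 0 < gL)
    (hK : ∀ g, s.K g = (a / σE) * mx gin a g) (hr : ∀ g, s.r g = (g + gL) * mx gin a g)
    (hw : Wt a σE gin gL s.G CB w w1 w2) (hB : Bq q L β b b1)
    (hR0 : ∀ g ∈ Icc 0 s.X, 0 ≤ s.R 0 g)
    (hRV : ∀ g ∈ Ioc 0 s.X, s.R s.V g * s.p s.V g = s.R 0 g * s.p 0 g)
    (hbd : ∀ g ∈ Ioc 0 s.X, s.R 0 g * β (mx gin a g * s.p 0 g) ≤ s.R s.V g * β (mx gin a g * s.p s.V g))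
    (hq : IntervalIntegrable (s.dq gin a gL q) volume 0 s.V) :
    ∫⁻ x, ENNReal.ofReal ((a / σE) * w x.2 * b1 (mx gin a x.2 * s.p x.1 x.2) *
        (-((x.2 - gin) / a) * (mx gin a x.2 * s.p x.1 x.2) + mx gin a x.2 * (s.F x.1 x.2 / s.K x.2)) ^ 2)
      ∂((volume.restrict (Ioo 0 s.V)).prod (volume.restrict (Ioc 0 s.X))) ≤
    ENNReal.ofReal (CB * q * ∫ v in (0:ℝ)..s.V, s.dq gin a gL q v) := by
  have hV := s.hV
  have hX := s.hX
  obtain ⟨c, hc, hcb'⟩ := bdd_Icc (f := w) (a := 0) (b := s.X) (Wt.c hw).continuousOn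
  have hcb : ∀ g ∈ Icc 0 s.X, w g ≤ c := fun g hg => (le_abs_self _).trans (hcb' g hg)
  have L0 : 0 ≤ L := (hB.bn 0).trans (hB.bL 0)
  have jp : ∀ n : ℕ, 0 < s.k0 + n := fun n => by have := s.hk0; positivity
  have hb : s.base 0 s.V := L9 0 s.V le_rfl hV.le le_rfl
  have al0 := L6full hR0 hRV
  set al : ℕ → ℝ := fun n => ∫ v in (0:ℝ)..s.V, s.alT (s.k0 + n) v with hal
  have i0 := L10 hR0
  obtain ⟨j0, t0⟩ := Phi_tend (gin := gin) (a := a) hw hB i0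
  obtain ⟨jV, tV⟩ := Phi_tend (gin := gin) (a := a) (v := s.V) hw hB
    (i0.congr_fun (fun g hg => (hRV g hg).symm) measurableSet_Ioc)
  set A := CB * q * ∫ v in (0:ℝ)..s.V, s.dq gin a gL q v with hA
  set μ := (volume.restrict (Ioo 0 s.V)).prod (volume.restrict (Ioc 0 s.X)) with hμ
  -- bound at level n
  have lev : ∀ n : ℕ, ∫⁻ x, ENNReal.ofReal (s.fD a σE gin w b1 (s.k0 + n) x.1 x.2) ∂μ ≤
      ENNReal.ofReal (A + c * L * al n - (s.Φ (Pw gin a w β (s.k0 + n)) s.V - s.Φ (Pw gin a w β (s.k0 + n)) 0)) := by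
    intro n
    obtain ⟨C, hT⟩ := TF_Pw (s := s) hw hB (jp n)
    have ali : IntervalIntegrable (s.alT (s.k0 + n)) volume 0 s.V := alT_int le_rfl hV.le le_rfl hb (by simp)
    set e : ℝ → ℝ := fun v => CB * q * s.dq gin a gL q v + c * L * s.alT (s.k0 + n) v with he
    have ei : IntervalIntegrable e volume 0 s.V := (hq.const_mul _).add (ali.const_mul _)
    have Eb : ∀ v ∈ Ioo 0 s.V, s.E (Pw gin a w β (s.k0 + n)) (Pw' gin a w b (s.k0 + n)) v +
        ∫ g in (0:ℝ)..s.X, s.fD a σE gin w b1 (s.k0 + n) v g ≤ e v := by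
      intro v hv
      have := E_bound ha hσ hgin hgL hK hr hw hB hcb (jp n) hv
      rw [intervalIntegral.integral_const_mul] at this
      exact this
    have f0 : ∀ v ∈ Ioo 0 s.V, 0 ≤ ∫ g in (0:ℝ)..s.X, s.fD a σE gin w b1 (s.k0 + n) v g := fun v hv =>
      intervalIntegral.integral_nonneg hX.le fun g hg => fD_nn ha hσ hw hB (jp n) hv hg
    obtain ⟨Ei, Ee⟩ := hb.upper hT e ei (fun v hv => by linarith [Eb v hv, f0 v hv])
    have fm := fD_m (s := s) (a := a) (σE := σE) (gin := gin) hw hB (s.k0 + n)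
    rw [hμ, lintegral_prod _ fm.ennreal_ofReal.aemeasurable, Ee]
    have e1 : A + c * L * al n - ∫ v in (0:ℝ)..s.V, s.E (Pw gin a w β (s.k0 + n)) (Pw' gin a w b (s.k0 + n)) v =
        ∫ v in (0:ℝ)..s.V, (e v - s.E (Pw gin a w β (s.k0 + n)) (Pw' gin a w b (s.k0 + n)) v) := by
      rw [intervalIntegral.integral_sub ei Ei]
      simp only [he]
      rw [intervalIntegral.integral_add (hq.const_mul _) (ali.const_mul _), intervalIntegral.integral_const_mul,
        intervalIntegral.integral_const_mul]
    rw [e1, intervalIntegral.integral_of_le hV.le, integral_Ioc_eq_integral_Ioo]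
    have di := (intervalIntegrable_iff_integrableOn_Ioo_of_le hV.le).1 (ei.sub Ei)
    have dn : 0 ≤ᵐ[volume.restrict (Ioo 0 s.V)]
        fun v => e v - s.E (Pw gin a w β (s.k0 + n)) (Pw' gin a w b (s.k0 + n)) v :=
      (ae_restrict_iff' measurableSet_Ioo).2 (Eventually.of_forall fun v hv => by
        have h1 := Eb v hv
        have h2 := f0 v hv
        simp only [Pi.zero_apply]
        linarith)
    rw [ofReal_integral_eq_lintegral_ofReal di dn]
    refine setLIntegral_mono_ae' measurableSet_Ioo (Eventually.of_forall fun v hv => ?_)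
    have fi := (ii_of_cont (fD_cont (a := a) (σE := σE) (gin := gin) hw hB (jp n) hv) hX.le le_rfl le_rfl).1
    rw [← ofReal_integral_eq_lintegral_ofReal fi ((ae_restrict_iff' measurableSet_Ioc).2 (Eventually.of_forall fun g hg =>
      fD_nn ha hσ hw hB (jp n) hv (Ioc_subset_Icc_self hg)))]
    refine ENNReal.ofReal_le_ofReal ?_
    rw [← intervalIntegral.integral_of_le hX.le]
    linarith [Eb v hv]
  have fat := lintegral_liminf_le (u := atTop) (μ := μ)
      (f := fun (n : ℕ) (x : ℝ × ℝ) => ENNReal.ofReal (s.fD a σE gin w b1 (s.k0 + n) x.1 x.2))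
      (fun n => (fD_m hw hB _).ennreal_ofReal)
  have eqn : ∀ x : ℝ × ℝ, liminf (fun n : ℕ => ENNReal.ofReal (s.fD a σE gin w b1 (s.k0 + n) x.1 x.2)) atTop =
      ENNReal.ofReal ((a / σE) * w x.2 * b1 (mx gin a x.2 * s.p x.1 x.2) *
        (-((x.2 - gin) / a) * (mx gin a x.2 * s.p x.1 x.2) + mx gin a x.2 * (s.F x.1 x.2 / s.K x.2)) ^ 2) := by
    intro x
    refine Tendsto.liminf_eq (tendsto_const_nhds.congr' ?_)
    obtain ⟨N, hN⟩ := exists_nat_ge (s.p x.1 x.2)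
    filter_upwards [eventually_ge_atTop N] with n hn
    have h1 : (N:ℝ) ≤ n := by exact_mod_cast hn
    have h2 := s.hk0
    have h3 : s.p x.1 x.2 ≤ s.k0 + n := by linarith
    unfold fD Uj Ug
    rw [th_eq (jp n) (s.pnn _ _) h3, bt_one (jp n) h3, one_mul]
  simp only [eqn] at fat
  refine fat.trans ((liminf_le_liminf (Eventually.of_forall lev)).trans ?_)
  have lim := (ENNReal.continuous_ofReal.tendsto _).comp
    (((al0.const_mul (c * L)).const_add A).sub (tV.sub t0))
  refine (Tendsto.liminf_eq lim).le.trans ?_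
  refine ENNReal.ofReal_le_ofReal ?_
  have : ∫ g in (0:ℝ)..s.X, s.R 0 g * (w g / mx gin a g * β (mx gin a g * s.p 0 g)) ≤
      ∫ g in (0:ℝ)..s.X, s.R s.V g * (w g / mx gin a g * β (mx gin a g * s.p s.V g)) := by
    refine intervalIntegral.integral_mono_on_of_le_Ioo hX.le j0 jV fun g hg => ?_
    have := mul_le_mul_of_nonneg_left (hbd g (Ioo_subset_Ioc_self hg))
      (div_nonneg (hw.nn g hg.1.le) (mx_pos gin a g).le)
    linarith
  linarith

end Sys
end

section

def bk (q k x : ℝ) : ℝ := q * (k * |x| / (k + |x|)) ^ (q - 1)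
def bk1 (q k x : ℝ) : ℝ := q * (q - 1) * (k * |x| / (k + |x|)) ^ (q - 2) * (k / (k + |x|)) ^ 2
def βk (q k x : ℝ) : ℝ := ∫ y in (0:ℝ)..x, bk q k y

lemma fr_le {k x : ℝ} (hk : 0 < k) : k * |x| / (k + |x|) ≤ |x| := by
  have := abs_nonneg x
  rw [div_le_iff₀ (by positivity)]
  nlinarith
lemma fr_lek {k x : ℝ} (hk : 0 < k) : k * |x| / (k + |x|) ≤ k := by
  have := abs_nonneg x
  rw [div_le_iff₀ (by positivity)]
  nlinarith
lemma fr_c {k : ℝ} (hk : 0 < k) : Continuous fun x : ℝ => k * |x| / (k + |x|) := by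
  refine Continuous.div (by fun_prop) (by fun_prop) fun x => ?_
  have := abs_nonneg x; positivity
lemma fr_mono {k x y : ℝ} (hk : 0 < k) (hx : 0 ≤ x) (hxy : x ≤ y) :
    k * |x| / (k + |x|) ≤ k * |y| / (k + |y|) := by
  rw [abs_of_nonneg hx, abs_of_nonneg (hx.trans hxy)]
  have hy := hx.trans hxy
  rw [div_le_div_iff₀ (by positivity) (by positivity)]
  nlinarith [mul_le_mul_of_nonneg_left hxy (mul_pos hk hk).le]

lemma bk_c {q k : ℝ} (hq : 1 < q) (hk : 0 < k) : Continuous (bk q k) :=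
  continuous_const.mul ((fr_c hk).rpow_const fun x => Or.inr (by linarith))

lemma bk_mono {q k x y : ℝ} (hq : 1 < q) (hk : 0 < k) (hx : 0 ≤ x) (hxy : x ≤ y) : bk q k x ≤ bk q k y := by
  unfold bk
  have := abs_nonneg x
  refine mul_le_mul_of_nonneg_left (rpow_le_rpow (by positivity) (fr_mono hk hx hxy) (by linarith)) (by linarith)

lemma Bq_k {q k : ℝ} (hq : 1 < q) (hk : 0 < k) : Bq q (q * k ^ (q - 1)) (βk q k) (bk q k) (bk1 q k) := by
  have q0 : 0 < q := by linarith
  have bc := bk_c hq hk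
  have ii : ∀ x y, IntervalIntegrable (bk q k) volume x y := fun x y => bc.intervalIntegrable x y
  have bn : ∀ y, 0 ≤ bk q k y := fun y => by
    have := abs_nonneg y
    unfold bk; positivity
  have bL : ∀ y, bk q k y ≤ q * k ^ (q - 1) := fun y => by
    have := abs_nonneg y
    unfold bk
    exact mul_le_mul_of_nonneg_left (rpow_le_rpow (by positivity) (fr_lek hk) (by linarith)) q0.le
  have bx : ∀ y, 0 ≤ y → bk q k y ≤ q * y ^ (q - 1) := fun y hy => by
    have := abs_nonneg y
    unfold bk
    refine mul_le_mul_of_nonneg_left (rpow_le_rpow (by positivity) ?_ (by linarith)) q0.le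
    have := fr_le (x := y) hk
    rwa [abs_of_nonneg hy] at this ⊢
  have yq : ∀ y : ℝ, 0 ≤ y → y * y ^ (q - 1) = y ^ q := fun y hy => by
    rcases eq_or_lt_of_le hy with h | h
    · rw [← h, zero_rpow q0.ne']; simp
    · rw [rpow_sub_one h.ne']; field_simp
  refine ⟨hq.le, bc, ?_, ?_, ?_, ?_, ?_, bn, bL, by simp [βk], ?_, ?_, ?_, ?_, ?_⟩
  · intro y
    exact intervalIntegral.integral_hasDerivAt_right (ii _ _) (bc.stronglyMeasurableAtFilter _ _) bc.continuousAt
  · intro y hy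
    have h0 : 0 < k * y / (k + y) := by positivity
    have h1 : HasDerivAt (fun x => k * x / (k + x)) ((k / (k + y)) ^ 2) y := by
      have := ((hasDerivAt_id y).const_mul k).div ((hasDerivAt_id y).const_add k) (by simp; positivity)
      refine this.congr_deriv ?_
      simp only [id]
      have : k + y ≠ 0 := by positivity
      field_simp; ring
    have h2 := (h1.rpow_const (p := q - 1) (Or.inl h0.ne')).const_mul q
    have h3 : HasDerivAt (bk q k) _ y := h2.congr_of_eventuallyEq (by
      filter_upwards [lt_mem_nhds hy] with x hx
      simp only [bk]; rw [abs_of_pos hx])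
    refine h3.congr_deriv ?_
    unfold bk1
    rw [abs_of_pos hy, show q - 1 - 1 = q - 2 by ring]; ring
  · have c1 : ContinuousOn (fun x : ℝ => k / (k + |x|)) (Ioi 0) := by
      refine ContinuousOn.div (by fun_prop) (by fun_prop) fun x hx => ?_
      have := abs_nonneg x; positivity
    refine (continuousOn_const.mul ((fr_c hk).continuousOn.rpow_const fun x hx => Or.inl ?_)).mul (c1.pow 2)
    have : 0 < |x| := abs_pos.2 (ne_of_gt hx)
    positivity
  · have m1 : Measurable fun x : ℝ => |x| := measurable_id.abs
    unfold bk1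
    exact (measurable_const.mul ((fr_c hk).measurable.pow_const _)).mul
      ((measurable_const.div (measurable_const.add m1)).pow_const 2)
  · intro y hy
    have := abs_nonneg y
    have : 0 < q - 1 := by linarith
    unfold bk1; positivity
  · intro y hy
    exact intervalIntegral.integral_nonneg hy fun x _ => bn x
  · intro y hy
    have h1 : βk q k y ≤ ∫ x in (0:ℝ)..y, q * x ^ (q - 1) := by
      refine intervalIntegral.integral_mono_on hy (ii _ _) ?_ fun x hx => bx x hx.1
      exact (intervalIntegral.intervalIntegrable_rpow' (by linarith)).const_mul q
    rw [intervalIntegral.integral_const_mul, integral_rpow (Or.inl (by linarith))] at h1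
    rw [show q - 1 + 1 = q by ring, zero_rpow q0.ne', sub_zero] at h1
    have : q * (y ^ q / q) = y ^ q := by field_simp
    linarith
  · intro y hy
    have := mul_le_mul_of_nonneg_left (bx y hy) hy
    have e : y * (q * y ^ (q - 1)) = q * y ^ q := by rw [← yq y hy]; ring
    linarith
  · intro y hy
    have h1 : βk q k y ≤ ∫ x in (0:ℝ)..y, bk q k y := by
      refine intervalIntegral.integral_mono_on hy (ii _ _) (by simp) fun x hx => bk_mono hq hk hx.1 hx.2
    simpa using h1
  · intro y hy
    have h1 : βk q k y ≤ ∫ x in (0:ℝ)..y, q * k ^ (q - 1) := by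
      refine intervalIntegral.integral_mono_on hy (ii _ _) (by simp) fun x hx => bL x
    simp only [intervalIntegral.integral_const, sub_zero, smul_eq_mul] at h1
    linarith

lemma βk_star {q k : ℝ} (hq : 1 < q) (hk : 0 < k) {x y : ℝ} (hx : 0 ≤ x) (hxy : x ≤ y) :
    βk q k x * y ≤ βk q k y * x := by
  have hB := Bq_k hq hk
  have h1 := hB.lam x hx
  have bc := bk_c hq hk
  have h2 : (y - x) * bk q k x ≤ βk q k y - βk q k x := by
    have e : βk q k y - βk q k x = ∫ t in x..y, bk q k t := by
      unfold βk
      rw [intervalIntegral.integral_interval_sub_left (bc.intervalIntegrable _ _) (bc.intervalIntegrable _ _)]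
    rw [e]
    have : ∫ t in x..y, bk q k x ≤ ∫ t in x..y, bk q k t :=
      intervalIntegral.integral_mono_on hxy (by simp) (bc.intervalIntegrable _ _) fun t ht => bk_mono hq hk hx ht.1
    simpa using this
  have h3 := mul_le_mul_of_nonneg_left h2 hx
  have h4 := mul_le_mul_of_nonneg_right h1 (sub_nonneg.2 hxy)
  linarith

/-- the boundary inequality -/
lemma bdry_ineq {q k A B x y : ℝ} (hq : 1 < q) (hk : 0 < k) (hx : 0 ≤ x) (hy : 0 ≤ y) (hB : 0 ≤ B) (hBA : B ≤ A)
    (h : B * y = A * x) : A * βk q k x ≤ B * βk q k y := by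
  have hq' := Bq_k hq hk
  rcases eq_or_lt_of_le (hB.trans hBA) with hA | hA
  · have : B = 0 := by linarith
    rw [← hA, this]; simp
  have hxy : x ≤ y := by
    have : A * x ≤ A * y := by rw [← h]; exact mul_le_mul_of_nonneg_right hBA hy
    exact le_of_mul_le_mul_left this hA
  rcases eq_or_lt_of_le hy with h0 | h0
  · have : x = 0 := le_antisymm (h0 ▸ hxy) hx
    rw [this, ← h0, hq'.β0]; simp
  have h1 := mul_le_mul_of_nonneg_left (βk_star hq hk hx hxy) hA.le
  have : (A * βk q k x) * y ≤ (B * βk q k y) * y := by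
    have : A * (βk q k y * x) = βk q k y * (B * y) := by rw [h]; ring
    linarith
  exact le_of_mul_le_mul_right this h0

def chi2 (x : ℝ) : ℝ := deriv chi1 x
lemma chi1_cd : ContDiff ℝ 1 chi1 := by
  have h : ContDiff ℝ (1 + 1) chi := by
    have := chi_cd
    norm_num; exact this
  exact (contDiff_succ_iff_deriv.1 h).2.2
lemma chi1_deriv (x : ℝ) : HasDerivAt chi1 (chi2 x) x :=
  (chi1_cd.differentiable (by norm_num) x).hasDerivAt
lemma chi2_cont : Continuous chi2 := chi1_cd.continuous_deriv (by norm_num)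
lemma chi2_high {x : ℝ} (h : 2 ≤ x) : chi2 x = 0 := by
  have h1 : HasDerivWithinAt chi1 (chi2 x) (Ici x) x := (chi1_deriv x).hasDerivWithinAt
  have h2 : HasDerivWithinAt chi1 0 (Ici x) x :=
    (hasDerivWithinAt_const x (Ici x) (0:ℝ)).congr (fun y hy => chi1_high (le_trans h hy)) (chi1_high h)
  exact (uniqueDiffWithinAt_Ici x).eq_deriv _ h1 h2
lemma chi2_bdd : ∃ c : ℝ, 0 ≤ c ∧ ∀ x, 0 ≤ x → |chi2 x| ≤ c := by
  obtain ⟨c, hc⟩ := (isCompact_Icc (a := (0:ℝ)) (b := 2)).exists_bound_of_continuousOn chi2_cont.continuousOn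
  refine ⟨max c 0, le_max_right _ _, fun x hx => ?_⟩
  rcases le_total x 2 with h | h
  · exact (hc x ⟨hx, h⟩).trans (le_max_left _ _)
  · rw [chi2_high h]; simp

def wR (R g : ℝ) : ℝ := (g + exp (-g)) * chi (g / R)
def wR1 (R g : ℝ) : ℝ := (1 - exp (-g)) * chi (g / R) + (g + exp (-g)) * (chi1 (g / R) / R)
def wR2 (R g : ℝ) : ℝ := exp (-g) * chi (g / R) + 2 * ((1 - exp (-g)) * (chi1 (g / R) / R)) +
  (g + exp (-g)) * (chi2 (g / R) / R / R)

lemma exp_der (g : ℝ) : HasDerivAt (fun g => exp (-g)) (-exp (-g)) g := by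
  simpa using (hasDerivAt_neg g).exp

lemma exists_Wt {a σE gin gL : ℝ} (ha : 0 < a) (hσ : 0 < σE) (hgin : 0 < gin) (hgL : 0 < gL) :
    ∃ CB : ℝ, 0 ≤ CB ∧ ∀ R G : ℝ, 1 ≤ R → 2 * R ≤ G → Wt a σE gin gL G CB (wR R) (wR1 R) (wR2 R) := by
  obtain ⟨c1, n1, h1⟩ := chi1_bdd
  obtain ⟨c2, n2, h2⟩ := chi2_bdd
  set κ := 1 + 1 / gL + gin / gL with hκ
  have κ1 : 1 ≤ κ := by
    have : 0 ≤ 1 / gL + gin / gL := by positivity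
    linarith
  set A1 := 1 + 3 * c1 with hA1
  set A2 := 1 + 2 * c1 + 3 * c2 with hA2
  have A10 : 0 ≤ A1 := by positivity
  have A20 : 0 ≤ A2 := by positivity
  refine ⟨(a / σE) * A2 * κ ^ 2 + A1 * (κ / σE) * κ + (A1 * (κ / σE) * κ + κ / σE * κ) + κ, by positivity, fun R G hR hG => ?_⟩
  have R0 : 0 < R := by linarith
  have dR : ∀ g, HasDerivAt (fun g => g / R) (1 / R) g := fun g => (hasDerivAt_id g).div_const R
  have ud : ∀ g : ℝ, HasDerivAt (fun g => g + exp (-g)) (1 - exp (-g)) g := fun g => by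
    have h := (hasDerivAt_id' g).add (exp_der g)
    exact h.congr_deriv (by ring)
  have u1d : ∀ g : ℝ, HasDerivAt (fun g => 1 - exp (-g)) (exp (-g)) g := fun g => by
    simpa using (exp_der g).const_sub 1
  have cd : ∀ g, HasDerivAt (fun g => chi (g / R)) (chi1 (g / R) / R) g := fun g => by
    have h := HasDerivAt.comp (h₂ := chi) (h := fun g => g / R) g (chi_deriv (g / R)) (dR g)
    exact HasDerivAt.congr_deriv h (by ring)
  have c1d : ∀ g, HasDerivAt (fun g => chi1 (g / R) / R) (chi2 (g / R) / R / R) g := fun g => by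
    have h := (HasDerivAt.comp (h₂ := chi1) (h := fun g => g / R) g (chi1_deriv (g / R)) (dR g)).div_const R
    exact HasDerivAt.congr_deriv h (by ring)
  have far : ∀ g, G ≤ g → 2 ≤ g / R := fun g hg => by rw [le_div_iff₀ R0]; linarith
  refine ⟨?_, ?_, ?_, ?_, ?_, ?_, ?_, ?_⟩
  · intro g; exact (ud g).mul (cd g)
  · intro g
    refine (((u1d g).mul (cd g)).add ((ud g).mul (c1d g))).congr_deriv ?_
    unfold wR2; ring
  · have e1 : Continuous fun g => chi (g / R) := chi_cont.comp (by fun_prop)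
    have e2 : Continuous fun g => chi1 (g / R) := chi1_cont.comp (by fun_prop)
    have e3 : Continuous fun g => chi2 (g / R) := chi2_cont.comp (by fun_prop)
    unfold wR2
    fun_prop
  · intro g hg
    exact mul_nonneg (by have := exp_pos (-g); linarith) (chi_nonneg _)
  · simp [wR1, chi1_low]
  · intro g hg; unfold wR; rw [chi_zero (far g hg)]; simp
  · intro g hg; unfold wR1; rw [chi_zero (far g hg), chi1_high (far g hg)]; simp
  · intro g hg
    set t := g + gL with ht
    have t0 : 0 < t := by linarith
    have e0 := exp_pos (-g)
    have e1 : exp (-g) ≤ 1 := exp_le_one_iff.2 (by linarith)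
    have x0 := chi_nonneg (g / R)
    have x1 := chi_le_one (g / R)
    have gR : 0 ≤ g / R := by positivity
    have tk1 : 1 ≤ κ * t := by
      have h1 : 1 ≤ (1 / gL) * t := by
        rw [ht]; have : 1 / gL * (g + gL) = g / gL + 1 := by field_simp
        rw [this]; have : 0 ≤ g / gL := by positivity
        linarith
      have h2 : (1 / gL) * t ≤ κ * t := mul_le_mul_of_nonneg_right (by
        have : 0 ≤ gin / gL := by positivity
        linarith) t0.le
      linarith
    have tkg : g + 1 ≤ κ * t := by
      have h1 : κ * t = t + (1 / gL) * t + (gin / gL) * t := by rw [hκ]; ring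
      have h2 : (1 / gL) * t = g / gL + 1 := by rw [ht]; field_simp
      have : 0 ≤ g / gL := by positivity
      have : 0 ≤ (gin / gL) * t := by positivity
      linarith
    have tkh : |g - gin| ≤ κ * t := by
      have h1 : κ * t = t + (1 / gL) * t + (gin / gL) * t := by rw [hκ]; ring
      have h2 : (gin / gL) * t = gin * g / gL + gin := by rw [ht]; field_simp
      have : 0 ≤ gin * g / gL := by positivity
      have : 0 ≤ (1 / gL) * t := by positivity
      rw [abs_le]; constructor <;> linarith
    have hhb : |(g - gin) / σE| ≤ κ / σE * t := by
      rw [abs_div, abs_of_pos hσ]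
      calc |g - gin| / σE ≤ κ * t / σE := by gcongr
        _ = _ := by ring
    have u0 : 0 ≤ g + exp (-g) := by linarith
    have wle : wR R g ≤ κ * t := by
      unfold wR
      have := mul_le_mul (by linarith : g + exp (-g) ≤ g + 1) x1 x0 (by linarith)
      linarith
    have w0 : 0 ≤ wR R g := mul_nonneg u0 x0
    have prod : ∀ z c : ℝ, |z| ≤ c → (2 * R ≤ g → z = 0) → |(g + exp (-g)) * (z / R)| ≤ 3 * c := by
      intro z c hz hz0
      have c0 := (abs_nonneg z).trans hz
      rcases le_total (2 * R) g with h | h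
      · rw [hz0 h]; simp; positivity
      · have e : (g + exp (-g)) * (z / R) = ((g + exp (-g)) / R) * z := by ring
        have : (g + exp (-g)) / R ≤ 3 := by rw [div_le_iff₀ R0]; linarith
        rw [e, abs_mul, abs_of_nonneg (by positivity)]
        exact mul_le_mul this hz (abs_nonneg _) (by norm_num)
    have zR : ∀ z c : ℝ, |z| ≤ c → |z / R| ≤ c := by
      intro z c hz
      rw [abs_div, abs_of_pos R0, div_le_iff₀ R0]
      have c0 := (abs_nonneg z).trans hz
      have := mul_le_mul_of_nonneg_left hR c0
      linarith
    have f2 : 2 * R ≤ g → 2 ≤ g / R := fun h => by rw [le_div_iff₀ R0]; linarith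
    have b1 : |wR1 R g| ≤ A1 := by
      unfold wR1
      refine (abs_add_le _ _).trans ?_
      have p1 := prod _ _ (h1 (g / R)) (fun h => chi1_high (f2 h))
      have p2 : |(1 - exp (-g)) * chi (g / R)| ≤ 1 := by
        rw [abs_of_nonneg (mul_nonneg (by linarith) x0)]
        have := mul_le_mul (by linarith : 1 - exp (-g) ≤ 1) x1 x0 (by norm_num)
        linarith
      rw [hA1]; linarith
    have b2 : |wR2 R g| ≤ A2 := by
      unfold wR2
      refine (abs_add_le _ _).trans ?_
      have p0 := abs_add_le (exp (-g) * chi (g / R)) (2 * ((1 - exp (-g)) * (chi1 (g / R) / R)))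
      have p1 := prod _ _ (zR _ _ (h2 (g / R) gR)) (fun h => by rw [chi2_high (f2 h)]; simp)
      have p2 : |exp (-g) * chi (g / R)| ≤ 1 := by
        rw [abs_of_nonneg (mul_nonneg e0.le x0)]
        have := mul_le_mul e1 x1 x0 (by norm_num)
        linarith
      have p3 : |2 * ((1 - exp (-g)) * (chi1 (g / R) / R))| ≤ 2 * c1 := by
        rw [abs_mul, abs_mul, abs_of_pos (by norm_num : (0:ℝ) < 2), abs_of_nonneg (by linarith : 0 ≤ 1 - exp (-g))]
        have := mul_le_mul (by linarith : 1 - exp (-g) ≤ 1) (zR _ _ (h1 (g / R))) (abs_nonneg _) (by norm_num)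
        linarith
      rw [hA2]; linarith
    have as0 : 0 ≤ a / σE := by positivity
    have T1 : (a / σE) * |wR2 R g| ≤ (a / σE) * A2 * κ ^ 2 * t ^ 2 := by
      have : 1 ≤ (κ * t) ^ 2 := one_le_pow₀ tk1
      calc (a / σE) * |wR2 R g| ≤ (a / σE) * A2 * 1 := by rw [mul_one]; gcongr
        _ ≤ (a / σE) * A2 * (κ * t) ^ 2 := by gcongr
        _ = _ := by ring
    have T2 : |wR1 R g| * |(g - gin) / σE| ≤ A1 * (κ / σE) * κ * t ^ 2 := by
      calc |wR1 R g| * |(g - gin) / σE| ≤ A1 * (κ / σE * t) := by gcongr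
        _ = A1 * (κ / σE * t) * 1 := by ring
        _ ≤ A1 * (κ / σE * t) * (κ * t) := by gcongr
        _ = _ := by ring
    have T3 : |wR1 R g * ((g - gin) / σE) + wR R g / σE| ≤ (A1 * (κ / σE) * κ + κ / σE * κ) * t ^ 2 := by
      refine (abs_add_le _ _).trans ?_
      rw [abs_mul, abs_of_nonneg (div_nonneg w0 hσ.le)]
      have : wR R g / σE ≤ κ / σE * κ * t ^ 2 := by
        calc wR R g / σE ≤ κ * t / σE := by gcongr
          _ = κ * t / σE * 1 := by ring
          _ ≤ κ * t / σE * (κ * t) := by gcongr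
          _ = _ := by ring
      linarith
    have T4 : t * wR R g ≤ κ * t ^ 2 := by
      have := mul_le_mul_of_nonneg_left wle t0.le
      linarith
    linarith

end

section

lemma chi2_low {x : ℝ} (h : x ≤ 1) : chi2 x = 0 := by
  have h1 : HasDerivWithinAt chi1 (chi2 x) (Iic x) x := (chi1_deriv x).hasDerivWithinAt
  have h2 : HasDerivWithinAt chi1 0 (Iic x) x :=
    (hasDerivWithinAt_const x (Iic x) (0:ℝ)).congr (fun y hy => chi1_low (le_trans hy h)) (chi1_low h)
  exact (uniqueDiffWithinAt_Iic x).eq_deriv _ h1 h2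

/-- clamping -/
def clm (V v : ℝ) : ℝ := max 0 (min v V)
lemma clm_c (V : ℝ) : Continuous (clm V) := by unfold clm; fun_prop
lemma clm_mem {V : ℝ} (hV : 0 < V) (v : ℝ) : clm V v ∈ Icc 0 V :=
  ⟨le_max_left _ _, max_le hV.le (min_le_right _ _)⟩
lemma clm_eq {V v : ℝ} (hv : v ∈ Icc 0 V) : clm V v = v := by
  unfold clm; rw [min_eq_left hv.2, max_eq_right hv.1]

/-- clamped density -/
def pc (V : ℝ) (p : ℝ → ℝ → ℝ) (v g : ℝ) : ℝ := p (clm V v) (max g 0)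

/-- one-sided `g`-derivative, extended by zero -/
def dg (V : ℝ) (f : ℝ → ℝ → ℝ) (v g : ℝ) : ℝ :=
  ((Ioo 0 V ×ˢ Ici (0:ℝ)).indicator (fun x : ℝ × ℝ => derivWithin (f x.1) (Ici 0) x.2)) (v, g)

lemma dg_eq {V v g : ℝ} (f : ℝ → ℝ → ℝ) (hv : v ∈ Ioo 0 V) (hg : 0 ≤ g) :
    dg V f v g = derivWithin (f v) (Ici 0) g := by
  unfold dg; rw [indicator_of_mem (by exact ⟨hv, hg⟩)]

lemma dg_meas {V : ℝ} {f : ℝ → ℝ → ℝ} (hf : Measurable (Function.uncurry f))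
    (hd : ∀ v ∈ Ioo 0 V, DifferentiableOn ℝ (f v) (Ici 0)) : Measurable (Function.uncurry (dg V f)) := by
  have hD : MeasurableSet (Ioo 0 V ×ˢ Ici (0:ℝ)) := measurableSet_Ioo.prod measurableSet_Ici
  refine measurable_of_tendsto_metrizable (f := fun (n : ℕ) => (Ioo 0 V ×ˢ Ici (0:ℝ)).indicator
    (fun x : ℝ × ℝ => (1 / ((n:ℝ) + 1))⁻¹ * (f x.1 (x.2 + 1 / ((n:ℝ) + 1)) - f x.1 x.2))) (fun n => ?_) ?_
  · refine Measurable.indicator ?_ hD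
    refine Measurable.const_mul (Measurable.sub ?_ hf) _
    exact hf.comp (measurable_fst.prodMk (measurable_snd.add_const _))
  · rw [tendsto_pi_nhds]
    rintro ⟨v, g⟩
    by_cases h : (v, g) ∈ (Ioo 0 V ×ˢ Ici (0:ℝ))
    · simp only [Function.uncurry, indicator_of_mem h, dg]
      have h1 := ((hd v h.1) g h.2).hasDerivWithinAt
      rw [hasDerivWithinAt_iff_tendsto_slope] at h1
      have h2 : Tendsto (fun n : ℕ => g + 1 / ((n:ℝ) + 1)) atTop (𝓝[Ici 0 \ {g}] g) := by
        refine tendsto_nhdsWithin_iff.2 ⟨?_, Eventually.of_forall fun n => ?_⟩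
        · simpa using tendsto_one_div_add_atTop_nhds_zero_nat.const_add g
        · have : 0 < 1 / ((n:ℝ) + 1) := by positivity
          refine ⟨?_, ?_⟩
          · have : (0:ℝ) ≤ g := h.2
            simp only [mem_Ici]; linarith
          · simp only [mem_singleton_iff]; linarith
      refine (h1.comp h2).congr fun n => ?_
      simp [slope]
    · simp only [Function.uncurry, indicator_of_notMem h, dg]
      exact tendsto_const_nhds

section
variable {VF VE gL gin a σE : ℝ} {p : ℝ → ℝ → ℝ}

lemma pc_eq {v g : ℝ} (hv : v ∈ Icc 0 VF) (hg : 0 ≤ g) : pc VF p v g = p v g := by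
  unfold pc; rw [clm_eq hv, max_eq_left hg]

lemma pc_cv (hVF : 0 < VF) (h : StatSol VF VE gL gin a σE p) (g : ℝ) : Continuous fun v => pc VF p v g := by
  have h1 := h.cont_v (max g 0) (mem_Ici.2 (le_max_right _ _))
  exact h1.comp_continuous (clm_c VF) (fun v => clm_mem hVF v)

lemma pc_closed (hVF : 0 < VF) (h : StatSol VF VE gL gin a σE p) {g : ℝ} (P : Set ℝ) (hP : IsClosed P)
    (hc : ∀ v ∈ Ioo 0 VF, pc VF p v g ∈ P) (v : ℝ) : pc VF p v g ∈ P := by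
  have h1 : closure (Ioo 0 VF) ⊆ (fun v => pc VF p v g) ⁻¹' P :=
    closure_minimal hc (hP.preimage (pc_cv hVF h g))
  rw [closure_Ioo hVF.ne] at h1
  have h2 := h1 (clm_mem hVF v)
  have h3 : pc VF p (clm VF v) g = pc VF p v g := by
    unfold pc; rw [clm_eq (clm_mem hVF v)]
  simpa [h3] using h2

lemma pc_nn (hVF : 0 < VF) (h : StatSol VF VE gL gin a σE p) (v g : ℝ) : 0 ≤ pc VF p v g := by
  refine pc_closed hVF h (Ici 0) isClosed_Ici (fun v hv => ?_) v
  unfold pc; rw [clm_eq (Ioo_subset_Icc_self hv)]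
  exact h.nonneg v hv _ (mem_Ici.2 (le_max_right _ _))

lemma pc_cd (h : StatSol VF VE gL gin a σE p) {v : ℝ} (hv : v ∈ Ioo 0 VF) :
    ContDiffOn ℝ 2 (pc VF p v) (Ici 0) :=
  (h.smooth_g v hv).congr fun g hg => pc_eq (Ioo_subset_Icc_self hv) hg

lemma pc_m (hVF : 0 < VF) (h : StatSol VF VE gL gin a σE p) : Measurable (Function.uncurry (pc VF p)) := by
  have h1 : ∀ v ∈ Ioo 0 VF, Measurable (pc VF p v) := fun v hv => by
    have h2 : Continuous (pc VF p v) := by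
      have h3 : pc VF p v = fun g => p v (max g 0) := by
        funext g; unfold pc; rw [clm_eq (Ioo_subset_Icc_self hv)]
      rw [h3]
      exact (h.smooth_g v hv).continuousOn.comp_continuous (by fun_prop) (fun g => mem_Ici.2 (le_max_right _ _))
    exact h2.measurable
  refine measurable_uncurry_of_continuous_of_measurable (pc_cv hVF h) (fun v => ?_)
  have h2 : ∃ u : ℕ → ℝ, (∀ n, u n ∈ Ioo 0 VF) ∧ Tendsto u atTop (𝓝 (clm VF v)) := by
    have : clm VF v ∈ closure (Ioo 0 VF) := by rw [closure_Ioo hVF.ne]; exact clm_mem hVF v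
    exact mem_closure_iff_seq_limit.1 this
  obtain ⟨u, hu, hu2⟩ := h2
  refine measurable_of_tendsto_metrizable (f := fun n => pc VF p (u n)) (fun n => h1 _ (hu n)) ?_
  rw [tendsto_pi_nhds]
  intro g
  have h3 := ((pc_cv hVF h g).tendsto (clm VF v)).comp hu2
  have h4 : pc VF p (clm VF v) g = pc VF p v g := by
    unfold pc; rw [clm_eq (clm_mem hVF v)]
  rw [h4] at h3
  exact h3

/-- `∂_g p` -/
def pg (VF : ℝ) (p : ℝ → ℝ → ℝ) : ℝ → ℝ → ℝ := dg VF (pc VF p)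

lemma pg_m (hVF : 0 < VF) (h : StatSol VF VE gL gin a σE p) : Measurable (Function.uncurry (pg VF p)) :=
  dg_meas (pc_m hVF h) fun v hv => (pc_cd h hv).differentiableOn (by norm_num)

lemma pg_cd (h : StatSol VF VE gL gin a σE p) {v : ℝ} (hv : v ∈ Ioo 0 VF) :
    ContDiffOn ℝ 1 (pg VF p v) (Ici 0) :=
  ((pc_cd h hv).derivWithin (uniqueDiffOn_Ici 0) (by norm_num)).congr fun g hg => dg_eq _ hv hg

lemma pc_ev {v g : ℝ} (hv : v ∈ Ioo 0 VF) (hg : 0 < g) : pc VF p v =ᶠ[𝓝 g] p v := by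
  filter_upwards [lt_mem_nhds hg] with y hy
  exact pc_eq (Ioo_subset_Icc_self hv) hy.le

lemma pc_der (h : StatSol VF VE gL gin a σE p) {v g : ℝ} (hv : v ∈ Ioo 0 VF) (hg : 0 < g) :
    HasDerivAt (pc VF p v) (pg VF p v g) g := by
  have h1 := ((pc_cd h hv).differentiableOn (by norm_num) g hg.le).hasDerivWithinAt
  have h2 := h1.hasDerivAt (Ici_mem_nhds hg)
  rwa [← dg_eq (V := VF) _ hv hg.le] at h2

lemma p_der (h : StatSol VF VE gL gin a σE p) {v g : ℝ} (hv : v ∈ Ioo 0 VF) (hg : 0 < g) :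
    HasDerivAt (p v) (pg VF p v g) g :=
  (pc_der h hv hg).congr_of_eventuallyEq (pc_ev hv hg).symm

lemma pg_der (h : StatSol VF VE gL gin a σE p) {v g : ℝ} (hv : v ∈ Ioo 0 VF) (hg : 0 < g) :
    HasDerivAt (pg VF p v) (deriv (deriv (fun g' => p v g')) g) g := by
  have h1 := ((pg_cd h hv).differentiableOn (by norm_num) g hg.le).hasDerivWithinAt.hasDerivAt (Ici_mem_nhds hg)
  have h2 : deriv (fun g' => p v g') =ᶠ[𝓝 g] pg VF p v := by
    filter_upwards [lt_mem_nhds hg] with y hy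
    exact (p_der h hv hy).deriv
  have h3 := h1.congr_of_eventuallyEq h2
  rw [h3.deriv]; exact h1

/-- flux in `g` -/
def Ff (VF gin a σE : ℝ) (p : ℝ → ℝ → ℝ) (v g : ℝ) : ℝ :=
  (a / σE) * pg VF p v g + ((g - gin) / σE) * pc VF p v g

lemma Ff_cd (h : StatSol VF VE gL gin a σE p) {v : ℝ} (hv : v ∈ Ioo 0 VF) :
    ContDiffOn ℝ 1 (Ff VF gin a σE p v) (Ici 0) := by
  have h1 := pg_cd h hv
  have h2 := (pc_cd h hv).of_le (m := 1) (by norm_num)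
  have h3 : ContDiffOn ℝ 1 (fun g => (g - gin) / σE) (Ici 0) :=
    (ContDiff.contDiffOn (by fun_prop))
  exact (contDiffOn_const.mul h1).add (h3.mul h2)

lemma Ff_m (hVF : 0 < VF) (h : StatSol VF VE gL gin a σE p) : Measurable (Function.uncurry (Ff VF gin a σE p)) := by
  have h1 := pg_m hVF h
  have h2 := pc_m hVF h
  have h3 : Measurable fun x : ℝ × ℝ => (x.2 - gin) / σE := by fun_prop
  exact (h1.const_mul _).add (h3.mul h2)

lemma Ff_0 (hgin : 0 < gin) (h : StatSol VF VE gL gin a σE p)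
    {v : ℝ} (hv : v ∈ Ioo 0 VF) (hp : 0 < p v 0) : Ff VF gin a σE p v 0 = 0 := by
  have h1 := h.bc_g v hv
  have h2 : deriv (fun g' => p v g') 0 ≠ 0 := fun h0 => by
    rw [h0] at h1
    have := mul_pos hgin hp
    linarith
  have h3 := (differentiableAt_of_deriv_ne_zero h2).hasDerivAt
  have h4 : HasDerivWithinAt (pc VF p v) (deriv (fun g' => p v g') 0) (Ici 0) 0 :=
    h3.hasDerivWithinAt.congr (fun g hg => pc_eq (Ioo_subset_Icc_self hv) hg) (pc_eq (Ioo_subset_Icc_self hv) le_rfl)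
  have h5 : pg VF p v 0 = deriv (fun g' => p v g') 0 := by
    unfold pg; rw [dg_eq _ hv le_rfl]
    exact h4.derivWithin (uniqueDiffOn_Ici 0 0 (by simp))
  unfold Ff
  rw [h5, pc_eq (Ioo_subset_Icc_self hv) le_rfl]
  have : a / σE * deriv (fun g' => p v g') 0 + (0 - gin) / σE * p v 0 =
    ((0 - gin) * p v 0 + a * deriv (fun g' => p v g') 0) / σE := by ring
  rw [this, h1]; simp

/-- `∂_g` of the flux -/
def Sf (VF gin a σE : ℝ) (p : ℝ → ℝ → ℝ) : ℝ → ℝ → ℝ := dg VF (Ff VF gin a σE p)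

lemma Sf_m (hVF : 0 < VF) (h : StatSol VF VE gL gin a σE p) : Measurable (Function.uncurry (Sf VF gin a σE p)) :=
  dg_meas (Ff_m hVF h) fun v hv => (Ff_cd h hv).differentiableOn (by norm_num)

lemma Sf_c (h : StatSol VF VE gL gin a σE p) {v : ℝ} (hv : v ∈ Ioo 0 VF) :
    ContinuousOn (Sf VF gin a σE p v) (Ici 0) :=
  ((Ff_cd h hv).continuousOn_derivWithin (uniqueDiffOn_Ici 0) (by norm_num)).congr fun g hg => dg_eq _ hv hg

lemma Ff_der (h : StatSol VF VE gL gin a σE p) {v g : ℝ} (hv : v ∈ Ioo 0 VF) (hg : 0 < g) :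
    HasDerivAt (Ff VF gin a σE p v) (Sf VF gin a σE p v g) g := by
  have h1 := ((Ff_cd h hv).differentiableOn (by norm_num) g hg.le).hasDerivWithinAt
  have h2 := h1.hasDerivAt (Ici_mem_nhds hg)
  rwa [← dg_eq (V := VF) _ hv hg.le] at h2

lemma pv_der (h : StatSol VF VE gL gin a σE p) {v g : ℝ} (hv : v ∈ Ioo 0 VF) (hg : 0 < g) :
    HasDerivAt (fun v => pc VF p v g) (deriv (fun v' => p v' g) v) v := by
  refine (h.diff_v v hv g hg).hasDerivAt.congr_of_eventuallyEq ?_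
  filter_upwards [Ioo_mem_nhds hv.1 hv.2] with y hy
  exact pc_eq (Ioo_subset_Icc_self hy) hg.le

lemma p_eqn (h : StatSol VF VE gL gin a σE p) {v g : ℝ} (hv : v ∈ Ioo 0 VF) (hg : 0 < g) :
    Jflux VE gL v g * deriv (fun v' => p v' g) v = Sf VF gin a σE p v g + (g + gL) * pc VF p v g := by
  have h1 := h.pde v hv g hg
  have hJ : HasDerivAt (fun v' => Jflux VE gL v' g) (-(g + gL)) v := by
    have h2 := (hasDerivAt_id' v).const_mul (-gL)
    have h3 := ((hasDerivAt_id' v).const_sub VE).const_mul g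
    exact (h2.add h3).congr_deriv (by ring)
  have e1 := (hJ.mul (h.diff_v v hv g hg).hasDerivAt).deriv
  have e2 : HasDerivAt (fun g' => ((gin - g') / σE) * p v g') (-1 / σE * p v g + (gin - g) / σE * pg VF p v g) g :=
    (((hasDerivAt_id' g).const_sub gin).div_const σE).mul (p_der h hv hg)
  have hS : Sf VF gin a σE p v g = (a / σE) * deriv (deriv (fun g' => p v g')) g +
      (1 / σE * pc VF p v g + (g - gin) / σE * pg VF p v g) := by
    refine (Ff_der h hv hg).unique ?_
    exact ((pg_der h hv hg).const_mul _).add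
      ((((hasDerivAt_id' g).sub_const gin).div_const σE).mul (pc_der h hv hg))
  have e1' : deriv (fun v' => Jflux VE gL v' g * p v' g) v =
    -(g + gL) * p v g + Jflux VE gL v g * deriv (fun v' => p v' g) v := e1
  rw [e1', e2.deriv] at h1
  rw [hS, pc_eq (Ioo_subset_Icc_self hv) hg.le]
  have : (g - gin) / σE * pg VF p v g = - ((gin - g) / σE * pg VF p v g) := by ring
  have : -1 / σE * p v g = - (1 / σE * p v g) := by ring
  linarith

end
end

section

section
variable {VF VE gL gin a σE : ℝ} {p : ℝ → ℝ → ℝ}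

lemma exists_G (hVF : 0 < VF) (h : StatSol VF VE gL gin a σE p) (R : ℝ) :
    ∃ G, R < G ∧ ∀ v, ∀ g, G ≤ g → pc VF p v g ≤ 1 := by
  obtain ⟨G0, hG0⟩ := h.decay 1 one_pos
  refine ⟨max (max G0 0) (R + 1), lt_of_lt_of_le (by linarith) (le_max_right _ _), fun v g hg => ?_⟩
  have h0 : G0 ≤ g := ((le_max_left _ _).trans (le_max_left _ _)).trans hg
  have h1 : 0 ≤ g := ((le_max_right _ _).trans (le_max_left _ _)).trans hg
  refine pc_closed hVF h (Iic 1) isClosed_Iic (fun v hv => ?_) v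
  rw [pc_eq (Ioo_subset_Icc_self hv) h1]
  exact (hG0 g h0 v hv).1.le

lemma p_int (hVF : 0 < VF) (hgL : 0 < gL) (h : StatSol VF VE gL gin a σE p) {q : ℝ} (hq : 1 ≤ q)
    (hd : ∫⁻ x in (Ioo (0:ℝ) VF) ×ˢ (Ioi (0:ℝ)), ENNReal.ofReal ((x.2 + gL) ^ 2 * (p x.1 x.2) ^ q) < ⊤) :
    IntegrableOn (fun x : ℝ × ℝ => (x.2 + gL) ^ 2 * (pc VF p x.1 x.2) ^ q) (Ioo 0 VF ×ˢ Ioi 0) := by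
  have hm : Measurable (fun x : ℝ × ℝ => (x.2 + gL) ^ 2 * (pc VF p x.1 x.2) ^ q) := by
    have h1 : Measurable fun x : ℝ × ℝ => pc VF p x.1 x.2 := pc_m hVF h
    exact Measurable.mul (by fun_prop) (h1.pow_const q)
  refine ⟨hm.aestronglyMeasurable, ?_⟩
  rw [hasFiniteIntegral_iff_ofReal (Eventually.of_forall fun x =>
    mul_nonneg (sq_nonneg _) (rpow_nonneg (pc_nn hVF h _ _) _))]
  refine lt_of_eq_of_lt (setLIntegral_congr_fun (measurableSet_Ioo.prod measurableSet_Ioi) fun x hx => ?_) hd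
  rw [pc_eq (Ioo_subset_Icc_self hx.1) (le_of_lt hx.2)]

lemma pi_int (hVF : 0 < VF) (hgL : 0 < gL) (h : StatSol VF VE gL gin a σE p) {q : ℝ} (hq : 1 ≤ q)
    (hd : ∫⁻ x in (Ioo (0:ℝ) VF) ×ˢ (Ioi (0:ℝ)), ENNReal.ofReal ((x.2 + gL) ^ 2 * (p x.1 x.2) ^ q) < ⊤) (X : ℝ) :
    IntegrableOn (Function.uncurry fun v g => pc VF p v g / mx gin a g) (Ioo 0 VF ×ˢ Ioo 0 X) := by
  have h1 := (p_int hVF hgL h hq hd).mono_set (prod_mono (subset_refl (Ioo 0 VF)) (fun g hg => hg.1 : Ioo 0 X ⊆ Ioi 0))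
  obtain ⟨c, hc⟩ := (isCompact_Icc (a := (0:ℝ)) (b := X)).exists_bound_of_continuousOn
    (f := fun g => (mx gin a g)⁻¹) (((mx_c gin a).inv₀ fun g => (mx_pos _ _ _).ne').continuousOn)
  have hm : Measurable (Function.uncurry fun v g => pc VF p v g / mx gin a g) := by
    have h1 : Measurable fun x : ℝ × ℝ => pc VF p x.1 x.2 := pc_m hVF h
    exact h1.div ((mx_c gin a).measurable.comp measurable_snd)
  have hfin : volume (Ioo 0 VF ×ˢ Ioo 0 X) ≠ ⊤ := by
    rw [Measure.volume_eq_prod, Measure.prod_prod, volume_Ioo, volume_Ioo]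
    exact ENNReal.mul_ne_top ENNReal.ofReal_ne_top ENNReal.ofReal_ne_top
  have h2 : IntegrableOn (fun _ : ℝ × ℝ => (1:ℝ)) (Ioo 0 VF ×ˢ Ioo 0 X) := integrableOn_const hfin
  refine Integrable.mono' ((h2.add (h1.const_mul (1 / gL ^ 2))).const_mul c) hm.aestronglyMeasurable ?_
  refine (ae_restrict_iff' (measurableSet_Ioo.prod measurableSet_Ioo)).2 (Eventually.of_forall fun x hx => ?_)
  have hp := pc_nn hVF h x.1 x.2
  have hmx := mx_pos gin a x.2
  have hcx := hc x.2 (Ioo_subset_Icc_self hx.2)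
  have hg0 : 0 < x.2 := hx.2.1
  simp only [Function.uncurry, Pi.add_apply]
  rw [Real.norm_eq_abs, abs_of_nonneg (div_nonneg hp hmx.le), div_eq_inv_mul]
  have e1 : (mx gin a x.2)⁻¹ ≤ c := by
    rw [Real.norm_eq_abs] at hcx
    exact (le_abs_self _).trans hcx
  have e2 : pc VF p x.1 x.2 ≤ 1 + (pc VF p x.1 x.2) ^ q := by
    rcases le_total (pc VF p x.1 x.2) 1 with h | h
    · have := rpow_nonneg hp q; linarith
    · have : pc VF p x.1 x.2 ^ (1:ℝ) ≤ pc VF p x.1 x.2 ^ q := rpow_le_rpow_of_exponent_le h hq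
      rw [rpow_one] at this; linarith
  have e3 : 1 ≤ 1 / gL ^ 2 * (x.2 + gL) ^ 2 := by
    rw [one_div, ← div_eq_inv_mul, le_div_iff₀ (by positivity), one_mul]
    exact pow_le_pow_left₀ hgL.le (by linarith) 2
  have e4 := mul_le_mul_of_nonneg_right e3 (rpow_nonneg hp q)
  refine mul_le_mul e1 ?_ hp ((inv_pos.2 hmx).le.trans e1)
  rw [← mul_assoc]; linarith

theorem mk_sys (hVF : 0 < VF) (hVE : VF < VE) (hgL : 0 < gL) (hgin : 0 < gin) (ha : 0 < a) (hσ : 0 < σE)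
    (h : StatSol VF VE gL gin a σE p) (hp : ∀ v ∈ Ioo 0 VF, ∀ g ∈ Ici (0:ℝ), 0 < p v g) {q : ℝ} (hq : 1 ≤ q)
    (hd : ∫⁻ x in (Ioo (0:ℝ) VF) ×ˢ (Ioi (0:ℝ)), ENNReal.ofReal ((x.2 + gL) ^ 2 * (p x.1 x.2) ^ q) < ⊤) (R : ℝ) :
    ∃ s : Sys, s.V = VF ∧ R ≤ s.G ∧ (∀ g, s.K g = (a / σE) * mx gin a g) ∧ (∀ g, s.r g = (g + gL) * mx gin a g) ∧
      (∀ v g, s.R v g = mx gin a g * Jflux VE gL v g) ∧ (∀ v g, s.p v g = pc VF p v g / mx gin a g) ∧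
      s.F = Ff VF gin a σE p := by
  set gF := gL * VF / (VE - VF) with hgF
  have gF0 : 0 < gF := div_pos (mul_pos hgL hVF) (by linarith)
  obtain ⟨G, hG, hpG⟩ := exists_G hVF h (max R gF)
  have RG : R < G := (le_max_left _ _).trans_lt hG
  have FG : gF < G := (le_max_right _ _).trans_lt hG
  have G0 : 0 < G := gF0.trans FG
  have mc := mx_c gin a
  have mp := mx_pos gin a
  obtain ⟨c, hc⟩ := (isCompact_Icc (a := G) (b := G + 1)).exists_bound_of_continuousOn
    (f := fun g => (mx gin a g)⁻¹) (((mx_c gin a).inv₀ fun g => (mx_pos _ _ _).ne').continuousOn)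
  obtain ⟨c', hc'⟩ := (isCompact_Icc (a := 0) (b := VF)).exists_bound_of_continuousOn
    (f := fun v => pc VF p v 0) (pc_cv hVF h 0).continuousOn
  have c0 : 0 ≤ c := (norm_nonneg _).trans (hc G ⟨le_rfl, by linarith⟩)
  have c0' : 0 ≤ c' := (norm_nonneg _).trans (hc' 0 ⟨le_rfl, hVF.le⟩)
  have JR : ∀ v g, g * VE * mx gin a g - (g + gL) * mx gin a g * v = mx gin a g * Jflux VE gL v g := by
    intro v g; unfold Jflux; ring
  have aσ : 0 < a / σE := div_pos ha hσ
  have chd : ∀ g, HasDerivAt (fun g => chi (g - G + 1)) (chi1 (g - G + 1)) g := fun g => by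
    have h1 : HasDerivAt (fun g : ℝ => g - G + 1) 1 g := ((hasDerivAt_id' g).sub_const G).add_const 1
    have h2 := HasDerivAt.comp (h₂ := chi) (h := fun g => g - G + 1) g (chi_deriv (g - G + 1)) h1
    exact h2.congr_deriv (by ring)
  have ch1d : ∀ g, HasDerivAt (fun g => chi1 (g - G + 1)) (chi2 (g - G + 1)) g := fun g => by
    have h1 : HasDerivAt (fun g : ℝ => g - G + 1) 1 g := ((hasDerivAt_id' g).sub_const G).add_const 1
    have h2 := HasDerivAt.comp (h₂ := chi1) (h := fun g => g - G + 1) g (chi1_deriv (g - G + 1)) h1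
    exact h2.congr_deriv (by ring)
  have Kd : ∀ g, HasDerivAt (fun g => (a / σE) * mx gin a g) ((a / σE) * (-((g - gin) / a) * mx gin a g)) g :=
    fun g => (mx_der gin ha g).const_mul _
  have cc1 : Continuous fun g : ℝ => chi1 (g - G + 1) := chi1_cont.comp (by fun_prop)
  have cc2 : Continuous fun g : ℝ => chi2 (g - G + 1) := chi2_cont.comp (by fun_prop)
  refine ⟨{ V := VF, G := G, X := G + 1, k0 := c + c' * (mx gin a 0)⁻¹ + 1,
            K := fun g => (a / σE) * mx gin a g
            K1 := fun g => (a / σE) * (-((g - gin) / a) * mx gin a g)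
            ρ := fun g => g * VE * mx gin a g
            r := fun g => (g + gL) * mx gin a g
            ψ := fun g => chi (g - G + 1)
            ψ1 := fun g => chi1 (g - G + 1)
            ψ2 := fun g => (a / σE) * (-((g - gin) / a) * mx gin a g) * chi1 (g - G + 1) +
                (a / σE) * mx gin a g * chi2 (g - G + 1)
            γ := fun v => gL * v / (VE - v)
            p := fun v g => pc VF p v g / mx gin a g
            F := Ff VF gin a σE p
            S := Sf VF gin a σE p
            pv := fun v g => deriv (fun v' => p v' g) v / mx gin a g
            hV := hVF, hG := G0, hGX := by linarith
            hk0 := by have := mp 0; positivity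
            Kpos := fun g => mul_pos aσ (mp g)
            Kder := Kd
            K1c := by fun_prop
            ρc := by fun_prop
            rc := by fun_prop
            rnn := fun g hg => mul_nonneg (by linarith [hg.1]) (mp g).le
            ψder := chd
            ψ1c := cc1
            ψ1der := fun g => (Kd g).mul (ch1d g)
            ψ2c := by fun_prop
            ψnn := fun g => chi_nonneg _
            ψle := fun g => chi_le_one _
            ψlow := fun g hg => chi_one (by linarith)
            ψ1low := fun g hg => chi1_low (by linarith)
            ψ2low := fun g hg => by
              rw [chi1_low (by linarith), chi2_low (by linarith)]; ring
            ψX := chi_zero (by linarith)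
            ψ1X := chi1_high (by linarith)
            γc := ?_, γmem := ?_, γpos := ?_, γneg := ?_
            pnn := fun v g => div_nonneg (pc_nn hVF h v g) (mp g).le
            ppos := fun v hv g hg => div_pos (by
              rw [pc_eq (Ioo_subset_Icc_self hv) hg.1]; exact hp v hv g hg.1) (mp g)
            pcv := fun g => (pc_cv hVF h g).div_const _
            pcg := fun v hv => ((pc_cd h hv).continuousOn.mono Icc_subset_Ici_self).div mc.continuousOn fun g _ => (mp g).ne'
            pder := ?_
            Fc := fun v hv => (Ff_cd h hv).continuousOn.mono Icc_subset_Ici_self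
            F0 := fun v hv => Ff_0 hgin h hv (hp v hv 0 (by simp))
            Fder := fun v hv g hg => Ff_der h hv hg.1
            Sc := fun v hv => (Sf_c h hv).mono Icc_subset_Ici_self
            pvder := fun v hv g hg => (pv_der h hv hg.1).div_const _
            eqn := ?_, pk0 := ?_, pk00 := ?_
            pm := (pc_m hVF h).div (mc.measurable.comp measurable_snd)
            Fm := Ff_m hVF h
            Sm := Sf_m hVF h
            pint := pi_int hVF hgL h hq hd _ }, rfl, RG.le, fun g => rfl, fun g => rfl, JR, fun v g => rfl, rfl⟩
  · exact ContinuousOn.div (by fun_prop) (by fun_prop) fun v hv => by have := hv.2; linarith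
  · intro v hv
    have h1 : 0 < VE - v := by have := hv.2; linarith
    refine ⟨div_pos (mul_pos hgL hv.1) h1, lt_trans ?_ FG⟩
    rw [hgF]
    exact div_lt_div₀ (mul_lt_mul_of_pos_left hv.2 hgL) (by linarith [hv.2]) (mul_pos hgL hVF).le (by linarith)
  · intro v hv g hg hγ
    have h1 : 0 < VE - v := by have := hv.2; linarith
    rw [JR]
    refine mul_nonneg (mp g).le ?_
    rw [div_le_iff₀ h1] at hγ
    unfold Jflux; linarith
  · intro v hv g hg hγ
    have h1 : 0 < VE - v := by have := hv.2; linarith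
    rw [JR]
    refine mul_nonpos_of_nonneg_of_nonpos (mp g).le ?_
    rw [le_div_iff₀ h1] at hγ
    unfold Jflux; linarith
  · intro v hv g hg
    refine ((pc_der h hv hg.1).div (mx_der gin ha g) (mp g).ne').congr_deriv ?_
    have := (mp g).ne'
    unfold Ff
    field_simp
    ring
  · intro v hv g hg
    have := p_eqn h hv hg.1
    have hm := (mp g).ne'
    rw [JR]
    have e1 : mx gin a g * Jflux VE gL v g * (deriv (fun v' => p v' g) v / mx gin a g) =
      Jflux VE gL v g * deriv (fun v' => p v' g) v := by field_simp
    have e2 : (g + gL) * mx gin a g * (pc VF p v g / mx gin a g) = (g + gL) * pc VF p v g := by field_simp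
    rw [e1, e2, this]
  · intro v g hg
    have h1 := hpG v g hg.1
    have h2 := hc g hg
    rw [Real.norm_eq_abs] at h2
    have h3 := (le_abs_self _).trans h2
    have h4 : pc VF p v g / mx gin a g ≤ (mx gin a g)⁻¹ := by
      rw [div_eq_mul_inv]
      have := mul_le_mul_of_nonneg_right h1 (inv_pos.2 (mp g)).le
      linarith
    have : 0 ≤ c' * (mx gin a 0)⁻¹ := by have := mp 0; positivity
    linarith
  · intro v
    have h2 := hc' _ (clm_mem hVF v)
    have h4 : pc VF p (clm VF v) 0 = pc VF p v 0 := by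
      unfold pc; rw [clm_eq (clm_mem hVF v)]
    rw [h4, Real.norm_eq_abs] at h2
    have h3 := (le_abs_self _).trans h2
    have := mul_le_mul_of_nonneg_right h3 (inv_pos.2 (mp 0)).le
    rw [div_eq_mul_inv]
    linarith

end
end

section

section
variable {VF VE gL gin a σE : ℝ} {p : ℝ → ℝ → ℝ}

theorem main_k (hVF : 0 < VF) (hVE : VF < VE) (hgL : 0 < gL) (hgin : 0 < gin) (ha : 0 < a) (hσ : 0 < σE)
    (h : StatSol VF VE gL gin a σE p) (hp : ∀ v ∈ Ioo 0 VF, ∀ g ∈ Ici (0:ℝ), 0 < p v g) {q k CB R : ℝ} (hq : 1 < q)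
    (hk : 0 < k) (hR : 1 ≤ R) (hCB : 0 ≤ CB)
    (hW : ∀ R G : ℝ, 1 ≤ R → 2 * R ≤ G → Wt a σE gin gL G CB (wR R) (wR1 R) (wR2 R))
    (hd : ∫⁻ x in (Ioo (0:ℝ) VF) ×ˢ (Ioi (0:ℝ)), ENNReal.ofReal ((x.2 + gL) ^ 2 * (p x.1 x.2) ^ q) < ⊤) :
    ∃ X, R ≤ X ∧ ∫⁻ x in (Ioo (0:ℝ) VF) ×ˢ (Ioc (0:ℝ) X),
      ENNReal.ofReal ((a / σE) * wR R x.2 * bk1 q k (pc VF p x.1 x.2) * (pg VF p x.1 x.2) ^ 2) ≤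
      ENNReal.ofReal (CB * q) *
        ∫⁻ x in (Ioo (0:ℝ) VF) ×ˢ (Ioi (0:ℝ)), ENNReal.ofReal ((x.2 + gL) ^ 2 * (p x.1 x.2) ^ q) := by
  obtain ⟨s, sV, sG, sK, sr, sR, sp, sF⟩ := mk_sys hVF hVE hgL hgin ha hσ h hp hq.le hd (2 * R)
  have mp := mx_pos gin a
  have smp : ∀ v g, mx gin a g * s.p v g = pc VF p v g := fun v g => by
    rw [sp]; have := (mp g).ne'; field_simp
  have X0 := s.hX
  have GX := s.hGX
  have hB := Bq_k hq hk
  have J0 : ∀ g, Jflux VE gL 0 g = g * VE := fun g => by unfold Jflux; ring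
  have m0 : (0:ℝ) ∈ Icc 0 VF := ⟨le_rfl, hVF.le⟩
  have mV : VF ∈ Icc 0 VF := ⟨hVF.le, le_rfl⟩
  have VEF : 0 < VE - VF := by linarith
  have low : ∀ g, 0 < g → g < gL * VF / (VE - VF) → pc VF p 0 g = 0 ∧ pc VF p VF g = 0 := by
    intro g hg hlt
    obtain ⟨b1, b2⟩ := h.bc_v_low g ⟨hg, hlt⟩
    rw [pc_eq m0 hg.le, pc_eq mV hg.le]
    rw [J0] at b1
    refine ⟨(mul_eq_zero.1 b1).resolve_left (mul_pos hg (hVF.trans hVE)).ne', (mul_eq_zero.1 b2).resolve_left ?_⟩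
    rw [lt_div_iff₀ VEF] at hlt
    unfold Jflux; intro h0; linarith
  have hJ : ∀ g, 0 < g → Jflux VE gL VF g * pc VF p VF g = Jflux VE gL 0 g * pc VF p 0 g := by
    intro g hg
    rcases lt_or_ge g (gL * VF / (VE - VF)) with hlt | hge
    · rw [(low g hg hlt).1, (low g hg hlt).2]; simp
    · rw [pc_eq m0 hg.le, pc_eq mV hg.le]; exact (h.bc_v_high g hge).symm
  have hR0 : ∀ g ∈ Icc 0 s.X, 0 ≤ s.R 0 g := fun g hg => by
    rw [sR, J0]; exact mul_nonneg (mp g).le (mul_nonneg hg.1 (hVF.trans hVE).le)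
  have hRV : ∀ g ∈ Ioc 0 s.X, s.R s.V g * s.p s.V g = s.R 0 g * s.p 0 g := fun g hg => by
    have e := hJ g hg.1
    rw [sV, sR, sR]
    calc _ = Jflux VE gL VF g * (mx gin a g * s.p VF g) := by ring
      _ = Jflux VE gL 0 g * (mx gin a g * s.p 0 g) := by rw [smp, smp, e]
      _ = _ := by ring
  have hbd : ∀ g ∈ Ioc 0 s.X, s.R 0 g * βk q k (mx gin a g * s.p 0 g) ≤ s.R s.V g * βk q k (mx gin a g * s.p s.V g) := by
    intro g hg
    rw [sV, smp, smp, sR, sR]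
    rcases lt_or_ge g (gL * VF / (VE - VF)) with hlt | hge
    · rw [(low g hg.1 hlt).1, (low g hg.1 hlt).2, hB.β0]; simp
    · have hge' := hge
      rw [div_le_iff₀ VEF] at hge'
      have JV : 0 ≤ Jflux VE gL VF g := by unfold Jflux; linarith
      refine bdry_ineq hq hk (pc_nn hVF h _ _) (pc_nn hVF h _ _) (mul_nonneg (mp g).le JV) ?_ ?_
      · refine mul_le_mul_of_nonneg_left ?_ (mp g).le
        rw [J0]; unfold Jflux
        have := mul_pos hgL hVF
        have := mul_pos hg.1 hVF
        linarith
      · rw [mul_assoc, mul_assoc, hJ g hg.1]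
  -- integrability
  have hI : Integrable (fun x : ℝ × ℝ => (x.2 + gL) ^ 2 * (pc VF p x.1 x.2) ^ q)
      ((volume.restrict (Ioo 0 VF)).prod (volume.restrict (Ioc 0 s.X))) := by
    rw [Measure.prod_restrict, ← Measure.volume_eq_prod]
    exact (p_int hVF hgL h hq.le hd).mono_set
      (prod_mono (subset_refl (Ioo 0 VF)) (fun g hg => hg.1 : Ioc 0 s.X ⊆ Ioi 0))
  have dqe : s.dq gin a gL q = fun v => ∫ g in Ioc 0 s.X, (g + gL) ^ 2 * (pc VF p v g) ^ q := by
    funext v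
    unfold Sys.dq
    rw [intervalIntegral.integral_of_le X0.le]
    refine integral_congr_ae (Eventually.of_forall fun g => ?_)
    simp only [smp]
  have hqI : IntervalIntegrable (s.dq gin a gL q) volume 0 s.V := by
    rw [sV, intervalIntegrable_iff_integrableOn_Ioo_of_le hVF.le, dqe]
    exact hI.integral_prod_left
  have main := s.L11 ha hσ hgin hgL sK sr (hW R s.G hR sG) hB hR0 hRV hbd hqI
  refine ⟨s.X, by linarith, ?_⟩
  have e1 : ∫⁻ x in (Ioo (0:ℝ) VF) ×ˢ (Ioc (0:ℝ) s.X),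
      ENNReal.ofReal ((a / σE) * wR R x.2 * bk1 q k (pc VF p x.1 x.2) * (pg VF p x.1 x.2) ^ 2) =
      ∫⁻ x, ENNReal.ofReal ((a/σE)*wR R x.2*bk1 q k (mx gin a x.2*s.p x.1 x.2)*
        (-((x.2-gin)/a)*(mx gin a x.2*s.p x.1 x.2)+mx gin a x.2*(s.F x.1 x.2/s.K x.2))^2)
        ∂((volume.restrict (Ioo 0 s.V)).prod (volume.restrict (Ioc 0 s.X))) := by
    rw [sV, Measure.prod_restrict, ← Measure.volume_eq_prod]
    refine lintegral_congr fun x => ?_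
    have e2 : -((x.2-gin)/a)*(mx gin a x.2*s.p x.1 x.2)+mx gin a x.2*(s.F x.1 x.2/s.K x.2) = pg VF p x.1 x.2 := by
      rw [smp, sK, sF]
      have := (mp x.2).ne'
      unfold Ff
      field_simp
      ring
    rw [e2, smp]
  rw [e1]
  refine main.trans ?_
  rw [ENNReal.ofReal_mul (by positivity)]
  gcongr
  rw [sV, dqe, intervalIntegral.integral_of_le hVF.le, integral_Ioc_eq_integral_Ioo]
  have e3 := integral_prod _ hI
  simp only at e3
  rw [← e3, ofReal_integral_eq_lintegral_ofReal hI (Eventually.of_forall fun x =>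
    mul_nonneg (sq_nonneg _) (rpow_nonneg (pc_nn hVF h _ _) _)), Measure.prod_restrict, ← Measure.volume_eq_prod]
  have e4 : ∫⁻ x in (Ioo (0:ℝ) VF) ×ˢ (Ioi (0:ℝ)), ENNReal.ofReal ((x.2 + gL) ^ 2 * (p x.1 x.2) ^ q) =
      ∫⁻ x in (Ioo (0:ℝ) VF) ×ˢ (Ioi (0:ℝ)), ENNReal.ofReal ((x.2 + gL) ^ 2 * (pc VF p x.1 x.2) ^ q) :=
    setLIntegral_congr_fun (measurableSet_Ioo.prod measurableSet_Ioi) fun x hx => by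
      rw [pc_eq (Ioo_subset_Icc_self hx.1) (le_of_lt hx.2)]
  rw [e4]
  exact lintegral_mono_set (prod_mono (subset_refl (Ioo 0 VF)) (fun g hg => hg.1 : Ioc 0 s.X ⊆ Ioi 0))

lemma bk1_meas {q k : ℝ} : Measurable (bk1 q k) := by
  have e1 : Measurable fun x : ℝ => k * |x| / (k + |x|) := by fun_prop
  have e2 : Measurable fun x : ℝ => (k / (k + |x|)) ^ 2 := by fun_prop
  exact ((e1.pow_const (q - 2)).const_mul _).mul e2

lemma bk1_lim {q x : ℝ} (hx : 0 < x) :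
    Tendsto (fun n : ℕ => bk1 q ((n:ℝ) + 1) x) atTop (𝓝 (q * (q - 1) * x ^ (q - 2))) := by
  have h0 : Tendsto (fun n : ℕ => ((n:ℝ) + 1)) atTop atTop := tendsto_atTop_add_const_right _ _ tendsto_natCast_atTop_atTop
  have h1 : Tendsto (fun n : ℕ => ((n:ℝ) + 1) / ((n:ℝ) + 1 + |x|)) atTop (𝓝 1) := by
    have h2 : Tendsto (fun n : ℕ => 1 - |x| / ((n:ℝ) + 1 + |x|)) atTop (𝓝 (1 - 0)) :=
      ((tendsto_atTop_add_const_right _ _ h0).const_div_atTop _).const_sub 1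
    rw [sub_zero] at h2
    refine h2.congr fun n => ?_
    have : (n:ℝ) + 1 + |x| ≠ 0 := by positivity
    field_simp; ring
  have h3 : Tendsto (fun n : ℕ => ((n:ℝ) + 1) * |x| / ((n:ℝ) + 1 + |x|)) atTop (𝓝 x) := by
    have := h1.mul_const |x|
    rw [one_mul, abs_of_pos hx] at this
    refine this.congr fun n => ?_
    rw [abs_of_pos hx]; ring
  have h4 := ((h3.rpow_const (p := q - 2) (Or.inl hx.ne')).const_mul (q * (q - 1))).mul (h1.pow 2)
  rw [one_pow, mul_one] at h4
  exact h4

lemma wR_lim (g : ℝ) : Tendsto (fun n : ℕ => wR ((n:ℝ) + 1) g) atTop (𝓝 (g + exp (-g))) := by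
  have h0 : Tendsto (fun n : ℕ => ((n:ℝ) + 1)) atTop atTop := tendsto_atTop_add_const_right _ _ tendsto_natCast_atTop_atTop
  refine tendsto_const_nhds.congr' ?_
  filter_upwards [h0.eventually_ge_atTop g] with n hn
  unfold wR
  rw [chi_one (by rw [div_le_one (by positivity)]; exact hn), mul_one]

lemma wR_c (R : ℝ) : Continuous (wR R) := by
  have : Continuous fun g => chi (g / R) := chi_cont.comp (by fun_prop)
  unfold wR; fun_prop

theorem main_lim (hVF : 0 < VF) (hVE : VF < VE) (hgL : 0 < gL) (hgin : 0 < gin) (ha : 0 < a) (hσ : 0 < σE)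
    (h : StatSol VF VE gL gin a σE p) (hp : ∀ v ∈ Ioo 0 VF, ∀ g ∈ Ici (0:ℝ), 0 < p v g) {q CB : ℝ} (hq : 1 < q)
    (hCB : 0 ≤ CB)
    (hW : ∀ R G : ℝ, 1 ≤ R → 2 * R ≤ G → Wt a σE gin gL G CB (wR R) (wR1 R) (wR2 R))
    (hd : ∫⁻ x in (Ioo (0:ℝ) VF) ×ˢ (Ioi (0:ℝ)), ENNReal.ofReal ((x.2 + gL) ^ 2 * (p x.1 x.2) ^ q) < ⊤) :
    ∫⁻ x in (Ioo (0:ℝ) VF) ×ˢ (Ioi (0:ℝ)),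
      ENNReal.ofReal ((a / σE) * (x.2 + exp (-x.2)) * (q * (q - 1) * (pc VF p x.1 x.2) ^ (q - 2)) * (pg VF p x.1 x.2) ^ 2) ≤
      ENNReal.ofReal (CB * q) *
        ∫⁻ x in (Ioo (0:ℝ) VF) ×ˢ (Ioi (0:ℝ)), ENNReal.ofReal ((x.2 + gL) ^ 2 * (p x.1 x.2) ^ q) := by
  have hn : ∀ n : ℕ, _ := fun n => main_k hVF hVE hgL hgin ha hσ h hp (k := (n:ℝ) + 1) (R := (n:ℝ) + 1) hq
    (by positivity) (by have : (0:ℝ) ≤ n := Nat.cast_nonneg n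
                        linarith) hCB hW hd
  choose X hX hXI using hn
  set f : ℕ → ℝ × ℝ → ℝ≥0∞ := fun n x => ENNReal.ofReal ((a / σE) * wR ((n:ℝ) + 1) x.2 *
    bk1 q ((n:ℝ) + 1) (pc VF p x.1 x.2) * (pg VF p x.1 x.2) ^ 2) with hf
  have pcm : Measurable fun x : ℝ × ℝ => pc VF p x.1 x.2 := pc_m hVF h
  have pgm : Measurable fun x : ℝ × ℝ => pg VF p x.1 x.2 := pg_m hVF h
  have fm : ∀ n, Measurable (f n) := fun n => by
    refine ENNReal.measurable_ofReal.comp ?_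
    have m1 : Measurable fun x : ℝ × ℝ => wR ((n:ℝ) + 1) x.2 := (wR_c _).measurable.comp measurable_snd
    exact ((m1.const_mul _).mul (bk1_meas.comp pcm)).mul (pgm.pow_const 2)
  have sm : ∀ n, MeasurableSet (Ioo (0:ℝ) VF ×ˢ Ioc (0:ℝ) (X n)) := fun n => measurableSet_Ioo.prod measurableSet_Ioc
  have fat := lintegral_liminf_le (u := atTop) (μ := volume.restrict (Ioo (0:ℝ) VF ×ˢ Ioi (0:ℝ)))
    (f := fun n => (Ioo (0:ℝ) VF ×ˢ Ioc (0:ℝ) (X n)).indicator (f n)) (fun n => (fm n).indicator (sm n))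
  refine le_trans (le_trans (le_of_eq ?_) fat) ?_
  · refine setLIntegral_congr_fun (measurableSet_Ioo.prod measurableSet_Ioi) fun x hx => ?_
    have hp0 : 0 < pc VF p x.1 x.2 := by
      rw [pc_eq (Ioo_subset_Icc_self hx.1) (le_of_lt hx.2)]
      exact hp _ hx.1 _ (mem_Ici.2 (le_of_lt hx.2))
    have l1 : Tendsto (fun n => f n x) atTop (𝓝 (ENNReal.ofReal ((a / σE) * (x.2 + exp (-x.2)) *
        (q * (q - 1) * (pc VF p x.1 x.2) ^ (q - 2)) * (pg VF p x.1 x.2) ^ 2))) :=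
      (ENNReal.continuous_ofReal.tendsto _).comp
        ((((wR_lim x.2).const_mul (a / σE)).mul (bk1_lim hp0)).mul_const _)
    have l2 : Tendsto (fun n => (Ioo (0:ℝ) VF ×ˢ Ioc (0:ℝ) (X n)).indicator (f n) x) atTop
        (𝓝 (ENNReal.ofReal ((a / σE) * (x.2 + exp (-x.2)) *
        (q * (q - 1) * (pc VF p x.1 x.2) ^ (q - 2)) * (pg VF p x.1 x.2) ^ 2))) := by
      refine l1.congr' ?_
      have h0 : Tendsto (fun n : ℕ => ((n:ℝ) + 1)) atTop atTop :=
        tendsto_atTop_add_const_right _ _ tendsto_natCast_atTop_atTop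
      filter_upwards [h0.eventually_ge_atTop x.2] with n hn
      rw [indicator_of_mem]
      exact ⟨hx.1, hx.2, hn.trans (hX n)⟩
    exact l2.liminf_eq.symm
  · refine liminf_le_of_le (by isBoundedDefault) fun b hb => ?_
    obtain ⟨n, hn⟩ := hb.exists
    refine hn.trans (le_trans ?_ (hXI n))
    rw [lintegral_indicator (sm n), Measure.restrict_restrict (sm n)]
    exact lintegral_mono_set inter_subset_left

end

end

end

/-- weighted dissipation bound `∫∫ (g+g_L) |∂_g p^{q/2}|² ≤ C q d_q`,
with `C` independent of `q`. -/
theorem stmt9 (VF VE gL gin a σE : ℝ)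
    (hVF : 0 < VF) (hVE : VF < VE) (hgL : 0 < gL) (hgin : 0 < gin)
    (ha : 0 < a) (hσE : 0 < σE) :
    ∃ C : ℝ, ∀ (p : ℝ → ℝ → ℝ), StatSol VF VE gL gin a σE p →
      (∀ v ∈ Ioo 0 VF, ∀ g ∈ Ici (0:ℝ), 0 < p v g) →
      ∀ q : ℝ, 4 / 3 ≤ q →
      (∫⁻ x in (Ioo (0:ℝ) VF) ×ˢ (Ioi (0:ℝ)),
        ENNReal.ofReal ((x.2 + gL) ^ 2 * (p x.1 x.2) ^ q) < ⊤) →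
      (∀ ε > 0, ∃ G : ℝ, ∀ g ∈ Ici G, ∀ v ∈ Ioo 0 VF,
        (p v g) ^ q < ε ∧ g ^ 2 * (p v g) ^ q < ε ∧
          |deriv (fun g' => (p v g') ^ q) g| < ε) →
      (∫⁻ x in (Ioo (0:ℝ) VF) ×ˢ (Ioi (0:ℝ)),
          ENNReal.ofReal ((x.2 + gL) * (deriv (fun g' => (p x.1 g') ^ (q / 2)) x.2) ^ 2)) ≤
      ENNReal.ofReal (C * q) *
        ∫⁻ x in (Ioo (0:ℝ) VF) ×ˢ (Ioi (0:ℝ)),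
          ENNReal.ofReal ((x.2 + gL) ^ 2 * (p x.1 x.2) ^ q) := by
  obtain ⟨CB, CB0, hW⟩ := exists_Wt ha hσE hgin hgL
  refine ⟨(1 + gL) * (σE / a) * CB, fun p h hp q hq hd _ => ?_⟩
  have q0 : 0 < q := by linarith
  have main := main_lim hVF hVE hgL hgin ha hσE h hp (q := q) (by linarith) CB0 hW hd
  have D0 : 0 ≤ (1 + gL) * (σE / a) := by positivity
  calc _ ≤ ∫⁻ x in (Ioo (0:ℝ) VF) ×ˢ (Ioi (0:ℝ)), ENNReal.ofReal ((1 + gL) * (σE / a)) * ENNReal.ofReal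
        ((a / σE) * (x.2 + exp (-x.2)) * (q * (q - 1) * (pc VF p x.1 x.2) ^ (q - 2)) * (pg VF p x.1 x.2) ^ 2) := by
        refine setLIntegral_mono' (measurableSet_Ioo.prod measurableSet_Ioi) fun x hx => ?_
        rw [← ENNReal.ofReal_mul D0]
        refine ENNReal.ofReal_le_ofReal ?_
        have hg : 0 < x.2 := hx.2
        have P0 := hp x.1 hx.1 x.2 hg.le
        have e1 := ((p_der h hx.1 hg).rpow_const (p := q / 2) (Or.inl P0.ne')).deriv
        have e1' : deriv (fun g' => (p x.1 g') ^ (q / 2)) x.2 =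
          pg VF p x.1 x.2 * (q / 2) * p x.1 x.2 ^ (q / 2 - 1) := e1
        rw [e1', pc_eq (Ioo_subset_Icc_self hx.1) hg.le]
        have e2 : (p x.1 x.2 ^ (q / 2 - 1)) ^ 2 = p x.1 x.2 ^ (q - 2) := by
          rw [← rpow_natCast, ← rpow_mul P0.le]; congr 1; push_cast; ring
        have hP := rpow_nonneg P0.le (q - 2)
        have eg : x.2 + gL ≤ (1 + gL) * (x.2 + exp (-x.2)) := by
          have h1 := add_one_le_exp (-x.2)
          have h2 := exp_pos (-x.2)
          have h3 : 1 ≤ x.2 + exp (-x.2) := by linarith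
          have h4 := mul_le_mul_of_nonneg_left h3 hgL.le
          linarith
        have eq' : q ^ 2 / 4 ≤ q * (q - 1) := by
          have : 0 ≤ q * (3 * q - 4) := mul_nonneg q0.le (by linarith)
          linarith
        calc (x.2 + gL) * (pg VF p x.1 x.2 * (q / 2) * p x.1 x.2 ^ (q / 2 - 1)) ^ 2
            = (x.2 + gL) * (q ^ 2 / 4) * (p x.1 x.2 ^ (q - 2) * (pg VF p x.1 x.2) ^ 2) := by rw [← e2]; ring
          _ ≤ ((1 + gL) * (x.2 + exp (-x.2))) * (q * (q - 1)) * (p x.1 x.2 ^ (q - 2) * (pg VF p x.1 x.2) ^ 2) := by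
              refine mul_le_mul_of_nonneg_right (mul_le_mul eg eq' (by positivity) ?_) (by positivity)
              have := exp_pos (-x.2)
              positivity
          _ = _ := by field_simp
    _ = ENNReal.ofReal ((1 + gL) * (σE / a)) * ∫⁻ x in (Ioo (0:ℝ) VF) ×ˢ (Ioi (0:ℝ)), ENNReal.ofReal
        ((a / σE) * (x.2 + exp (-x.2)) * (q * (q - 1) * (pc VF p x.1 x.2) ^ (q - 2)) * (pg VF p x.1 x.2) ^ 2) :=
        lintegral_const_mul' _ _ ENNReal.ofReal_ne_top
    _ ≤ ENNReal.ofReal ((1 + gL) * (σE / a)) * (ENNReal.ofReal (CB * q) *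
        ∫⁻ x in (Ioo (0:ℝ) VF) ×ˢ (Ioi (0:ℝ)), ENNReal.ofReal ((x.2 + gL) ^ 2 * (p x.1 x.2) ^ q)) := by
        gcongr
    _ = _ := by
        rw [← mul_assoc, ← ENNReal.ofReal_mul D0]
        congr 2
        ring
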